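/- Let k be an algebraically closed field of characteristic zero, let n ≥ 4 and d ≥ 1 be integers and s ≥ 0. Then there exist a plane Π (a 3-dimensional linear subspace of k^{n+1}) and s lines L_1,…,L_s (2-dimensional linear subspaces of k^{n+1}) such that the lines are pairwise disjoint and each is disjoint from Π (all pairwise intersections of the subspaces are 0), and the ideal I_X = I(Π) ∩ I(L_1) ∩ ⋯ ∩ I(L_s) satisfies dim (I_X)_d = max{ C(d+n,n) − C(d+2,2) − s(d+1), 0 }. (This is the statement that a generic union of one plane and s generic lines in P^n has bipolynomial Hilbert function.) -/

import Mathlib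

open MvPolynomial

noncomputable def vanIdeal (k : Type) [Field k] (N : ℕ) (V : Set (Fin N → k)) :
    Ideal (MvPolynomial (Fin N) k) where
  carrier := {f | ∀ v ∈ V, MvPolynomial.eval v f = 0}
  add_mem' := by
    intro f g hf hg v hv
    simp only [Set.mem_setOf_eq] at *
    simp [map_add, hf v hv, hg v hv]
  zero_mem' := by
    intro v hv
    simp
  smul_mem' := by
    intro c f hf v hv
    simp only [Set.mem_setOf_eq] at *
    simp [smul_eq_mul, hf v hv]

noncomputable def hdim (k : Type) [Field k] (N : ℕ)
    (I : Ideal (MvPolynomial (Fin N) k)) (d : ℕ) : ℕ :=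
  Module.finrank k
    ↥(Submodule.restrictScalars k
        (I : Submodule (MvPolynomial (Fin N) k) (MvPolynomial (Fin N) k))
      ⊓ MvPolynomial.homogeneousSubmodule (Fin N) k d)

namespace BP
open Module

section LinAlg
variable {k : Type} [Field k] {M G : Type} [AddCommGroup M] [Module k M] [AddCommGroup G] [Module k G]

theorem exists_dual_fam {r : ℕ} (ψ : Fin r → Dual k M) (h : LinearIndependent k ψ) :
    ∃ f : Fin r → M, ∀ i j, ψ i (f j) = if i = j then 1 else 0 := by
  have hs : Function.Surjective (LinearMap.pi ψ : M →ₗ[k] (Fin r → k)) := by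
    rw [← LinearMap.range_eq_top]
    by_contra hne
    obtain ⟨g, hg0, hg⟩ := Submodule.exists_le_ker_of_lt_top _ (lt_top_iff_ne_top.2 hne)
    apply hg0
    have : ∑ i, g (Pi.single i 1) • ψ i = 0 := by
      ext m
      have h1 : g (LinearMap.pi ψ m) = 0 := hg ⟨m, rfl⟩
      rw [LinearMap.pi_apply_eq_sum_univ g] at h1
      simp only [LinearMap.pi_apply, smul_eq_mul] at h1
      simp only [LinearMap.sum_apply, LinearMap.smul_apply, smul_eq_mul, LinearMap.zero_apply]
      rw [← h1]
      refine Finset.sum_congr rfl fun i _ => ?_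
      rw [mul_comm]
      congr 2
      ext j
      simp [Pi.single_apply, eq_comm]
    have h2 := Fintype.linearIndependent_iff.1 h _ this
    refine LinearMap.pi_ext' fun i => LinearMap.ext_ring ?_
    simpa using h2 i
  choose f hf using fun j => hs (Pi.single j 1)
  refine ⟨f, fun i j => ?_⟩
  have := congrFun (hf j) i
  simp only [LinearMap.pi_apply] at this
  rw [this, Pi.single_apply]

/-- membership in a space of functionals by double annihilators -/
theorem mem_of_ann [FiniteDimensional k M] (U : Submodule k (Dual k M)) (φ : Dual k M)
    (h : ∀ f, (∀ ψ ∈ U, ψ f = 0) → φ f = 0) : φ ∈ U := by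
  rw [← Subspace.dualCoannihilator_dualAnnihilator_eq (W := U), Submodule.mem_dualAnnihilator]
  intro w hw
  exact h w (fun ψ hψ => (Submodule.mem_dualCoannihilator w).1 hw ψ hψ)

/-- Horace inequality -/
theorem horace [FiniteDimensional k M] (μ : G →ₗ[k] M) (A B : Submodule k (Dual k M))
    (hA : ∀ φ ∈ A, φ ∘ₗ μ = 0) :
    finrank k A + finrank k (B.map μ.dualMap) ≤ finrank k ↥(A ⊔ B) := by
  set f := μ.dualMap.domRestrict (A ⊔ B)
  have h1 := LinearMap.finrank_range_add_finrank_ker (K := k) (V := ↥(A ⊔ B)) (V₂ := Dual k G) f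
  have h2 : B.map μ.dualMap ≤ LinearMap.range f := by
    rintro _ ⟨b, hb, rfl⟩
    exact ⟨⟨b, Submodule.mem_sup_right hb⟩, rfl⟩
  have h3 := Submodule.finrank_mono h2
  have h4 : finrank k A ≤ finrank k (LinearMap.ker f) := by
    let g : A →ₗ[k] LinearMap.ker f := LinearMap.codRestrict _
      (Submodule.inclusion (le_sup_left : A ≤ A ⊔ B)) (by
        intro a
        rw [LinearMap.mem_ker]
        exact hA a a.2)
    apply LinearMap.finrank_le_finrank_of_injective (f := g)
    intro a b hab
    have := congrArg (fun x => ((x : LinearMap.ker f) : ↥(A ⊔ B)).1) hab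
    exact Subtype.ext this
  omega

theorem finrank_map_dualMap_of_surj [FiniteDimensional k M] (μ : G →ₗ[k] M)
    (hμ : Function.Surjective μ) (A : Submodule k (Dual k M)) :
    finrank k (A.map μ.dualMap) = finrank k A :=
  (LinearEquiv.finrank_eq (Submodule.equivMapOfInjective μ.dualMap
    (LinearMap.dualMap_injective_of_surjective hμ) A)).symm

theorem finrank_le_dim [FiniteDimensional k M] (U : Submodule k (Dual k M)) :
    finrank k U ≤ finrank k M := by
  rw [← Subspace.dual_finrank_eq (K := k) (V := M)]
  exact Submodule.finrank_le U

/-- adding generic functionals -/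
theorem add_generic [FiniteDimensional k M] {Z : Type} (G : Z → Dual k M)
    (hG : Submodule.span k (Set.range G) = ⊤) (z0 : Z) (U : Submodule k (Dual k M)) (j : ℕ) :
    ∃ z : Fin j → Z, min (finrank k M) (finrank k U + j) ≤
      finrank k ↥(U ⊔ Submodule.span k (Set.range (G ∘ z))) := by
  induction j with
  | zero =>
    refine ⟨Fin.elim0, ?_⟩
    refine le_trans (min_le_right _ _) ?_
    exact Submodule.finrank_mono le_sup_left
  | succ j ih =>
    obtain ⟨z, hz⟩ := ih
    set U' := U ⊔ Submodule.span k (Set.range (G ∘ z))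
    have key : ∃ w, min (finrank k M) (finrank k U' + 1) ≤
        finrank k ↥(U' ⊔ Submodule.span k {G w}) := by
      by_cases hU : ∃ w, G w ∉ U'
      · obtain ⟨w, hw⟩ := hU
        refine ⟨w, (min_le_right _ _).trans ?_⟩
        have : U' < U' ⊔ Submodule.span k {G w} := by
          refine lt_of_le_of_ne le_sup_left fun h => hw ?_
          rw [h]
          exact Submodule.mem_sup_right (Submodule.mem_span_singleton_self _)
        exact Submodule.finrank_lt_finrank_of_lt this
      · push Not at hU
        have : U' = ⊤ := by
          rw [eq_top_iff, ← hG, Submodule.span_le]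
          rintro _ ⟨w, rfl⟩
          exact hU w
        refine ⟨z0, (min_le_left _ _).trans ?_⟩
        rw [this, top_sup_eq, finrank_top, Subspace.dual_finrank_eq]
    obtain ⟨w, hw⟩ := key
    refine ⟨Fin.snoc z w, ?_⟩
    have hle : U' ⊔ Submodule.span k {G w} ≤
        U ⊔ Submodule.span k (Set.range (G ∘ (Fin.snoc z w : Fin (j+1) → Z))) := by
      refine sup_le (sup_le le_sup_left ?_) ?_
      · refine le_trans (Submodule.span_mono ?_) le_sup_right
        rintro _ ⟨i, rfl⟩
        exact ⟨i.castSucc, by simp⟩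
      · refine le_trans (Submodule.span_mono ?_) le_sup_right
        rintro _ rfl
        exact ⟨Fin.last j, by simp⟩
    have := Submodule.finrank_mono hle
    have h0 := finrank_le_dim U'
    omega

theorem add_generic' [FiniteDimensional k M] {Z : Type} (G : Z → Dual k M)
    (hG : Submodule.span k (Set.range G) = ⊤) (z0 : Z) (U : Submodule k (Dual k M))
    (J : Type) [Fintype J] :
    ∃ z : J → Z, min (finrank k M) (finrank k U + Fintype.card J) ≤
      finrank k ↥(U ⊔ ⨆ j, Submodule.span k {G (z j)}) := by
  obtain ⟨z, hz⟩ := add_generic G hG z0 U (Fintype.card J)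
  refine ⟨z ∘ Fintype.equivFin J, hz.trans (Submodule.finrank_mono (sup_le_sup_left ?_ _))⟩
  rw [Submodule.span_le]
  rintro _ ⟨i, rfl⟩
  refine Submodule.mem_iSup_of_mem ((Fintype.equivFin J).symm i) ?_
  simp [Submodule.mem_span_singleton_self]

theorem rank_ge_of_triangular [FiniteDimensional k M] (U : Submodule k (Dual k M)) {r : ℕ}
    (ψ : Fin r → Dual k M) (hψ : ∀ i, ψ i ∈ U) (f : Fin r → M)
    (hd : ∀ i, ψ i (f i) ≠ 0) (ht : ∀ i j, i < j → ψ i (f j) = 0) : r ≤ finrank k U := by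
  have hli : LinearIndependent k ψ := by
    have hdet : (Matrix.of fun i j => ψ i (f j)).det ≠ 0 := by
      rw [Matrix.det_of_isLowerTriangular]
      · exact Finset.prod_ne_zero_iff.2 fun i _ => hd i
      · intro i j hij
        exact ht i j hij
    rw [Fintype.linearIndependent_iff]
    intro g hg
    have h0 : Matrix.vecMul g (Matrix.of fun i j => ψ i (f j)) = 0 := by
      ext j
      have := congrArg (fun (φ : Dual k M) => φ (f j)) hg
      simpa [Matrix.vecMul, dotProduct, LinearMap.sum_apply] using this
    have := Matrix.eq_zero_of_vecMul_eq_zero hdet h0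
    exact fun i => congrFun this i
  have h2 := finrank_span_eq_card hli
  rw [Fintype.card_fin] at h2
  rw [← h2]
  apply Submodule.finrank_mono
  rw [Submodule.span_le]
  rintro _ ⟨i, rfl⟩
  exact hψ i

end LinAlg

section PL
variable {k : Type} [Field k] {E : Type} [AddCommGroup E] [Module k E]

def PL (k : Type) [Field k] {E : Type} [AddCommGroup E] [Module k E] (g : E → k) : Prop :=
  ∀ x y : E, ∃ P : Polynomial k, ∀ t : k, g (x + t • (y - x)) = P.eval t

theorem PL.const (c : k) : PL k (fun _ : E => c) := fun _ _ => ⟨Polynomial.C c, by simp⟩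
theorem PL.add {g h : E → k} (hg : PL k g) (hh : PL k h) : PL k (fun x => g x + h x) := by
  intro x y
  obtain ⟨P, hP⟩ := hg x y
  obtain ⟨Q, hQ⟩ := hh x y
  exact ⟨P + Q, by simp [hP, hQ]⟩
theorem PL.mul {g h : E → k} (hg : PL k g) (hh : PL k h) : PL k (fun x => g x * h x) := by
  intro x y
  obtain ⟨P, hP⟩ := hg x y
  obtain ⟨Q, hQ⟩ := hh x y
  exact ⟨P * Q, by simp [hP, hQ]⟩
theorem PL.neg {g : E → k} (hg : PL k g) : PL k (fun x => - g x) := by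
  intro x y
  obtain ⟨P, hP⟩ := hg x y
  exact ⟨-P, by simp [hP]⟩
theorem PL.sub {g h : E → k} (hg : PL k g) (hh : PL k h) : PL k (fun x => g x - h x) := by
  simpa [sub_eq_add_neg] using hg.add hh.neg
theorem PL.sum {ι : Type} (s : Finset ι) {g : ι → E → k} (hg : ∀ i, PL k (g i)) :
    PL k (fun x => ∑ i ∈ s, g i x) := by
  classical
  induction s using Finset.induction_on with
  | empty => simpa using PL.const 0
  | insert a s ha ih => simpa [Finset.sum_insert ha] using (hg a).add ih
theorem PL.prod {ι : Type} (s : Finset ι) {g : ι → E → k} (hg : ∀ i, PL k (g i)) :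
    PL k (fun x => ∏ i ∈ s, g i x) := by
  classical
  induction s using Finset.induction_on with
  | empty => simpa using PL.const 1
  | insert a s ha ih => simpa [Finset.prod_insert ha] using (hg a).mul ih
theorem PL.lin (l : E →ₗ[k] k) : PL k (fun x => l x) := fun x y =>
  ⟨Polynomial.C (l x) + Polynomial.X * Polynomial.C (l (y - x)), by intro t; simp⟩
theorem PL.det {r : ℕ} {g : Fin r → Fin r → E → k} (hg : ∀ i j, PL k (g i j)) :
    PL k (fun x => (Matrix.of fun i j => g i j x).det) := by
  simp only [Matrix.det_apply']
  exact PL.sum _ fun σ => (PL.const _).mul (PL.prod _ fun i => hg _ _)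
theorem PL.eval {N : ℕ} {v : E → Fin N → k} (hv : ∀ i, PL k (fun x => v x i))
    (f : MvPolynomial (Fin N) k) : PL k (fun x => MvPolynomial.eval (v x) f) := by
  induction f using MvPolynomial.induction_on with
  | C a => simpa using PL.const a
  | add p q hp hq => simpa using hp.add hq
  | mul_X p i hp => simpa using hp.mul (hv i)
theorem PL.comp_lin {E' : Type} [AddCommGroup E'] [Module k E'] {g : E → k} (hg : PL k g)
    (l : E' →ₗ[k] E) : PL k (fun x => g (l x)) := by
  intro x y
  obtain ⟨P, hP⟩ := hg (l x) (l y)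
  exact ⟨P, fun t => by rw [← hP]; simp⟩
theorem PL.comp_sub {E' : Type} [AddCommGroup E'] [Module k E'] {g : E → k} (hg : PL k g)
    (h : E' → E) (hh : ∀ (x y : E') (t : k), h (x + t • (y - x)) = h x + t • (h y - h x)) :
    PL k (fun x => g (h x)) := by
  intro x y
  obtain ⟨P, hP⟩ := hg (h x) (h y)
  exact ⟨P, fun t => by simp only [hh, hP]⟩
theorem PL.poly (Q : Polynomial k) : PL k (fun x : k => Q.eval x) := fun x y =>
  ⟨Q.comp (Polynomial.C x + Polynomial.X * Polynomial.C (y - x)), by intro t; simp⟩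

def ZOpen (k : Type) [Field k] {E : Type} [AddCommGroup E] [Module k E] (O : Set E) : Prop :=
  ∀ x ∈ O, ∃ g, PL k g ∧ g x ≠ 0 ∧ ∀ y, g y ≠ 0 → y ∈ O

theorem ZOpen.inter {O₁ O₂ : Set E} (h₁ : ZOpen k O₁) (h₂ : ZOpen k O₂) : ZOpen k (O₁ ∩ O₂) := by
  rintro x ⟨hx1, hx2⟩
  obtain ⟨g1, hg1, hgx1, h1⟩ := h₁ x hx1
  obtain ⟨g2, hg2, hgx2, h2⟩ := h₂ x hx2
  exact ⟨_, hg1.mul hg2, mul_ne_zero hgx1 hgx2, fun y hy =>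
    ⟨h1 y (left_ne_zero_of_mul hy), h2 y (right_ne_zero_of_mul hy)⟩⟩

theorem ZOpen.nonempty_inter [Infinite k] {O₁ O₂ : Set E} (h₁ : ZOpen k O₁) (h₂ : ZOpen k O₂)
    (hn₁ : O₁.Nonempty) (hn₂ : O₂.Nonempty) : (O₁ ∩ O₂).Nonempty := by
  obtain ⟨x, hx⟩ := hn₁
  obtain ⟨y, hy⟩ := hn₂
  obtain ⟨g1, hg1, hgx1, h1⟩ := h₁ x hx
  obtain ⟨g2, hg2, hgx2, h2⟩ := h₂ y hy
  obtain ⟨P, hP⟩ := hg1 x y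
  obtain ⟨Q, hQ⟩ := hg2 x y
  have hP0 : P ≠ 0 := by
    rintro rfl
    have := hP 0
    simp at this
    exact hgx1 this
  have hQ0 : Q ≠ 0 := by
    rintro rfl
    have := hQ 1
    simp at this
    exact hgx2 this
  obtain ⟨t, ht⟩ : ∃ t, (P * Q).eval t ≠ 0 := by
    by_contra hcon
    push Not at hcon
    exact mul_ne_zero hP0 hQ0 (Polynomial.funext fun t => by simpa using hcon t)
  rw [Polynomial.eval_mul] at ht
  refine ⟨x + t • (y - x), h1 _ ?_, h2 _ ?_⟩
  · rw [hP]; exact left_ne_zero_of_mul ht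
  · rw [hQ]; exact right_ne_zero_of_mul ht

theorem ZOpen.univ : ZOpen k (Set.univ : Set E) := fun _ _ =>
  ⟨fun _ => 1, PL.const 1, one_ne_zero, fun _ _ => trivial⟩

theorem ZOpen.preimage {E' : Type} [AddCommGroup E'] [Module k E'] {O : Set E} (h : ZOpen k O)
    (l : E' →ₗ[k] E) : ZOpen k {x | l x ∈ O} := by
  intro x hx
  obtain ⟨g, hg, hgx, h1⟩ := h _ hx
  exact ⟨_, hg.comp_lin l, hgx, fun y hy => h1 _ hy⟩

theorem ZOpen.ne_zero {g : E → k} (hg : PL k g) : ZOpen k {x | g x ≠ 0} := fun _ hx =>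
  ⟨g, hg, hx, fun _ hy => hy⟩

theorem ZOpen.forall {ι : Type} [Finite ι] {O : ι → Set E} (h : ∀ i, ZOpen k (O i)) :
    ZOpen k {x | ∀ i, x ∈ O i} := by
  classical
  cases nonempty_fintype ι
  intro x hx
  choose g hg hgx h1 using fun i => h i x (hx i)
  refine ⟨_, PL.prod Finset.univ hg, Finset.prod_ne_zero_iff.2 fun i _ => hgx i, fun y hy i => ?_⟩
  exact h1 i y (Finset.prod_ne_zero_iff.1 hy i (Finset.mem_univ i))

theorem ZOpen.forall_nonempty [Infinite k] {ι : Type} [Finite ι] {O : ι → Set E}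
    (h : ∀ i, ZOpen k (O i)) (hn : ∀ i, (O i).Nonempty) : {x | ∀ i, x ∈ O i}.Nonempty := by
  classical
  cases nonempty_fintype ι
  have : ∀ s : Finset ι, {x | ∀ i ∈ s, x ∈ O i}.Nonempty ∧ ZOpen k {x | ∀ i ∈ s, x ∈ O i} := by
    intro s
    induction s using Finset.induction_on with
    | empty => exact ⟨⟨0, by simp⟩, by simpa using ZOpen.univ⟩
    | insert a s ha ih =>
      have e : {x | ∀ i ∈ insert a s, x ∈ O i} = O a ∩ {x | ∀ i ∈ s, x ∈ O i} := by
        ext x; simp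
      rw [e]
      exact ⟨ZOpen.nonempty_inter (h a) ih.2 (hn a) ih.1, (h a).inter ih.2⟩
  simpa using (this Finset.univ).1

variable {M G : Type} [AddCommGroup M] [Module k M] [AddCommGroup G] [Module k G]

def PLs (φ : E → Dual k M) : Prop := ∀ f, PL k (fun x => φ x f)

def Reg (U : E → Submodule k (Dual k M)) : Prop :=
  ∀ x, ∀ ψ ∈ U x, ∃ φ : E → Dual k M, PLs φ ∧ φ x = ψ ∧ ∀ y, φ y ∈ U y

theorem Reg.sup {U V : E → Submodule k (Dual k M)} (hU : Reg U) (hV : Reg V) :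
    Reg (fun x => U x ⊔ V x) := by
  intro x ψ hψ
  obtain ⟨a, ha, b, hb, rfl⟩ := Submodule.mem_sup.1 hψ
  obtain ⟨φ1, h1, rfl, h1'⟩ := hU x a ha
  obtain ⟨φ2, h2, rfl, h2'⟩ := hV x b hb
  exact ⟨fun y => φ1 y + φ2 y, fun f => (h1 f).add (h2 f), rfl, fun y =>
    Submodule.add_mem_sup (h1' y) (h2' y)⟩

theorem Reg.bot : Reg (fun _ : E => (⊥ : Submodule k (Dual k M))) := by
  intro x ψ hψ
  rw [Submodule.mem_bot] at hψ
  exact ⟨fun _ => 0, fun f => by simpa using PL.const 0, hψ.symm, fun _ => zero_mem _⟩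

theorem Reg.span {S : Set (E → Dual k M)} (hS : ∀ φ ∈ S, PLs φ) :
    Reg (fun x => Submodule.span k ((fun φ => φ x) '' S)) := by
  intro x ψ hψ
  induction hψ using Submodule.span_induction with
  | mem ψ h =>
    obtain ⟨φ, hφ, rfl⟩ := h
    exact ⟨φ, hS φ hφ, rfl, fun y => Submodule.subset_span ⟨φ, hφ, rfl⟩⟩
  | zero => exact ⟨fun _ => 0, fun f => by simpa using PL.const 0, rfl, fun _ => zero_mem _⟩
  | add a b _ _ ha hb =>
    obtain ⟨φ1, h1, rfl, h1'⟩ := ha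
    obtain ⟨φ2, h2, rfl, h2'⟩ := hb
    exact ⟨fun y => φ1 y + φ2 y, fun f => (h1 f).add (h2 f), rfl, fun y =>
      add_mem (h1' y) (h2' y)⟩
  | smul c a _ ha =>
    obtain ⟨φ1, h1, rfl, h1'⟩ := ha
    exact ⟨fun y => c • φ1 y, fun f => (PL.const c).mul (h1 f), rfl, fun y =>
      Submodule.smul_mem _ _ (h1' y)⟩

theorem Reg.range {ι : Type} {Φ : ι → E → Dual k M} (hS : ∀ i, PLs (Φ i)) :
    Reg (fun x => Submodule.span k (Set.range fun i => Φ i x)) := by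
  have := Reg.span (k := k) (S := Set.range Φ) (by rintro _ ⟨i, rfl⟩; exact hS i)
  convert this using 3
  rw [← Set.range_comp]
  rfl

theorem Reg.single {φ : E → Dual k M} (hS : PLs φ) :
    Reg (fun x => Submodule.span k {φ x}) := by
  have := Reg.span (k := k) (S := {φ}) (by rintro _ rfl; exact hS)
  simpa using this

theorem Reg.iSup {ι : Type} {U : ι → E → Submodule k (Dual k M)} (hU : ∀ i, Reg (U i)) :
    Reg (fun x => ⨆ i, U i x) := by
  intro x ψ hψ
  induction hψ using Submodule.iSup_induction' with
  | mem i ψ h =>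
    obtain ⟨φ, h1, h2, h3⟩ := hU i x ψ h
    exact ⟨φ, h1, h2, fun y => Submodule.mem_iSup_of_mem i (h3 y)⟩
  | zero => exact ⟨fun _ => 0, fun f => by simpa using PL.const 0, rfl, fun _ => zero_mem _⟩
  | add a b _ _ ha hb =>
    obtain ⟨φ1, h1, rfl, h1'⟩ := ha
    obtain ⟨φ2, h2, rfl, h2'⟩ := hb
    exact ⟨fun y => φ1 y + φ2 y, fun f => (h1 f).add (h2 f), rfl, fun y =>
      add_mem (h1' y) (h2' y)⟩

theorem Reg.map {U : E → Submodule k (Dual k M)} (hU : Reg U) (μ : G →ₗ[k] M) :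
    Reg (fun x => (U x).map μ.dualMap) := by
  rintro x _ ⟨ψ, hψ, rfl⟩
  obtain ⟨φ, h1, rfl, h3⟩ := hU x ψ hψ
  exact ⟨fun y => μ.dualMap (φ y), fun f => h1 (μ f), rfl, fun y => ⟨_, h3 y, rfl⟩⟩

theorem Reg.comp {U : E → Submodule k (Dual k M)} (hU : Reg U) {E' : Type} [AddCommGroup E']
    [Module k E'] (l : E' →ₗ[k] E) : Reg (fun x => U (l x)) := by
  intro x ψ hψ
  obtain ⟨φ, h1, h2, h3⟩ := hU _ ψ hψ
  exact ⟨fun y => φ (l y), fun f => (h1 f).comp_lin l, h2, fun y => h3 _⟩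

theorem rank_ge_of_det [FiniteDimensional k M] (U : Submodule k (Dual k M)) {r : ℕ}
    (ψ : Fin r → Dual k M) (hψ : ∀ i, ψ i ∈ U) (f : Fin r → M)
    (hdet : (Matrix.of fun i j => ψ i (f j)).det ≠ 0) : r ≤ finrank k U := by
  have hli : LinearIndependent k ψ := by
    rw [Fintype.linearIndependent_iff]
    intro g hg
    have h0 : Matrix.vecMul g (Matrix.of fun i j => ψ i (f j)) = 0 := by
      ext j
      have := congrArg (fun (φ : Dual k M) => φ (f j)) hg
      simpa [Matrix.vecMul, dotProduct, LinearMap.sum_apply] using this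
    have := Matrix.eq_zero_of_vecMul_eq_zero hdet h0
    exact fun i => congrFun this i
  have h2 := finrank_span_eq_card hli
  rw [Fintype.card_fin] at h2
  rw [← h2]
  apply Submodule.finrank_mono
  rw [Submodule.span_le]
  rintro _ ⟨i, rfl⟩
  exact hψ i

theorem exists_li_of_rank (U : Submodule k M) {r : ℕ} (hr : r ≤ finrank k U) :
    ∃ (ψ : Fin r → M), (∀ i, ψ i ∈ U) ∧ LinearIndependent k ψ := by
  obtain ⟨b, hb⟩ := exists_linearIndependent_of_le_finrank (R := k) (M := ↥U) hr
  exact ⟨fun i => b i, fun i => (b i).2, hb.map' U.subtype (Submodule.ker_subtype _)⟩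

theorem exists_fam_of_rank (U : Submodule k (Dual k M)) {r : ℕ} (hr : r ≤ finrank k U) :
    ∃ (ψ : Fin r → Dual k M) (f : Fin r → M), (∀ i, ψ i ∈ U) ∧
      ∀ i j, ψ i (f j) = if i = j then 1 else 0 := by
  obtain ⟨ψ, h1, h2⟩ := exists_li_of_rank U hr
  obtain ⟨f, hf⟩ := exists_dual_fam ψ h2
  exact ⟨ψ, f, h1, hf⟩

theorem Reg.isZOpen [FiniteDimensional k M] {U : E → Submodule k (Dual k M)} (hU : Reg U) (r : ℕ) :
    ZOpen k {x | r ≤ finrank k (U x)} := by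
  intro x hx
  obtain ⟨ψ, f, hψ, hf⟩ := exists_fam_of_rank (U x) hx
  choose φ h1 h2 h3 using fun i => hU x (ψ i) (hψ i)
  refine ⟨fun y => (Matrix.of fun i j => φ i y (f j)).det,
    PL.det (g := fun i j y => φ i y (f j)) (fun i j => h1 i _), ?_, ?_⟩
  · have : (Matrix.of fun i j => φ i x (f j)) = 1 := by
      ext i j
      simp only [Matrix.of_apply, h2, hf, Matrix.one_apply]
    simp only [this, Matrix.det_one]
    exact one_ne_zero
  · intro y hy
    exact rank_ge_of_det (U y) (fun i => φ i y) (fun i => h3 i y) f hy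
end PL
end BP

namespace BP
open Module

section Poly
variable {k : Type} [Field k]

abbrev Fm (k : Type) [Field k] (N d : ℕ) : Type := ↥(homogeneousSubmodule (Fin N) k d)

instance finiteFm (N d : ℕ) : FiniteDimensional k (Fm k N d) :=
  Module.Finite.iff_fg.2 (homogeneousSubmodule_fg (σ := Fin N) (R := k) d)

theorem finrank_Fm (n d : ℕ) : finrank k (Fm k (n+1) d) = (n+d).choose n := by
  have h : finrank k (Fm k (n+1) d) =
      (Finset.finsuppAntidiag (Finset.univ : Finset (Fin (n+1))) d).card := by
    unfold Fm
    rw [homogeneousSubmodule_eq_finsupp_supported]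
    have e : {m : Fin (n+1) →₀ ℕ | m.degree = d} =
        ↑(Finset.finsuppAntidiag (Finset.univ : Finset (Fin (n+1))) d) := by
      ext m
      simp [Finsupp.degree_eq_sum]
    rw [e]
    have hb := Module.finrank_eq_card_basis (basisRestrictSupport k
      (↑(Finset.finsuppAntidiag (Finset.univ : Finset (Fin (n+1))) d) : Set (Fin (n+1) →₀ ℕ)))
    rw [← Set.toFinset_card, Finset.toFinset_coe] at hb
    exact hb
  rw [h, Finset.card_finsuppAntidiag_nat_eq_choose] 
  simp
  rw [← Nat.choose_symm_add]


noncomputable def ev {N : ℕ} (d : ℕ) (v : Fin N → k) : Dual k (Fm k N d) :=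
  (MvPolynomial.aeval v).toLinearMap ∘ₗ (homogeneousSubmodule (Fin N) k d).subtype

theorem ev_apply {N d : ℕ} (v : Fin N → k) (f : Fm k N d) : ev d v f = eval v f.1 := by
  simp [ev, MvPolynomial.aeval_eq_eval]

noncomputable def dv {N : ℕ} (d : ℕ) (p v : Fin N → k) : Dual k (Fm k N d) :=
  ∑ i, v i • ((MvPolynomial.aeval p).toLinearMap ∘ₗ (pderiv i).toLinearMap ∘ₗ
    (homogeneousSubmodule (Fin N) k d).subtype)

theorem dv_apply {N d : ℕ} (p v : Fin N → k) (f : Fm k N d) :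
    dv d p v f = ∑ i, v i * eval p (pderiv i f.1) := by
  simp [dv, MvPolynomial.aeval_eq_eval, LinearMap.sum_apply]

theorem ev_smul {N d : ℕ} (c : k) (v : Fin N → k) : ev d (c • v) = c ^ d • ev d v := by
  ext f
  have := (mem_homogeneousSubmodule d f.1).1 f.2
  simp only [LinearMap.smul_apply, ev_apply, smul_eq_mul]
  rw [MvPolynomial.eval_eq', MvPolynomial.eval_eq', Finset.mul_sum]
  refine Finset.sum_congr rfl fun m hm => ?_
  have h1 := this (mem_support_iff.1 hm)
  have h1' : m.degree = d := by rw [← h1, Finsupp.degree_eq_weight_one]; rfl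
  rw [Finsupp.degree_eq_sum] at h1'
  simp only [Pi.smul_apply, smul_eq_mul, mul_pow, Finset.prod_mul_distrib,
    Finset.prod_pow_eq_pow_sum, h1']
  ring

theorem dv_add {N d : ℕ} (p v w : Fin N → k) : dv d p (v + w) = dv d p v + dv d p w := by
  ext f
  simp [dv_apply, add_mul, Finset.sum_add_distrib]

theorem dv_smul {N d : ℕ} (c : k) (p v : Fin N → k) : dv d p (c • v) = c • dv d p v := by
  ext f
  simp [dv_apply, Finset.mul_sum, mul_assoc]

theorem dv_self {N d : ℕ} (p : Fin N → k) : dv d p p = (d : k) • ev d p := by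
  ext f
  have := (mem_homogeneousSubmodule d f.1).1 f.2
  have h := congrArg (eval p) this.sum_X_mul_pderiv
  simpa [dv_apply, ev_apply] using h

/-- restriction of a polynomial to an affine line -/
noncomputable def jet {N : ℕ} (p v : Fin N → k) (f : MvPolynomial (Fin N) k) : Polynomial k :=
  MvPolynomial.aeval (fun i => Polynomial.C (p i) + Polynomial.X * Polynomial.C (v i)) f

theorem jet_eval {N : ℕ} (p v : Fin N → k) (f : MvPolynomial (Fin N) k) (t : k) :
    (jet p v f).eval t = eval (p + t • v) f := by
  induction f using MvPolynomial.induction_on with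
  | C a => simp [jet]
  | add f g hf hg => simp only [jet, map_add, Polynomial.eval_add] at *; rw [hf, hg]
  | mul_X f i hf =>
    simp only [jet, map_mul, Polynomial.eval_mul] at *; rw [hf]; simp only [aeval_X, eval_X, Polynomial.eval_add, Polynomial.eval_mul, Polynomial.eval_C,
      Polynomial.eval_X, Pi.add_apply, Pi.smul_apply, smul_eq_mul]

theorem jet_deriv {N : ℕ} (p v : Fin N → k) (f : MvPolynomial (Fin N) k) :
    (jet p v f).derivative = ∑ i, Polynomial.C (v i) * jet p v (pderiv i f) := by
  classical
  induction f using MvPolynomial.induction_on with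
  | C a => simp [jet]
  | add f g hf hg =>
    simp only [jet, map_add, Polynomial.derivative_add] at *
    rw [hf, hg, ← Finset.sum_add_distrib]
    simp [mul_add]
  | mul_X f i hf =>
    simp only [jet, map_mul, Derivation.leibniz, smul_eq_mul, map_add] at *
    rw [Polynomial.derivative_mul, hf]
    have h1 : ∀ j : Fin N, (MvPolynomial.aeval (fun i => Polynomial.C (p i) +
        Polynomial.X * Polynomial.C (v i)) (pderiv j (X i : MvPolynomial (Fin N) k))) =
        if j = i then 1 else 0 := by
      intro j
      rw [pderiv_X]
      by_cases h : j = i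
      · subst h; simp
      · simp [Pi.single_apply, h, Ne.symm h]
    simp only [h1, aeval_X]
    generalize (MvPolynomial.aeval fun i => Polynomial.C (p i) + Polynomial.X * Polynomial.C (v i)) f = A
    have h2 : ∀ (g : Fin N → Polynomial k) (B : Polynomial k),
        ∑ x, Polynomial.C (v x) * (A * (if x = i then 1 else 0) + B * g x) =
          Polynomial.C (v i) * A + (∑ x, Polynomial.C (v x) * g x) * B := by
      intro g B
      have h3 := Finset.sum_ite_eq' Finset.univ i (fun x => Polynomial.C (v x) * A)
      rw [if_pos (Finset.mem_univ i)] at h3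
      rw [Finset.sum_mul, ← h3, ← Finset.sum_add_distrib]
      refine Finset.sum_congr rfl fun x _ => ?_
      split_ifs <;> ring
    rw [h2]
    simp only [Polynomial.derivative_add, Polynomial.derivative_mul, Polynomial.derivative_C,
        Polynomial.derivative_X]
    ring

theorem jet_deriv_eval {N d : ℕ} (p v : Fin N → k) (f : Fm k N d) (t : k) :
    (jet p v f.1).derivative.eval t = dv d (p + t • v) v f := by
  rw [jet_deriv, dv_apply, Polynomial.eval_finsetSum]
  simp [jet_eval]

/-- difference quotient functional -/
noncomputable def dq {N : ℕ} (d : ℕ) (p v : Fin N → k) (t : k) : Dual k (Fm k N d) :=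
  open Classical in if t = 0 then dv d p v else t⁻¹ • (ev d (p + t • v) - ev d p)

theorem dq_zero {N d : ℕ} (p v : Fin N → k) : dq d p v 0 = dv d p v := by simp [dq]

theorem dq_PLs {N d : ℕ} (p v : Fin N → k) : PLs (fun t : k => dq d p v t) := by
  intro f
  have : (fun t => dq d p v t f) = fun t => (Polynomial.divX (jet p v f.1)).eval t := by
    ext t
    by_cases ht : t = 0
    · subst ht
      rw [dq_zero]
      have := jet_deriv_eval p v f 0
      rw [zero_smul, add_zero] at this
      rw [← this, ← Polynomial.coeff_zero_eq_eval_zero, ← Polynomial.coeff_zero_eq_eval_zero,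
        Polynomial.coeff_derivative, Polynomial.coeff_divX]
      simp
    · have h1 := congrArg (Polynomial.eval t) (Polynomial.divX_mul_X_add (jet p v f.1))
      have h2 : (jet p v f.1).coeff 0 = ev d p f := by
        rw [Polynomial.coeff_zero_eq_eval_zero, jet_eval, ev_apply]; simp
      simp only [Polynomial.eval_add, Polynomial.eval_mul, Polynomial.eval_X, Polynomial.eval_C,
        h2, jet_eval] at h1
      simp only [dq, if_neg ht, LinearMap.smul_apply, LinearMap.sub_apply, smul_eq_mul]
      rw [ev_apply (p + t • v), ← h1]
      field_simp
      ring
  rw [this]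
  exact PL.poly _

/-- conditions imposed by the span of a family of vectors -/
noncomputable def Flat {N r : ℕ} (d : ℕ) (a : Fin r → Fin N → k) : Submodule k (Dual k (Fm k N d)) :=
  Submodule.span k (Set.range fun s : Fin r → k => ev d (∑ j, s j • a j))

noncomputable abbrev Line {N : ℕ} (d : ℕ) (a b : Fin N → k) := Flat d ![a, b]

theorem ev_mem_Flat {N r d : ℕ} (a : Fin r → Fin N → k) (s : Fin r → k) :
    ev d (∑ j, s j • a j) ∈ Flat d a := Submodule.subset_span ⟨s, rfl⟩

theorem ev_mem_Line {N d : ℕ} (a b : Fin N → k) (s t : k) :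
    ev d (s • a + t • b) ∈ Line d a b := by
  have := ev_mem_Flat (d := d) ![a, b] ![s, t]
  simpa using this

theorem ev_mem_Line_left {N d : ℕ} (a b : Fin N → k) : ev d a ∈ Line d a b := by
  simpa using ev_mem_Line (d := d) a b 1 0
theorem ev_mem_Line_right {N d : ℕ} (a b : Fin N → k) : ev d b ∈ Line d a b := by
  simpa using ev_mem_Line (d := d) a b 0 1

theorem Line_le_iff {N d : ℕ} (a b : Fin N → k) (U : Submodule k (Dual k (Fm k N d))) :
    Line d a b ≤ U ↔ ∀ s t : k, ev d (s • a + t • b) ∈ U := by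
  constructor
  · intro h s t
    exact h (ev_mem_Line a b s t)
  · intro h
    unfold Line Flat
    rw [Submodule.span_le]
    rintro _ ⟨s, rfl⟩
    simpa [Fin.sum_univ_two] using h (s 0) (s 1)

theorem Line_comm {N d : ℕ} (a b : Fin N → k) : Line d a b = Line d b a := by
  apply le_antisymm
  · rw [Line_le_iff]; intro s t; rw [add_comm]; exact ev_mem_Line b a t s
  · rw [Line_le_iff]; intro s t; rw [add_comm]; exact ev_mem_Line a b t s

theorem Flat_reg {E : Type} [AddCommGroup E] [Module k E] {N r d : ℕ} {a : E → Fin r → Fin N → k}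
    (ha : ∀ j i, PL k (fun x => a x j i)) : Reg (fun x => Flat d (a x)) := by
  apply Reg.range (Φ := fun (s : Fin r → k) x => ev d (∑ j, s j • a x j))
  intro s f
  simp only [ev_apply]
  apply PL.eval
  intro i
  simp only [Finset.sum_apply, Pi.smul_apply, smul_eq_mul]
  exact PL.sum _ fun j => (PL.const _).mul (ha j i)

theorem Line_reg {E : Type} [AddCommGroup E] [Module k E] {N d : ℕ} {a b : E → Fin N → k}
    (ha : ∀ i, PL k (fun x => a x i)) (hb : ∀ i, PL k (fun x => b x i)) :
    Reg (fun x => Line d (a x) (b x)) := by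
  apply Flat_reg
  intro j i
  fin_cases j
  · exact ha i
  · exact hb i

theorem ev_PLs {E : Type} [AddCommGroup E] [Module k E] {N d : ℕ} {a : E → Fin N → k}
    (ha : ∀ i, PL k (fun x => a x i)) : PLs (fun x => ev d (a x)) := by
  intro f
  simp only [ev_apply]
  exact PL.eval ha _

theorem dv_PLs {E : Type} [AddCommGroup E] [Module k E] {N d : ℕ} {a b : E → Fin N → k}
    (ha : ∀ i, PL k (fun x => a x i)) (hb : ∀ i, PL k (fun x => b x i)) :
    PLs (fun x => dv d (a x) (b x)) := by
  intro f
  simp only [dv_apply]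
  exact PL.sum _ fun i => (hb i).mul (PL.eval ha _)

theorem dv_mem_Line [Infinite k] {N d : ℕ} (a b : Fin N → k) : dv d a b ∈ Line d a b := by
  apply mem_of_ann
  intro f hf
  have h0 : jet a b f.1 = 0 := by
    apply Polynomial.funext
    intro t
    rw [jet_eval, ← ev_apply]
    simpa using hf _ (ev_mem_Line a b 1 t)
  have := jet_deriv_eval a b f 0
  simpa [h0] using this.symm

/-- a point is in the span of nearby points along a line -/
theorem ev_mem_of_ne [Infinite k] {N d : ℕ} (u y : Fin N → k)
    (U : Submodule k (Dual k (Fm k N d))) (h : ∀ t : k, t ≠ 0 → ev d (u + t • y) ∈ U) :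
    ev d u ∈ U := by
  apply mem_of_ann
  intro f hf
  have h0 : Polynomial.X * jet u y f.1 = 0 := by
    apply Polynomial.funext
    intro t
    rw [Polynomial.eval_mul, jet_eval, ← ev_apply, Polynomial.eval_X]
    by_cases ht : t = 0
    · simp [ht]
    · simp [hf _ (h t ht)]
  have h1 : jet u y f.1 = 0 := by simpa using h0
  have := jet_eval u y f.1 0
  rw [h1] at this
  rw [ev_apply]
  simpa using this.symm

theorem span_ev [Infinite k] (N d : ℕ) :
    Submodule.span k (Set.range fun v : Fin N → k => ev d v) = ⊤ := by
  rw [eq_top_iff]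
  intro φ _
  apply mem_of_ann
  intro f hf
  have : f = 0 := by
    apply Subtype.ext
    apply MvPolynomial.funext
    intro v
    rw [← ev_apply, hf _ (Submodule.subset_span ⟨v, rfl⟩)]
    simp
  simp [this]

/-- substitution by linear forms -/
noncomputable def subst {N r : ℕ} (d : ℕ) (a : Fin r → Fin N → k) : Fm k N d →ₗ[k] Fm k r d :=
  LinearMap.codRestrict _ ((MvPolynomial.aeval
    (fun i => ∑ j, MvPolynomial.C (a j i) * MvPolynomial.X j :
      Fin N → MvPolynomial (Fin r) k)).toLinearMap ∘ₗ (homogeneousSubmodule (Fin N) k d).subtype)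
    (by
      intro f
      have hf := (mem_homogeneousSubmodule d f.1).1 f.2
      rw [mem_homogeneousSubmodule]
      have := hf.aeval (fun i => ∑ j, MvPolynomial.C (a j i) * MvPolynomial.X j :
        Fin N → MvPolynomial (Fin r) k) (n := 1) (by
          intro i
          exact IsHomogeneous.sum _ _ _ fun j _ => isHomogeneous_C_mul_X _ _)
      simpa using this)

theorem eval_subst {N r d : ℕ} (a : Fin r → Fin N → k) (f : Fm k N d) (s : Fin r → k) :
    eval s (subst d a f).1 = eval (∑ j, s j • a j) f.1 := by
  simp only [subst, LinearMap.codRestrict_apply, LinearMap.comp_apply, Submodule.subtype_apply,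
    AlgHom.toLinearMap_apply]
  induction f.1 using MvPolynomial.induction_on with
  | C a => simp
  | add f g hf hg => simp only [map_add]; rw [hf, hg]
  | mul_X f i hf => simp only [map_mul]; rw [hf]; simp [mul_comm]

theorem subst_dual {N r d : ℕ} (a : Fin r → Fin N → k) (s : Fin r → k) :
    (subst d a).dualMap (ev d s) = ev d (∑ j, s j • a j) := by
  ext f
  simp [LinearMap.dualMap_apply, ev_apply, eval_subst]

theorem Flat_rank_le {N r d : ℕ} (a : Fin (r+1) → Fin N → k) :
    finrank k (Flat d a) ≤ (r+d).choose r := by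
  have : Flat d a ≤ LinearMap.range (subst d a).dualMap := by
    unfold Flat
    rw [Submodule.span_le]
    rintro _ ⟨s, rfl⟩
    exact ⟨ev d s, subst_dual a s⟩
  refine (Submodule.finrank_mono this).trans ((LinearMap.finrank_range_le _).trans ?_)
  rw [Subspace.dual_finrank_eq, finrank_Fm]

theorem Line_rank_le {N d : ℕ} (a b : Fin N → k) : finrank k (Line d a b) ≤ d + 1 := by
  have := Flat_rank_le (d := d) ![a, b]
  rw [Nat.choose_one_right] at this
  unfold Line
  omega

/-- multiplication by a form -/
noncomputable def mulF {N e : ℕ} (d : ℕ) (g : Fm k N e) : Fm k N d →ₗ[k] Fm k N (d + e) :=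
  LinearMap.codRestrict _ ((LinearMap.mulRight k g.1) ∘ₗ
    (homogeneousSubmodule (Fin N) k d).subtype) (by
      intro f
      have hf := (mem_homogeneousSubmodule d f.1).1 f.2
      have hg := (mem_homogeneousSubmodule e g.1).1 g.2
      rw [mem_homogeneousSubmodule]
      exact hf.mul hg)

theorem mulF_coe {N d e : ℕ} (g : Fm k N e) (f : Fm k N d) : (mulF d g f).1 = f.1 * g.1 := rfl

theorem mulF_ev {N d e : ℕ} (g : Fm k N e) (v : Fin N → k) :
    (mulF d g).dualMap (ev (d+e) v) = ev e v g • ev d v := by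
  ext f
  simp [LinearMap.dualMap_apply, ev_apply, mulF_coe, mul_comm]

theorem mulF_dv {N d e : ℕ} (g : Fm k N e) (p v : Fin N → k) :
    (mulF d g).dualMap (dv (d+e) p v) = ev e p g • dv d p v + dv e p v g • ev d p := by
  ext f
  simp only [LinearMap.dualMap_apply, ev_apply, mulF_coe, dv_apply, Derivation.leibniz,
    smul_eq_mul, map_add, map_mul, LinearMap.add_apply, LinearMap.smul_apply, mul_add,
    Finset.sum_add_distrib, Finset.mul_sum, Finset.sum_mul]
  rw [add_comm]
  congr 1
  · exact Finset.sum_congr rfl fun j _ => by ring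
  · exact Finset.sum_congr rfl fun j _ => by ring

end Poly
end BP

namespace BP
open Module

section Step
variable {k : Type} [Field k]

theorem PL.of_lin {E : Type} [AddCommGroup E] [Module k E] {g : E → k}
    (h1 : ∀ x y, g (x + y) = g x + g y) (h2 : ∀ (c : k) x, g (c • x) = c * g x) : PL k g :=
  PL.lin { toFun := g, map_add' := h1, map_smul' := h2 }

theorem subst_dual_dv [Infinite k] {N r d : ℕ} (a : Fin r → Fin N → k) (s s' : Fin r → k) :
    (subst d a).dualMap (dv d s s') = dv d (∑ j, s j • a j) (∑ j, s' j • a j) := by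
  ext f
  rw [LinearMap.dualMap_apply]
  have h1 := jet_deriv_eval s s' (subst d a f) 0
  have h2 := jet_deriv_eval (∑ j, s j • a j) (∑ j, s' j • a j) f 0
  have h3 : jet s s' (subst d a f).1 = jet (∑ j, s j • a j) (∑ j, s' j • a j) f.1 := by
    apply Polynomial.funext
    intro t
    rw [jet_eval, jet_eval, eval_subst]
    congr 2
    simp [add_smul, Finset.sum_add_distrib, Finset.smul_sum, mul_smul]
  rw [h3] at h1
  rw [h1] at h2
  simpa using h2

def em {n : ℕ} (v : Fin n → k) : Fin (n+1) → k := Fin.cons 0 v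

@[simp] theorem em_zero {n : ℕ} (v : Fin n → k) : em v 0 = 0 := rfl
@[simp] theorem em_succ {n : ℕ} (v : Fin n → k) (i : Fin n) : em v i.succ = v i := rfl

theorem em_add {n : ℕ} (v w : Fin n → k) : em (v + w) = em v + em w := by
  ext i
  refine Fin.cases ?_ (fun j => ?_) i <;> simp
theorem em_smul {n : ℕ} (c : k) (v : Fin n → k) : em (c • v) = c • em v := by
  ext i
  refine Fin.cases ?_ (fun j => ?_) i <;> simp

theorem em_PL {E : Type} [AddCommGroup E] [Module k E] {n : ℕ} {a : E → Fin n → k}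
    (ha : ∀ i, PL k (fun x => a x i)) (i : Fin (n+1)) : PL k (fun x => em (a x) i) := by
  refine Fin.cases ?_ (fun j => ?_) i
  · simpa using PL.const 0
  · simpa using ha j

noncomputable def res (n d : ℕ) : Fm k (n+1) d →ₗ[k] Fm k n d :=
  subst d (fun j : Fin n => Pi.single j.succ (1:k))

theorem sum_single_em {n : ℕ} (s : Fin n → k) :
    ∑ j : Fin n, s j • (Pi.single j.succ (1:k) : Fin (n+1) → k) = em s := by
  ext i
  refine Fin.cases ?_ (fun l => ?_) i
  · simp [Finset.sum_apply, Pi.single_apply, (Fin.succ_ne_zero _).symm]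
  · simp [Finset.sum_apply, Pi.single_apply]

theorem res_ev {n d : ℕ} (s : Fin n → k) : (res n d).dualMap (ev d s) = ev d (em s) := by
  rw [res, subst_dual, sum_single_em]

theorem res_dv [Infinite k] {n d : ℕ} (s s' : Fin n → k) :
    (res n d).dualMap (dv d s s') = dv d (em s) (em s') := by
  rw [res, subst_dual_dv, sum_single_em, sum_single_em]

theorem eval_res {n d : ℕ} (f : Fm k (n+1) d) (s : Fin n → k) :
    eval s (res n d f).1 = eval (em s) f.1 := by
  rw [res, eval_subst, sum_single_em]

theorem res_surj [Infinite k] (n d : ℕ) : Function.Surjective (res (k := k) n d) := by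
  intro g
  refine ⟨⟨rename Fin.succ g.1, ?_⟩, ?_⟩
  · have hg := (mem_homogeneousSubmodule d g.1).1 g.2
    rw [mem_homogeneousSubmodule]
    exact hg.rename_isHomogeneous
  · apply Subtype.ext
    apply MvPolynomial.funext
    intro s
    rw [eval_res, eval_rename]
    rfl

theorem res_Line {n d : ℕ} (a b : Fin n → k) :
    (Line d a b).map (res n d).dualMap = Line d (em a) (em b) := by
  unfold Line Flat
  rw [Submodule.map_span, ← Set.range_comp]
  congr 2
  ext s : 1
  simp only [Function.comp, res_ev]
  congr 1
  simp [em_add, em_smul]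

noncomputable def xz (k : Type) [Field k] (n : ℕ) : Fm k (n+1) 1 := ⟨X 0, isHomogeneous_X k 0⟩

theorem ev_xz {n : ℕ} (v : Fin (n+1) → k) : ev 1 v (xz k n) = v 0 := by
  simp [ev_apply, xz]

theorem res_mul_xz [Infinite k] (n d : ℕ) : res n (d+1) ∘ₗ mulF d (xz k n) = 0 := by
  ext1 f
  apply Subtype.ext
  apply MvPolynomial.funext
  intro s
  rw [LinearMap.comp_apply, eval_res, mulF_coe]
  simp [xz]

theorem Flat_le_map [Infinite k] {n r d : ℕ} (a : Fin r → Fin (n+1) → k) (j : Fin r)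
    (hj : a j 0 ≠ 0) :
    Flat d a ≤ (Flat (d+1) a).map (mulF d (xz k n)).dualMap := by
  have key : ∀ s : Fin r → k, (∑ j, s j • a j) 0 ≠ 0 →
      ev d (∑ j, s j • a j) ∈ (Flat (d+1) a).map (mulF d (xz k n)).dualMap := by
    intro s hs
    have h1 := Submodule.mem_map_of_mem (f := (mulF d (xz k n)).dualMap)
      (ev_mem_Flat (d := d+1) a s)
    rw [mulF_ev, ev_xz] at h1
    have h2 := Submodule.smul_mem _ ((∑ j, s j • a j) 0)⁻¹ h1
    rwa [smul_smul, inv_mul_cancel₀ hs, one_smul] at h2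
  conv_lhs => unfold Flat
  rw [Submodule.span_le]
  rintro _ ⟨s, rfl⟩
  by_cases hs : (∑ j, s j • a j) 0 = 0
  · apply ev_mem_of_ne _ (a j)
    intro t ht
    have e : (∑ j, s j • a j) + t • a j = ∑ i, (s + Pi.single j t : Fin r → k) i • a i := by
      simp [add_smul, Finset.sum_add_distrib, Pi.single_apply, ite_smul]
    rw [e]
    apply key
    rw [← e]
    simp only [Pi.add_apply, hs, Pi.smul_apply, smul_eq_mul, zero_add]
    exact mul_ne_zero ht hj
  · exact key s hs

/-- configurations adapted to the hyperplane `x₀ = 0` -/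
abbrev Cfg (k : Type) [Field k] (n : ℕ) (P T J : Type) : Type :=
  (P → (Fin n → k) × (Fin n → k) × (Fin (n+1) → k)) ×
  (T → (Fin n → k) × (Fin (n+1) → k) × (Fin (n+1) → k)) ×
  (J → (Fin n → k) × (Fin (n+1) → k))

noncomputable def UU {n : ℕ} {P T J : Type} (d : ℕ) (x : Cfg k n P T J) :
    Submodule k (Dual k (Fm k (n+1) d)) :=
  (⨆ i, Flat d ![em (x.1 i).1, em (x.1 i).2.1, (x.1 i).2.2]) ⊔
  (⨆ i, (Line d (em (x.2.1 i).1) (x.2.1 i).2.1 ⊔ Line d (em (x.2.1 i).1) (x.2.1 i).2.2)) ⊔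
  (⨆ i, Line d (em (x.2.2 i).1) (x.2.2 i).2)

theorem UU_reg {n d : ℕ} {P T J : Type} : Reg (fun x : Cfg k n P T J => UU d x) := by
  unfold UU
  refine Reg.sup (Reg.sup (Reg.iSup fun i => Flat_reg ?_) (Reg.iSup fun i => Reg.sup (Line_reg ?_ ?_)
    (Line_reg ?_ ?_))) (Reg.iSup fun i => Line_reg ?_ ?_)
  · intro j l
    fin_cases j
    · exact em_PL (fun m => PL.of_lin (fun _ _ => rfl) (fun _ _ => rfl)) l
    · exact em_PL (fun m => PL.of_lin (fun _ _ => rfl) (fun _ _ => rfl)) l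
    · exact PL.of_lin (fun _ _ => rfl) (fun _ _ => rfl)
  · exact em_PL (fun m => PL.of_lin (fun _ _ => rfl) (fun _ _ => rfl))
  · exact (fun m => PL.of_lin (fun _ _ => rfl) (fun _ _ => rfl))
  · exact em_PL (fun m => PL.of_lin (fun _ _ => rfl) (fun _ _ => rfl))
  · exact (fun m => PL.of_lin (fun _ _ => rfl) (fun _ _ => rfl))
  · exact em_PL (fun m => PL.of_lin (fun _ _ => rfl) (fun _ _ => rfl))
  · exact (fun m => PL.of_lin (fun _ _ => rfl) (fun _ _ => rfl))

/-- trace configurations: lines, planar double points, points -/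
abbrev TCfg (k : Type) [Field k] (n : ℕ) (A D Z : Type) : Type :=
  (A → (Fin n → k) × (Fin n → k)) ×
  (D → (Fin n → k) × (Fin n → k) × (Fin n → k)) × (Z → (Fin n → k))

noncomputable def PD {n : ℕ} (d : ℕ) (p v w : Fin n → k) : Submodule k (Dual k (Fm k n d)) :=
  Submodule.span k {ev d p} ⊔ Submodule.span k {dv d p v} ⊔ Submodule.span k {dv d p w}

noncomputable def TT {n : ℕ} {A D Z : Type} (d : ℕ) (x : TCfg k n A D Z) :
    Submodule k (Dual k (Fm k n d)) :=
  (⨆ i, Line d (x.1 i).1 (x.1 i).2) ⊔ (⨆ i, PD d (x.2.1 i).1 (x.2.1 i).2.1 (x.2.1 i).2.2) ⊔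
  (⨆ i, Submodule.span k {ev d (x.2.2 i)})

theorem TT_reg {E : Type} [AddCommGroup E] [Module k E] {n d : ℕ} {A D Z : Type}
    (h : E → TCfg k n A D Z)
    (h1 : ∀ i j, PL k (fun x => ((h x).1 i).1 j)) (h2 : ∀ i j, PL k (fun x => ((h x).1 i).2 j))
    (h3 : ∀ i j, PL k (fun x => ((h x).2.1 i).1 j)) (h4 : ∀ i j, PL k (fun x => ((h x).2.1 i).2.1 j))
    (h5 : ∀ i j, PL k (fun x => ((h x).2.1 i).2.2 j)) (h6 : ∀ i j, PL k (fun x => ((h x).2.2 i) j)) :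
    Reg (fun x : E => TT d (h x)) := by
  unfold TT PD
  exact Reg.sup (Reg.sup (Reg.iSup fun i => Line_reg (h1 i) (h2 i))
    (Reg.iSup fun i => Reg.sup (Reg.sup (Reg.single (ev_PLs (h3 i))) (Reg.single
      (dv_PLs (h3 i) (h4 i)))) (Reg.single (dv_PLs (h3 i) (h5 i)))))
    (Reg.iSup fun i => Reg.single (ev_PLs (h6 i)))

/-- conormal direction coming from two lines through a point of the hyperplane -/
def v1 {n : ℕ} (w w' : Fin (n+1) → k) : Fin n → k := fun i => w' 0 * w i.succ - w 0 * w' i.succ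

theorem em_v1 {n : ℕ} (w w' : Fin (n+1) → k) : em (v1 w w') = w' 0 • w - w 0 • w' := by
  ext i
  refine Fin.cases ?_ (fun l => ?_) i
  · simp [mul_comm]
  · simp [v1]

/-- total space for one step -/
abbrev SCfg (k : Type) [Field k] (n : ℕ) (P T' T L I : Type) : Type :=
  Cfg k n P T' (T ⊕ L) × (T' → Fin n → k) × (T → Fin n → k) × (I → (Fin n → k) × (Fin n → k))

def toTr {n : ℕ} {P T' T L I : Type} (x : SCfg k n P T' T L I) : TCfg k n (T ⊕ I ⊕ P) T' L :=
  (Sum.elim (fun i => ((x.1.2.2 (Sum.inl i)).1, x.2.2.1 i))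
     (Sum.elim (fun i => x.2.2.2 i) (fun i => ((x.1.1 i).1, (x.1.1 i).2.1))),
   fun i => ((x.1.2.1 i).1, v1 (x.1.2.1 i).2.1 (x.1.2.1 i).2.2, x.2.1 i),
   fun i => (x.1.2.2 (Sum.inr i)).1)

theorem toTr_reg {n d : ℕ} {P T' T L I : Type} :
    Reg (fun x : SCfg k n P T' T L I => TT d (toTr x)) := by
  refine TT_reg _ ?_ ?_ ?_ ?_ ?_ ?_
  · rintro (i | i | i) j <;> exact PL.of_lin (fun _ _ => rfl) (fun _ _ => rfl)
  · rintro (i | i | i) j <;> exact PL.of_lin (fun _ _ => rfl) (fun _ _ => rfl)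
  · intro i j; exact PL.of_lin (fun _ _ => rfl) (fun _ _ => rfl)
  · intro i j
    simp only [toTr, v1]
    exact ((PL.of_lin (fun _ _ => rfl) (fun _ _ => rfl)).mul
      (PL.of_lin (fun _ _ => rfl) (fun _ _ => rfl))).sub
      ((PL.of_lin (fun _ _ => rfl) (fun _ _ => rfl)).mul
      (PL.of_lin (fun _ _ => rfl) (fun _ _ => rfl)))
  · intro i j; exact PL.of_lin (fun _ _ => rfl) (fun _ _ => rfl)
  · intro i j; exact PL.of_lin (fun _ _ => rfl) (fun _ _ => rfl)

end Step
end BP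

namespace BP
open Module

section StepN
variable {k : Type} [Field k]

theorem dv_sub {N d : ℕ} (p v w : Fin N → k) : dv d p (v - w) = dv d p v - dv d p w := by
  ext f
  simp [dv_apply, sub_mul, Finset.sum_sub_distrib]

theorem le_UU_flat {n d : ℕ} {P T J : Type} (x : Cfg k n P T J) (i : P) :
    Flat d ![em (x.1 i).1, em (x.1 i).2.1, (x.1 i).2.2] ≤ UU d x :=
  le_sup_of_le_left (le_sup_of_le_left (le_iSup (fun i => Flat d ![em (x.1 i).1, em (x.1 i).2.1, (x.1 i).2.2]) i))
theorem le_UU_T1 {n d : ℕ} {P T J : Type} (x : Cfg k n P T J) (i : T) :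
    Line d (em (x.2.1 i).1) (x.2.1 i).2.1 ≤ UU d x :=
  le_sup_of_le_left (le_sup_of_le_right ((le_sup_left).trans (le_iSup (fun i => Line d (em (x.2.1 i).1) (x.2.1 i).2.1 ⊔ Line d (em (x.2.1 i).1) (x.2.1 i).2.2) i)))
theorem le_UU_T2 {n d : ℕ} {P T J : Type} (x : Cfg k n P T J) (i : T) :
    Line d (em (x.2.1 i).1) (x.2.1 i).2.2 ≤ UU d x :=
  le_sup_of_le_left (le_sup_of_le_right ((le_sup_right).trans (le_iSup (fun i => Line d (em (x.2.1 i).1) (x.2.1 i).2.1 ⊔ Line d (em (x.2.1 i).1) (x.2.1 i).2.2) i)))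
theorem le_UU_J {n d : ℕ} {P T J : Type} (x : Cfg k n P T J) (i : J) :
    Line d (em (x.2.2 i).1) (x.2.2 i).2 ≤ UU d x :=
  le_sup_of_le_right (le_iSup (fun i => Line d (em (x.2.2 i).1) (x.2.2 i).2) i)

/-- good position of the hyperplane -/
def Good {n : ℕ} {P T J : Type} (x : Cfg k n P T J) : Prop :=
  (∀ i, (x.1 i).2.2 0 ≠ 0) ∧ (∀ i, (x.2.1 i).2.1 0 ≠ 0) ∧ (∀ i, (x.2.1 i).2.2 0 ≠ 0) ∧
    (∀ i, (x.2.2 i).2 0 ≠ 0)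

theorem Good_open {n : ℕ} {P T J : Type} [Finite P] [Finite T] [Finite J] :
    ZOpen k {x : Cfg k n P T J | Good x} := by
  refine ZOpen.inter (ZOpen.forall fun i => ZOpen.ne_zero ?_) (ZOpen.inter (ZOpen.forall fun i => ZOpen.ne_zero ?_)
    (ZOpen.inter (ZOpen.forall fun i => ZOpen.ne_zero ?_) (ZOpen.forall fun i => ZOpen.ne_zero ?_)))
  all_goals exact PL.of_lin (fun _ _ => rfl) (fun _ _ => rfl)

theorem Good_nonempty {n : ℕ} {P T J : Type} : {x : Cfg k n P T J | Good x}.Nonempty :=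
  ⟨(fun _ => (fun _ => 1, fun _ => 1, fun _ => 1), fun _ => (fun _ => 1, fun _ => 1, fun _ => 1),
    fun _ => (fun _ => 1, fun _ => 1)), fun _ => one_ne_zero, fun _ => one_ne_zero, fun _ => one_ne_zero,
    fun _ => one_ne_zero⟩

noncomputable def eA {n : ℕ} {P T' T L I : Type} (d : ℕ) (x : SCfg k n P T' T L I) (ε : k) :
    Submodule k (Dual k (Fm k (n+1) d)) :=
  (⨆ i, Line d (em ((toTr x).1 i).1) (em ((toTr x).1 i).2)) ⊔
  (⨆ i : T', (Submodule.span k {ev d (em (x.1.2.1 i).1)} ⊔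
    Submodule.span k {(x.1.2.1 i).2.2 0 • dv d (em (x.1.2.1 i).1) (x.1.2.1 i).2.1 -
      (x.1.2.1 i).2.1 0 • dv d (em (x.1.2.1 i).1 + ε • em (x.2.1 i)) (x.1.2.1 i).2.2}) ⊔
    Submodule.span k {dq d (em (x.1.2.1 i).1) (em (x.2.1 i)) ε}) ⊔
  (⨆ i : L, Submodule.span k {ev d (em (x.1.2.2 (Sum.inr i)).1)})

theorem eA_reg {n d : ℕ} {P T' T L I : Type} (x : SCfg k n P T' T L I) :
    Reg (fun ε : k => eA d x ε) := by
  unfold eA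
  refine Reg.sup (Reg.sup (Reg.iSup fun i => Line_reg (fun _ => PL.const _) (fun _ => PL.const _))
    (Reg.iSup fun i => Reg.sup (Reg.sup (Reg.single (ev_PLs fun _ => PL.const _)) (Reg.single ?_))
      (Reg.single (dq_PLs _ _)))) (Reg.iSup fun i => Reg.single (ev_PLs fun _ => PL.const _))
  intro f
  simp only [LinearMap.sub_apply, LinearMap.smul_apply, smul_eq_mul]
  refine PL.sub (PL.const _) (PL.mul (PL.const _) (dv_PLs (a := fun ε : k => em (x.1.2.1 i).1 + ε • em (x.2.1 i))
    (b := fun _ => (x.1.2.1 i).2.2) ?_ (fun _ => PL.const _) f))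
  intro j
  simp only [Pi.add_apply, Pi.smul_apply, smul_eq_mul]
  exact PL.add (PL.const _) (PL.mul (PL.of_lin (fun _ _ => rfl) (fun _ _ => rfl)) (PL.const _))

theorem eA_zero [Infinite k] {n d : ℕ} {P T' T L I : Type} (x : SCfg k n P T' T L I) :
    eA d x 0 = (TT d (toTr x)).map (res n d).dualMap := by
  unfold eA TT PD
  simp only [Submodule.map_sup, Submodule.map_iSup, res_Line, Submodule.map_span, Set.image_singleton,
    res_ev, res_dv, dq_zero, zero_smul, add_zero]
  congr 3
  ext1 i
  congr 4
  simp only [toTr, em_v1]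
  rw [dv_sub, dv_smul, dv_smul]

noncomputable def eB {n : ℕ} {P T' T L I : Type} (d : ℕ) (x : SCfg k n P T' T L I) (ε : k) :
    Submodule k (Dual k (Fm k (n+1) d)) :=
  (⨆ i, Flat d ![em (x.1.1 i).1, em (x.1.1 i).2.1, (x.1.1 i).2.2]) ⊔
  (⨆ i, (Line d (em (x.1.2.1 i).1) (x.1.2.1 i).2.1 ⊔
    Line d (em (x.1.2.1 i).1 + ε • em (x.2.1 i)) (x.1.2.1 i).2.2)) ⊔
  (⨆ i, Line d (em (x.1.2.2 i).1) (x.1.2.2 i).2)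

theorem eB_reg {n d : ℕ} {P T' T L I : Type} (x : SCfg k n P T' T L I) :
    Reg (fun ε : k => eB d x ε) := by
  unfold eB
  refine Reg.sup (Reg.sup (Reg.iSup fun i => Flat_reg fun _ _ => PL.const _)
    (Reg.iSup fun i => Reg.sup (Line_reg (fun _ => PL.const _) (fun _ => PL.const _)) (Line_reg ?_ (fun _ => PL.const _))))
    (Reg.iSup fun i => Line_reg (fun _ => PL.const _) (fun _ => PL.const _))
  intro j
  simp only [Pi.add_apply, Pi.smul_apply, smul_eq_mul]
  exact PL.add (PL.const _) (PL.mul (PL.of_lin (fun _ _ => rfl) (fun _ _ => rfl)) (PL.const _))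

theorem eB_zero {n d : ℕ} {P T' T L I : Type} (x : SCfg k n P T' T L I) : eB d x 0 = UU d x.1 := by
  unfold eB UU
  simp

theorem UU_le_map [Infinite k] {n d : ℕ} {P T J : Type} (x : Cfg k n P T J) (h : Good x) :
    UU d x ≤ (UU (d+1) x).map (mulF d (xz k n)).dualMap := by
  obtain ⟨h1, h2, h3, h4⟩ := h
  refine sup_le (sup_le (iSup_le fun i => ?_) (iSup_le fun i => sup_le ?_ ?_)) (iSup_le fun i => ?_)
  · exact (Flat_le_map _ 2 (h1 i)).trans (Submodule.map_mono (le_UU_flat x i))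
  · exact (Flat_le_map _ 1 (h2 i)).trans (Submodule.map_mono (le_UU_T1 x i))
  · exact (Flat_le_map _ 1 (h3 i)).trans (Submodule.map_mono (le_UU_T2 x i))
  · exact (Flat_le_map _ 1 (h4 i)).trans (Submodule.map_mono (le_UU_J x i))

def fin {n : ℕ} {P T' T L I J : Type} (e : J ≃ L ⊕ I ⊕ T' ⊕ T') (x : SCfg k n P T' T L I) (ε : k) :
    Cfg k n P T J :=
  (x.1.1, fun i => ((x.1.2.2 (Sum.inl i)).1, em (x.2.2.1 i), (x.1.2.2 (Sum.inl i)).2),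
   fun j => Sum.elim (fun i => ((x.1.2.2 (Sum.inr i)).1, (x.1.2.2 (Sum.inr i)).2))
     (Sum.elim (fun i => ((x.2.2.2 i).1, em (x.2.2.2 i).2))
       (Sum.elim (fun i => ((x.1.2.1 i).1, (x.1.2.1 i).2.1))
         (fun i => ((x.1.2.1 i).1 + ε • x.2.1 i, (x.1.2.1 i).2.2)))) (e j))

theorem fin_le [Infinite k] {n d : ℕ} {P T' T L I J : Type} (e : J ≃ L ⊕ I ⊕ T' ⊕ T') (x : SCfg k n P T' T L I) (ε : k)
    (hε : ε ≠ 0) : eA d x ε ⊔ eB d x ε ≤ UU d (fin e x ε) := by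
  have hL : ∀ i : L, Line d (em (x.1.2.2 (Sum.inr i)).1) (x.1.2.2 (Sum.inr i)).2 ≤ UU d (fin e x ε) := by
    intro i
    have := le_UU_J (d := d) (fin e x ε) (e.symm (Sum.inl i))
    simpa [fin] using this
  have hI : ∀ i : I, Line d (em (x.2.2.2 i).1) (em (x.2.2.2 i).2) ≤ UU d (fin e x ε) := by
    intro i
    have := le_UU_J (d := d) (fin e x ε) (e.symm (Sum.inr (Sum.inl i)))
    simpa [fin] using this
  have h1 : ∀ i : T', Line d (em (x.1.2.1 i).1) (x.1.2.1 i).2.1 ≤ UU d (fin e x ε) := by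
    intro i
    have := le_UU_J (d := d) (fin e x ε) (e.symm (Sum.inr (Sum.inr (Sum.inl i))))
    simpa [fin] using this
  have h2 : ∀ i : T', Line d (em (x.1.2.1 i).1 + ε • em (x.2.1 i)) (x.1.2.1 i).2.2 ≤ UU d (fin e x ε) := by
    intro i
    have := le_UU_J (d := d) (fin e x ε) (e.symm (Sum.inr (Sum.inr (Sum.inr i))))
    simpa [fin, em_add, em_smul] using this
  have hP : ∀ i : P, Flat d ![em (x.1.1 i).1, em (x.1.1 i).2.1, (x.1.1 i).2.2] ≤ UU d (fin e x ε) :=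
    fun i => le_UU_flat (d := d) (fin e x ε) i
  have hT1 : ∀ i : T, Line d (em (x.1.2.2 (Sum.inl i)).1) (em (x.2.2.1 i)) ≤ UU d (fin e x ε) :=
    fun i => le_UU_T1 (d := d) (fin e x ε) i
  have hT2 : ∀ i : T, Line d (em (x.1.2.2 (Sum.inl i)).1) (x.1.2.2 (Sum.inl i)).2 ≤ UU d (fin e x ε) :=
    fun i => le_UU_T2 (d := d) (fin e x ε) i
  refine sup_le (sup_le (sup_le (iSup_le ?_) (iSup_le fun i => sup_le (sup_le ?_ ?_) ?_)) (iSup_le fun i => ?_))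
    (sup_le (sup_le (iSup_le hP) (iSup_le fun i => sup_le (h1 i) (h2 i))) (iSup_le ?_))
  · rintro (i | i | i)
    · exact hT1 i
    · exact hI i
    · refine le_trans ?_ (hP i)
      rw [Line_le_iff]
      intro s t
      have := ev_mem_Flat (d := d) ![em (x.1.1 i).1, em (x.1.1 i).2.1, (x.1.1 i).2.2] ![s, t, 0]
      simpa [Fin.sum_univ_three, toTr] using this
  · rw [Submodule.span_singleton_le_iff_mem]
    exact h1 i (ev_mem_Line_left _ _)
  · rw [Submodule.span_singleton_le_iff_mem]
    exact Submodule.sub_mem _ (Submodule.smul_mem _ _ (h1 i (dv_mem_Line _ _)))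
      (Submodule.smul_mem _ _ (h2 i (dv_mem_Line _ _)))
  · rw [Submodule.span_singleton_le_iff_mem]
    rw [dq, if_neg hε]
    exact Submodule.smul_mem _ _ (Submodule.sub_mem _ (h2 i (ev_mem_Line_left _ _)) (h1 i (ev_mem_Line_left _ _)))
  · rw [Submodule.span_singleton_le_iff_mem]
    exact hL i (ev_mem_Line_left _ _)
  · rintro (i | i)
    · exact hT2 i
    · exact hL i

theorem toTr_surj {n : ℕ} {P T' T L I : Type} (x : TCfg k n (T ⊕ I ⊕ P) T' L) :
    ∃ y : SCfg k n P T' T L I, toTr y = x := by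
  refine ⟨((fun i => ((x.1 (.inr (.inr i))).1, (x.1 (.inr (.inr i))).2, 0),
      fun i => ((x.2.1 i).1, Fin.cons 1 (x.2.1 i).2.1, Fin.cons 1 0),
      Sum.elim (fun i => ((x.1 (.inl i)).1, 0)) (fun i => (x.2.2 i, 0))),
      fun i => (x.2.1 i).2.2, fun i => (x.1 (.inl i)).2, fun i => x.1 (.inr (.inl i))), ?_⟩
  refine Prod.ext ?_ (Prod.ext ?_ ?_)
  · funext i
    rcases i with i | i | i <;> rfl
  · funext i
    refine Prod.ext rfl (Prod.ext ?_ rfl)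
    funext j
    simp [toTr, v1]
  · rfl

theorem stepN [Infinite k] {n d : ℕ} {P T' T L I J : Type} [Finite P] [Finite T'] [Finite T] [Finite L]
    (e : J ≃ L ⊕ I ⊕ T' ⊕ T') {r1 r2 : ℕ}
    (hr : ∃ x : Cfg k n P T' (T ⊕ L), r2 ≤ finrank k (UU d x))
    (ht : ∃ x : TCfg k n (T ⊕ I ⊕ P) T' L, r1 ≤ finrank k (TT (d+1) x)) :
    ∃ x : Cfg k n P T J, r1 + r2 ≤ finrank k (UU (d+1) x) := by
  have o1 : ZOpen k {x : SCfg k n P T' T L I | r2 ≤ finrank k (UU d x.1)} :=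
    ZOpen.preimage (O := {y : Cfg k n P T' (T ⊕ L) | r2 ≤ finrank k (UU d y)}) (UU_reg.isZOpen (k := k) r2)
      (LinearMap.fst k (Cfg k n P T' (T ⊕ L)) ((T' → Fin n → k) × (T → Fin n → k) × (I → (Fin n → k) × (Fin n → k))))
  have o2 : ZOpen k {x : SCfg k n P T' T L I | Good x.1} :=
    ZOpen.preimage (O := {y : Cfg k n P T' (T ⊕ L) | Good y}) (Good_open (k := k))
      (LinearMap.fst k (Cfg k n P T' (T ⊕ L)) ((T' → Fin n → k) × (T → Fin n → k) × (I → (Fin n → k) × (Fin n → k))))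
  have o3 : ZOpen k {x : SCfg k n P T' T L I | r1 ≤ finrank k (TT (d+1) (toTr x))} :=
    toTr_reg.isZOpen r1
  have n1 : {x : SCfg k n P T' T L I | r2 ≤ finrank k (UU d x.1)}.Nonempty := by
    obtain ⟨x, hx⟩ := hr
    exact ⟨(x, 0), hx⟩
  have n2 : {x : SCfg k n P T' T L I | Good x.1}.Nonempty := by
    obtain ⟨x, hx⟩ := Good_nonempty (k := k) (n := n) (P := P) (T := T') (J := T ⊕ L)
    exact ⟨(x, 0), hx⟩
  have n3 : {x : SCfg k n P T' T L I | r1 ≤ finrank k (TT (d+1) (toTr x))}.Nonempty := by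
    obtain ⟨x, hx⟩ := ht
    obtain ⟨y, hy⟩ := toTr_surj x
    refine ⟨y, ?_⟩
    rw [Set.mem_ofPred_eq, hy]
    exact hx
  obtain ⟨x, ⟨hx1, hx2⟩, hx3⟩ := (o1.inter o2).nonempty_inter o3 (o1.nonempty_inter o2 n1 n2) n3
  simp only [Set.mem_ofPred_eq] at hx1 hx2 hx3
  have o4 : ZOpen k {ε : k | r1 + r2 ≤ finrank k ↥(eA (d+1) x ε ⊔ eB (d+1) x ε)} :=
    ((eA_reg x).sup (eB_reg x)).isZOpen _
  have o5 : ZOpen k {ε : k | ε ≠ 0} := ZOpen.ne_zero (PL.of_lin (fun _ _ => rfl) (fun _ _ => rfl))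
  have n4 : {ε : k | r1 + r2 ≤ finrank k ↥(eA (d+1) x ε ⊔ eB (d+1) x ε)}.Nonempty := by
    refine ⟨0, ?_⟩
    rw [Set.mem_ofPred_eq]
    have := horace (mulF d (xz k n)) (eA (d+1) x 0) (eB (d+1) x 0) (by
      rw [eA_zero]
      rintro _ ⟨ψ, -, rfl⟩
      ext f
      have := congrArg (fun l => ψ (l f)) (res_mul_xz (k := k) n d)
      simpa using this)
    refine le_trans (Nat.add_le_add ?_ ?_) this
    · rw [eA_zero, finrank_map_dualMap_of_surj _ (res_surj _ _)]
      exact hx3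
    · rw [eB_zero]
      exact hx1.trans (Submodule.finrank_mono (UU_le_map x.1 hx2))
  obtain ⟨ε, h1, h2⟩ := o4.nonempty_inter o5 n4 ⟨1, one_ne_zero⟩
  · exact ⟨fin e x ε, le_trans h1 (Submodule.finrank_mono (fin_le e x ε h2))⟩

end StepN
end BP

namespace BP
open Module

section PDsec
variable {k : Type} [Field k]

theorem rank_add_of_det {M : Type} [AddCommGroup M] [Module k M] [FiniteDimensional k M]
    (U B : Submodule k (Dual k M)) {r : ℕ} (ψ : Fin r → Dual k M) (hψ : ∀ i, ψ i ∈ B) (f : Fin r → M)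
    (hf : ∀ j, ∀ φ ∈ U, φ (f j) = 0)
    (hdet : (Matrix.of fun i j => ψ i (f j)).det ≠ 0) : finrank k U + r ≤ finrank k ↥(U ⊔ B) := by
  have h1 := horace (Fintype.linearCombination k f) U B (by
    intro φ hφ
    ext j
    simp [Fintype.linearCombination_apply, hf j φ hφ])
  refine le_trans (Nat.add_le_add_left ?_ _) h1
  refine rank_ge_of_det _ (fun i => (Fintype.linearCombination k f).dualMap (ψ i))
    (fun i => Submodule.mem_map_of_mem (hψ i)) (fun j => Pi.single j 1) ?_
  simpa [Fintype.linearCombination_apply_single] using hdet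

theorem poly_wr [CharZero k] (F H : Polynomial k) (h : F * H.derivative = H * F.derivative)
    (hF : F.eval 0 ≠ 0) (hH : H.eval 0 = 0) : H = 0 := by
  by_contra hne
  obtain ⟨K, hK, hK0⟩ := Polynomial.exists_eq_pow_rootMultiplicity_mul_and_not_dvd H hne 0
  set m := H.rootMultiplicity 0 with hm
  have hm1 : 0 < m := (Polynomial.rootMultiplicity_pos hne).2 hH
  obtain ⟨l, hl⟩ : ∃ l, m = l + 1 := ⟨m - 1, by omega⟩
  rw [hl] at hK
  simp only [map_zero, sub_zero] at hK hK0
  have hK0' : K.eval 0 ≠ 0 := by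
    rwa [← Polynomial.coeff_zero_eq_eval_zero, ne_eq, ← Polynomial.X_dvd_iff]
  rw [hK] at h
  simp only [Polynomial.derivative_mul, Polynomial.derivative_X_pow, Nat.add_sub_cancel] at h
  have h2 : Polynomial.X ^ l * (F * (Polynomial.C ((l+1 : ℕ) : k) * K + Polynomial.X * K.derivative))
      = Polynomial.X ^ l * (Polynomial.X * K * F.derivative) := by
    linear_combination h
  have h3 := mul_left_cancel₀ (pow_ne_zero l Polynomial.X_ne_zero) h2
  have h4 := congrArg (Polynomial.eval 0) h3
  simp only [Polynomial.eval_mul, Polynomial.eval_add, Polynomial.eval_C, Polynomial.eval_X, zero_mul,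
    add_zero] at h4
  have : ((l+1 : ℕ) : k) ≠ 0 := by exact_mod_cast Nat.succ_ne_zero l
  exact mul_ne_zero hF (mul_ne_zero this hK0') h4

theorem wr_prop [CharZero k] {N d : ℕ} (f g : Fm k N d) (hf : f ≠ 0)
    (h : ∀ x y : Fin N → k, ev d y f * dv d y x g = ev d y g * dv d y x f) : ∃ c : k, g = c • f := by
  have : ∃ z : Fin N → k, eval z f.1 ≠ 0 := by
    by_contra! hz
    apply hf
    apply Subtype.ext
    apply MvPolynomial.funext
    simpa using hz
  obtain ⟨z, hz⟩ := this
  refine ⟨eval z g.1 / eval z f.1, ?_⟩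
  set c := eval z g.1 / eval z f.1 with hc
  have h' : ∀ x y : Fin N → k, ev d y f * dv d y x (g - c • f) = ev d y (g - c • f) * dv d y x f := by
    intro x y
    have := h x y
    simp only [map_sub, map_smul, smul_eq_mul]
    linear_combination this
  rw [← sub_eq_zero]
  apply Subtype.ext
  apply MvPolynomial.funext
  intro v
  have hj := poly_wr (jet z (v - z) f.1) (jet z (v - z) (g - c • f).1) (by
    apply Polynomial.funext
    intro t
    rw [Polynomial.eval_mul, Polynomial.eval_mul, jet_deriv_eval, jet_deriv_eval, jet_eval, jet_eval]
    exact h' _ _) (by rw [jet_eval]; simpa using hz) (by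
      rw [jet_eval]
      simp [hc, smul_eval, hz])
  have := congrArg (Polynomial.eval 1) hj
  rw [jet_eval] at this
  simpa using this

theorem ev_ne_zero {N d : ℕ} (x : Fin N → k) (hx : x ≠ 0) : ev d x ≠ 0 := by
  obtain ⟨i, hi⟩ := Function.ne_iff.1 hx
  intro h
  have := LinearMap.congr_fun h ⟨X i ^ d, isHomogeneous_X_pow i d⟩
  rw [ev_apply] at this
  simp at this
  exact hi this.1

/-- two-variable jet -/
noncomputable def bj {N : ℕ} (y x u : Fin N → k) (f : MvPolynomial (Fin N) k) :
    Polynomial (Polynomial k) :=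
  aeval (fun i => Polynomial.C (Polynomial.C (y i) + Polynomial.X * Polynomial.C (x i)) +
    Polynomial.X * Polynomial.C (Polynomial.C (u i))) f

theorem bj_eval {N : ℕ} (y x u : Fin N → k) (f : MvPolynomial (Fin N) k) (t τ : k) :
    ((bj y x u f).eval (Polynomial.C τ)).eval t = eval (y + t • x + τ • u) f := by
  have : (((Polynomial.evalRingHom t).comp (Polynomial.evalRingHom (Polynomial.C τ))).comp
    (aeval (fun i => Polynomial.C (Polynomial.C (y i) + Polynomial.X * Polynomial.C (x i)) +
    Polynomial.X * Polynomial.C (Polynomial.C (u i)) : Fin N → Polynomial (Polynomial k))).toRingHom) =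
      eval (y + t • x + τ • u) := by
    apply MvPolynomial.ringHom_ext
    · intro r
      simp
    · intro i
      change Polynomial.eval t (Polynomial.eval (Polynomial.C τ) (aeval _ (X i))) = _
      rw [aeval_X, eval_X]
      simp
      ring
  exact RingHom.congr_fun this f

theorem bj_map [Infinite k] {N : ℕ} (y x u : Fin N → k) (f : MvPolynomial (Fin N) k) (t : k) :
    (bj y x u f).map (Polynomial.evalRingHom t) = jet (y + t • x) u f := by
  apply Polynomial.funext
  intro τ
  rw [Polynomial.map_evalRingHom_eval, Polynomial.evalEval, bj_eval, jet_eval]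

theorem bj_eval' [Infinite k] {N : ℕ} (y x u : Fin N → k) (f : MvPolynomial (Fin N) k) (τ : k) :
    (bj y x u f).eval (Polynomial.C τ) = jet (y + τ • u) x f := by
  apply Polynomial.funext
  intro t
  rw [bj_eval, jet_eval]
  congr 2
  exact add_right_comm _ _ _

theorem det_exists [CharZero k] {N d : ℕ} (f g h : Fm k N d) (y x u : Fin N → k)
    (hΛ : ∀ t : k, eval (y + t • x) f.1 = 0) (hf : ∃ τ : k, eval (y + τ • u) f.1 ≠ 0)
    (hW : ev d y g * dv d y x h - ev d y h * dv d y x g ≠ 0) :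
    ∃ p : Fin N → k, (Matrix.of fun i j => (![ev d p, dv d p x, dv d p u] i) (![g, h, f] j)).det ≠ 0 := by
  classical
  set Φ := bj y x u f.1 with hΦ
  have hΦ0 : Φ ≠ 0 := by
    intro h0
    obtain ⟨τ, hτ⟩ := hf
    apply hτ
    have := bj_eval y x u f.1 0 τ
    rw [← hΦ, h0] at this
    simpa using this.symm
  have hΦz : Φ.eval 0 = 0 := by
    apply Polynomial.funext
    intro t
    have := bj_eval y x u f.1 t 0
    simp only [map_zero, zero_smul, add_zero] at this
    rw [hΦ, this, hΛ]
    simp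
  obtain ⟨Ψ, hΨ, hΨ0⟩ := Polynomial.exists_eq_pow_rootMultiplicity_mul_and_not_dvd Φ hΦ0 0
  set m := Φ.rootMultiplicity 0 with hm
  have hm1 : 0 < m := (Polynomial.rootMultiplicity_pos hΦ0).2 hΦz
  obtain ⟨l, hl⟩ : ∃ l, m = l + 1 := ⟨m - 1, by omega⟩
  rw [hl] at hΨ
  simp only [map_zero, sub_zero] at hΨ hΨ0
  rw [Polynomial.X_dvd_iff] at hΨ0
  -- choose t0
  set Wp : Polynomial k := jet y x g.1 * (jet y x h.1).derivative - jet y x h.1 * (jet y x g.1).derivative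
    with hWp
  have hWpe : ∀ t, Wp.eval t = ev d (y + t • x) g * dv d (y + t • x) x h -
      ev d (y + t • x) h * dv d (y + t • x) x g := by
    intro t
    simp [hWp, jet_deriv_eval, jet_eval, ev_apply]
  have hWp0 : Wp ≠ 0 := by
    intro h0
    have := hWpe 0
    rw [h0] at this
    apply hW
    simpa using this.symm
  obtain ⟨t0, ht0⟩ : ∃ t0, (Wp * Ψ.coeff 0).eval t0 ≠ 0 := by
    by_contra! hz
    exact mul_ne_zero hWp0 hΨ0 (Polynomial.funext (by simpa using hz))
  rw [Polynomial.eval_mul] at ht0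
  have htW := left_ne_zero_of_mul ht0
  have htΨ := right_ne_zero_of_mul ht0
  rw [hWpe] at htW
  set A := Ψ.map (Polynomial.evalRingHom t0) with hA
  have hjA : jet (y + t0 • x) u f.1 = Polynomial.X ^ (l+1) * A := by
    rw [← bj_map, ← hΦ, hΨ]
    simp [hA]
  have hA0 : A.eval 0 ≠ 0 := by
    rw [← Polynomial.coeff_zero_eq_eval_zero, hA, Polynomial.coeff_map]
    exact htΨ
  set r : k → k := fun τ => ((Ψ.eval (Polynomial.C τ)).derivative).eval t0 with hr
  have hrPL : PL k r := by
    have : r = fun τ => ∑ i ∈ Finset.range (Ψ.natDegree + 1), ((Ψ.coeff i).derivative).eval t0 * τ ^ i := by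
      funext τ
      change Polynomial.eval t0 (Polynomial.derivative (Polynomial.eval (Polynomial.C τ) Ψ)) = _
      rw [Polynomial.eval_eq_sum_range (p := Ψ), Polynomial.derivative_sum, Polynomial.eval_finsetSum]
      refine Finset.sum_congr rfl fun i _ => ?_
      rw [← Polynomial.C_pow, Polynomial.derivative_mul, Polynomial.derivative_C]
      simp
    rw [this]
    refine PL.sum _ fun i => PL.mul (PL.const _) ?_
    simpa using PL.poly (Polynomial.X ^ i : Polynomial k)
  set P : k → Fin N → k := fun τ => y + t0 • x + τ • u with hP
  have e1 : ∀ τ, ev d (P τ) f = τ ^ (l+1) * A.eval τ := by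
    intro τ
    rw [ev_apply, hP, ← jet_eval, hjA]
    simp
  have e2 : ∀ τ, dv d (P τ) x f = τ ^ (l+1) * r τ := by
    intro τ
    have h1 := jet_deriv_eval (y + τ • u) x f t0
    rw [← bj_eval', ← hΦ, hΨ] at h1
    rw [show P τ = y + τ • u + t0 • x from add_right_comm _ _ _, ← h1]
    simp only [Polynomial.eval_mul, Polynomial.eval_pow, Polynomial.eval_X, ← Polynomial.C_pow,
      Polynomial.derivative_C_mul, Polynomial.eval_C, hr]
  have e3 : ∀ τ, dv d (P τ) u f = (l+1) * τ ^ l * A.eval τ + τ ^ (l+1) * A.derivative.eval τ := by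
    intro τ
    rw [hP, ← jet_deriv_eval, hjA]
    simp [Polynomial.derivative_mul]
  have hPc : ∀ i, PL k (fun τ => P τ i) := by
    intro i
    simp only [hP, Pi.add_apply, Pi.smul_apply, smul_eq_mul]
    exact PL.add (PL.const _) (PL.mul (PL.of_lin (fun _ _ => rfl) (fun _ _ => rfl)) (PL.const _))
  have pe : ∀ q : Fm k N d, PL k (fun τ => ev d (P τ) q) := fun q => ev_PLs hPc q
  have pd : ∀ (q : Fm k N d) (z : Fin N → k), PL k (fun τ => dv d (P τ) z q) :=
    fun q z => dv_PLs (b := fun _ => z) hPc (fun _ => PL.const _) q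
  have pid : PL k (fun τ : k => τ) := PL.of_lin (fun _ _ => rfl) (fun _ _ => rfl)
  set Ee : k → k := fun τ => τ * (A.eval τ * (dv d (P τ) x g * dv d (P τ) u h - dv d (P τ) x h * dv d (P τ) u g)
      - r τ * (ev d (P τ) g * dv d (P τ) u h - ev d (P τ) h * dv d (P τ) u g)
      + A.derivative.eval τ * (ev d (P τ) g * dv d (P τ) x h - ev d (P τ) h * dv d (P τ) x g))
    + (l+1) * A.eval τ * (ev d (P τ) g * dv d (P τ) x h - ev d (P τ) h * dv d (P τ) x g) with hEe
  have hEPL : PL k Ee := by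
    refine PL.add (PL.mul pid (PL.add (PL.sub (PL.mul (PL.poly A) ?_) (PL.mul hrPL ?_)) (PL.mul (PL.poly _) ?_)))
      (PL.mul (PL.mul (PL.const _) (PL.poly A)) ?_)
    · exact PL.sub (PL.mul (pd _ _) (pd _ _)) (PL.mul (pd _ _) (pd _ _))
    all_goals exact PL.sub (PL.mul (pe _) (pd _ _)) (PL.mul (pe _) (pd _ _))
  have hE0 : Ee 0 ≠ 0 := by
    simp only [hEe, zero_mul, zero_add, hP, zero_smul, add_zero]
    have : ((l:k)+1) ≠ 0 := by exact_mod_cast Nat.succ_ne_zero l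
    exact mul_ne_zero (mul_ne_zero this hA0) htW
  obtain ⟨τ, hτ1, hτ2⟩ := (ZOpen.ne_zero hEPL).nonempty_inter (ZOpen.ne_zero pid) ⟨0, hE0⟩ ⟨1, one_ne_zero⟩
  refine ⟨P τ, ?_⟩
  have : (Matrix.of fun i j => (![ev d (P τ), dv d (P τ) x, dv d (P τ) u] i) (![g, h, f] j)).det =
      τ ^ l * Ee τ := by
    rw [Matrix.det_fin_three]
    simp only [Matrix.of_apply, Matrix.cons_val_zero, Matrix.cons_val_one, Matrix.cons_val, e1, e2, e3, hEe]
    ring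
  rw [this]
  exact mul_ne_zero (pow_ne_zero _ hτ2) hτ1

theorem dv_zero {N d : ℕ} (p : Fin N → k) : dv d p (0 : Fin N → k) = 0 := by
  ext f
  simp [dv_apply]

/-- forms killed by `U` -/
theorem exists_killed {M : Type} [AddCommGroup M] [Module k M] [FiniteDimensional k M]
    (U : Submodule k (Dual k M)) {r : ℕ} (h : finrank k U + r ≤ finrank k M) :
    ∃ f : Fin r → M, LinearIndependent k f ∧ ∀ j, ∀ φ ∈ U, φ (f j) = 0 := by
  have h1 : r ≤ finrank k U.dualCoannihilator := by
    have := Subspace.finrank_add_finrank_dualCoannihilator_eq U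
    omega
  obtain ⟨f, hf, hl⟩ := exists_li_of_rank _ h1
  refine ⟨f, hl, fun j φ hφ => ?_⟩
  exact (Submodule.mem_dualCoannihilator _).1 (hf j) φ hφ

theorem pd_one [CharZero k] {N d : ℕ} (hd : 1 ≤ d) (U : Submodule k (Dual k (Fm k N d)))
    (hU : finrank k U + (d + 1) ≤ finrank k (Fm k N d)) (Z : Set (Fin N → k))
    (hZ : Submodule.span k Z = ⊤) (hZU : ∀ z ∈ Z, ev d z ∈ U) :
    ∃ p v w : Fin N → k, finrank k U + 3 ≤ finrank k ↥(U ⊔ PD d p v w) := by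
  obtain ⟨F, hF, hFU⟩ := exists_killed U (r := 2) (by omega)
  have hF0 : F 0 ≠ 0 := hF.ne_zero 0
  obtain ⟨x, hx, y, hxy⟩ : ∃ x ∈ Z, ∃ y, ev d y (F 0) * dv d y x (F 1) - ev d y (F 1) * dv d y x (F 0) ≠ 0 := by
    by_contra! hno
    obtain ⟨c, hc⟩ := wr_prop (F 0) (F 1) hF0 (by
      intro x y
      have hx : x ∈ Submodule.span k Z := by rw [hZ]; trivial
      induction hx using Submodule.span_induction with
      | mem x h => exact sub_eq_zero.1 (hno x h y)
      | zero => simp [dv_zero]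
      | add x z _ _ h1 h2 =>
        rw [dv_add]
        simp only [LinearMap.add_apply]
        linear_combination h1 + h2
      | smul a x _ h1 =>
        rw [dv_smul]
        simp only [LinearMap.smul_apply, smul_eq_mul]
        linear_combination a * h1)
    have := Fintype.linearIndependent_iff.1 hF ![-c, 1] (by simp [Fin.sum_univ_two, hc]) 1
    simp at this
  have hx0 : x ≠ 0 := by
    rintro rfl
    simp [dv_zero] at hxy
  have hrank : finrank k ↥(U ⊔ Line d x y) + 1 ≤ finrank k (Fm k N d) := by
    have h1 := Submodule.finrank_sup_add_finrank_inf_eq U (Line d x y)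
    have h2 := Line_rank_le (d := d) x y
    have h3 : 1 ≤ finrank k ↥(U ⊓ Line d x y) := by
      apply Submodule.one_le_finrank_iff.2
      intro h0
      have : ev d x ∈ U ⊓ Line d x y := ⟨hZU x hx, ev_mem_Line_left _ _⟩
      rw [h0, Submodule.mem_bot] at this
      exact ev_ne_zero x hx0 this
    omega
  obtain ⟨G, hG, hGU⟩ := exists_killed (U ⊔ Line d x y) (r := 1) hrank
  have hG0 : G 0 ≠ 0 := hG.ne_zero 0
  have : ∃ z : Fin N → k, eval z (G 0).1 ≠ 0 := by
    by_contra! hz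
    apply hG0
    apply Subtype.ext
    apply MvPolynomial.funext
    simpa using hz
  obtain ⟨u, hu⟩ := this
  obtain ⟨p, hp⟩ := det_exists (G 0) (F 0) (F 1) y x (u - y) (by
    intro t
    have := hGU 0 _ (Submodule.mem_sup_right (ev_mem_Line x y t 1))
    rw [ev_apply, one_smul, add_comm] at this
    exact this) ⟨1, by simpa using hu⟩ hxy
  refine ⟨p, x, u - y, rank_add_of_det U _ ![ev d p, dv d p x, dv d p (u-y)] ?_ ![F 0, F 1, G 0] ?_ hp⟩
  · intro i
    unfold PD
    fin_cases i
    · exact Submodule.mem_sup_left (Submodule.mem_sup_left (Submodule.mem_span_singleton_self _))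
    · exact Submodule.mem_sup_left (Submodule.mem_sup_right (Submodule.mem_span_singleton_self _))
    · exact Submodule.mem_sup_right (Submodule.mem_span_singleton_self _)
  · intro j φ hφ
    fin_cases j
    · exact hFU 0 φ hφ
    · exact hFU 1 φ hφ
    · exact hGU 0 φ (Submodule.mem_sup_left hφ)

theorem PD_rank_le {N d : ℕ} (p v w : Fin N → k) : finrank k (PD d p v w) ≤ 3 := by
  unfold PD
  have h1 := Submodule.finrank_add_le_finrank_add_finrank (Submodule.span k {ev d p} ⊔ Submodule.span k {dv d p v})
    (Submodule.span k {dv d p w})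
  have h2 := Submodule.finrank_add_le_finrank_add_finrank (Submodule.span k {ev d p}) (Submodule.span k {dv d p v})
  have h3 : ∀ φ : Dual k (Fm k N d), finrank k (Submodule.span k {φ}) ≤ 1 := fun φ => by
    simpa using finrank_span_le_card (R := k) ({φ} : Set (Dual k (Fm k N d)))
  have := h3 (ev d p)
  have := h3 (dv d p v)
  have := h3 (dv d p w)
  omega

theorem pd_many [CharZero k] {N d : ℕ} (hd : 1 ≤ d) (U : Submodule k (Dual k (Fm k N d)))
    (Z : Set (Fin N → k))
    (hZ : Submodule.span k Z = ⊤) (hZU : ∀ z ∈ Z, ev d z ∈ U) (D : Type) [Fintype D]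
    (hU : Fintype.card D = 0 ∨ finrank k U + 3 * Fintype.card D + (d + 1) ≤ finrank k (Fm k N d) + 3) :
    ∃ q : D → (Fin N → k) × (Fin N → k) × (Fin N → k),
      finrank k U + 3 * Fintype.card D ≤
        finrank k ↥(U ⊔ ⨆ i, PD d (q i).1 (q i).2.1 (q i).2.2) := by
  have key : ∀ c : ℕ, (c = 0 ∨ finrank k U + 3 * c + (d + 1) ≤ finrank k (Fm k N d) + 3) →
      ∃ q : Fin c → (Fin N → k) × (Fin N → k) × (Fin N → k),
      finrank k U + 3 * c =
        finrank k ↥(U ⊔ ⨆ i, PD d (q i).1 (q i).2.1 (q i).2.2) := by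
    intro c
    induction c with
    | zero =>
      intro _
      refine ⟨fun _ => 0, ?_⟩
      have e0 : U = U ⊔ ⨆ i : Fin 0, PD d ((fun _ => 0 : Fin 0 → (Fin N → k) × (Fin N → k) × (Fin N → k)) i).1 0 0 := by
        rw [iSup_of_empty, sup_bot_eq]
      exact le_antisymm (Submodule.finrank_mono e0.le) (Submodule.finrank_mono e0.ge)
    | succ c ih =>
      intro h
      have h : finrank k U + 3 * (c+1) + (d + 1) ≤ finrank k (Fm k N d) + 3 := by simpa using h
      obtain ⟨q, hq⟩ := ih (by right; omega)
      obtain ⟨p, v, w, hp⟩ := pd_one hd (U ⊔ ⨆ i, PD d (q i).1 (q i).2.1 (q i).2.2) (by omega) Z hZ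
            (fun z hz => Submodule.mem_sup_left (hZU z hz))
      have h5 := PD_rank_le (d := d) p v w
      have h6 := Submodule.finrank_add_le_finrank_add_finrank
        (U ⊔ ⨆ i, PD d (q i).1 (q i).2.1 (q i).2.2) (PD d p v w)
      refine ⟨Fin.snoc (α := fun _ => (Fin N → k) × (Fin N → k) × (Fin N → k)) q (p, v, w), ?_⟩
      have e : (U ⊔ ⨆ i, PD d (q i).1 (q i).2.1 (q i).2.2) ⊔ PD d p v w =
        U ⊔ ⨆ i : Fin (c+1), PD d (Fin.snoc (α := fun _ => (Fin N → k) × (Fin N → k) × (Fin N → k)) q (p, v, w) i).1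
          (Fin.snoc (α := fun _ => (Fin N → k) × (Fin N → k) × (Fin N → k)) q (p, v, w) i).2.1
          (Fin.snoc (α := fun _ => (Fin N → k) × (Fin N → k) × (Fin N → k)) q (p, v, w) i).2.2 := by
        apply le_antisymm
        · refine sup_le (sup_le le_sup_left (le_sup_of_le_right (iSup_le fun i => ?_))) (le_sup_of_le_right ?_)
          · exact le_iSup_of_le i.castSucc (by simp)
          · exact le_iSup_of_le (Fin.last c) (by simp)
        · refine sup_le (le_sup_of_le_left le_sup_left) (iSup_le fun i => ?_)
          refine Fin.lastCases ?_ (fun i => ?_) i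
          · simp
          · simp only [Fin.snoc_castSucc]
            exact le_sup_of_le_left (le_sup_of_le_right (le_iSup (fun i => PD d (q i).1 (q i).2.1 (q i).2.2) i))
      rw [← e]
      omega
  obtain ⟨q, hq⟩ := key _ hU
  let e := Fintype.equivFin D
  refine ⟨q ∘ e, ?_⟩
  have := e.iSup_comp (g := fun i => PD d (q i).1 (q i).2.1 (q i).2.2)
  exact hq.le.trans (Submodule.finrank_mono (sup_le_sup_left this.ge U))

end PDsec
end BP

namespace BP
open Module

section Ind
variable {k : Type} [Field k]

/-- generic lines in `k^N` have maximal rank in degree `d` -/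
def HL (k : Type) [Field k] (N d : ℕ) : Prop :=
  ∀ (J : Type) [Fintype J], ∃ x : J → (Fin N → k) × (Fin N → k),
    min (finrank k (Fm k N d)) ((d+1) * Fintype.card J) ≤ finrank k ↥(⨆ i, Line d (x i).1 (x i).2)

theorem lines_reg {N d : ℕ} {J : Type} :
    Reg (fun x : J → (Fin N → k) × (Fin N → k) => ⨆ i, Line d (x i).1 (x i).2) :=
  Reg.iSup fun i => Line_reg (fun _ => PL.of_lin (fun _ _ => rfl) (fun _ _ => rfl))
    (fun _ => PL.of_lin (fun _ _ => rfl) (fun _ _ => rfl))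

theorem eq_top_of_rank {M : Type} [AddCommGroup M] [Module k M] [FiniteDimensional k M]
    (U : Submodule k (Dual k M)) (h : finrank k M ≤ finrank k U) : U = ⊤ := by
  apply Submodule.eq_top_of_finrank_eq
  rw [Subspace.dual_finrank_eq]
  exact le_antisymm (finrank_le_dim U) h

theorem finrank_iSup_le {M : Type} [AddCommGroup M] [Module k M] [FiniteDimensional k M]
    {J : Type} [Fintype J] (W : J → Submodule k M) (b : ℕ) (h : ∀ i, finrank k (W i) ≤ b) :
    finrank k ↥(⨆ i, W i) ≤ b * Fintype.card J := by
  classical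
  have key : ∀ s : Finset J, finrank k ↥(⨆ i ∈ s, W i) ≤ b * s.card := by
    intro s
    induction s using Finset.induction_on with
    | empty => simp
    | insert a s ha ih =>
      rw [Finset.iSup_insert, Finset.card_insert_of_notMem ha]
      have := Submodule.finrank_add_le_finrank_add_finrank (W a) (⨆ i ∈ s, W i)
      have := h a
      rw [Nat.mul_add]
      omega
  have e : (⨆ i, W i) ≤ ⨆ i ∈ Finset.univ, W i := by simp
  exact (Submodule.finrank_mono e).trans (key Finset.univ)

theorem lines_span {N : ℕ} {J : Type} (x : J → (Fin N → k) × (Fin N → k))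
    (h : finrank k (Fm k N 1) ≤ finrank k ↥(⨆ i, Line 1 (x i).1 (x i).2)) :
    Submodule.span k {v : Fin N → k | ∃ i, ∃ s t : k, v = s • (x i).1 + t • (x i).2} = ⊤ := by
  by_contra hne
  obtain ⟨f, hf0, hf⟩ := Submodule.exists_le_ker_of_lt_top _ (lt_top_iff_ne_top.2 hne)
  apply hf0
  have hF : (∑ i, C (f (Pi.single i 1)) * X i : MvPolynomial (Fin N) k) ∈ homogeneousSubmodule (Fin N) k 1 := by
    apply Submodule.sum_mem
    intro i _
    rw [mem_homogeneousSubmodule]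
    exact (isHomogeneous_X k i).C_mul _
  have hv : ∀ v, ev 1 v ⟨_, hF⟩ = f v := by
    intro v
    rw [ev_apply]
    simp only [map_sum, map_mul, eval_C, eval_X]
    conv_rhs => rw [pi_eq_sum_univ' v]
    rw [map_sum]
    refine Finset.sum_congr rfl fun i _ => ?_
    rw [map_smul, smul_eq_mul, mul_comm]
  have key : ∀ φ ∈ ⨆ i, Line 1 (x i).1 (x i).2, φ ⟨_, hF⟩ = 0 := by
    have : (⨆ i, Line 1 (x i).1 (x i).2) ≤ (LinearMap.ker (Dual.eval k (Fm k N 1) ⟨_, hF⟩)) := by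
      refine iSup_le fun i => (Line_le_iff _ _ _).2 fun s t => ?_
      rw [LinearMap.mem_ker, Dual.eval_apply, hv]
      exact hf (Submodule.subset_span ⟨i, s, t, rfl⟩)
    intro φ hφ
    exact this hφ
  rw [eq_top_of_rank _ h] at key
  ext v
  have := key (ev 1 (Pi.single v 1)) trivial
  rw [hv] at this
  simpa using this

theorem trace_exists [CharZero k] {N d : ℕ} (hd : 1 ≤ d) (h1 : HL k N 1) (h : HL k N d)
    (A D Z : Type) [Fintype A] [Fintype D] [Fintype Z]
    (hc : Fintype.card D = 0 ∨ (finrank k (Fm k N 1) ≤ 2 * Fintype.card A ∧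
      (d+1) * Fintype.card A + 3 * Fintype.card D + (d+1) ≤ finrank k (Fm k N d) + 3)) :
    ∃ x : TCfg k N A D Z, min (finrank k (Fm k N d))
      ((d+1) * Fintype.card A + 3 * Fintype.card D + Fintype.card Z) ≤ finrank k (TT d x) := by
  obtain ⟨x, hx, q, hq⟩ : ∃ (x : A → (Fin N → k) × (Fin N → k)),
    min (finrank k (Fm k N d)) ((d+1) * Fintype.card A) ≤ finrank k ↥(⨆ i, Line d (x i).1 (x i).2) ∧
    ∃ q : D → (Fin N → k) × (Fin N → k) × (Fin N → k),
      finrank k ↥(⨆ i, Line d (x i).1 (x i).2) + 3 * Fintype.card D ≤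
        finrank k ↥((⨆ i, Line d (x i).1 (x i).2) ⊔ ⨆ i, PD d (q i).1 (q i).2.1 (q i).2.2) := by
    rcases hc with hc | ⟨hc1, hc2⟩
    · obtain ⟨x, hx⟩ := h A
      refine ⟨x, hx, fun _ => 0, ?_⟩
      rw [hc]
      exact Submodule.finrank_mono le_sup_left
    · obtain ⟨x, hx1, hx2⟩ := (lines_reg (k := k) (N := N) (d := d) (J := A)).isZOpen
        (min (finrank k (Fm k N d)) ((d+1) * Fintype.card A)) |>.nonempty_inter
        ((lines_reg (k := k) (N := N) (d := 1) (J := A)).isZOpen (finrank k (Fm k N 1))) (h A)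
        (by
          obtain ⟨x, hx⟩ := h1 A
          refine ⟨x, le_trans ?_ hx⟩
          simp only [le_min_iff, le_refl, true_and]
          omega)
      refine ⟨x, hx1, ?_⟩
      refine pd_many hd _ _ (lines_span x hx2) ?_ D ?_
      · rintro z ⟨i, s, t, rfl⟩
        exact (le_iSup (fun i => Line d (x i).1 (x i).2) i) (ev_mem_Line _ _ _ _)
      · by_cases hD : Fintype.card D = 0
        · left; exact hD
        · right
          have hle : finrank k ↥(⨆ i, Line d (x i).1 (x i).2) ≤ (d+1) * Fintype.card A := by
            exact finrank_iSup_le _ (d+1) fun i => Line_rank_le _ _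
          omega
  obtain ⟨z, hz⟩ := add_generic' (fun v : Fin N → k => ev d v) (span_ev N d) 0
    ((⨆ i, Line d (x i).1 (x i).2) ⊔ ⨆ i, PD d (q i).1 (q i).2.1 (q i).2.2) Z
  refine ⟨(x, q, z), le_trans ?_ hz⟩
  simp only [le_min_iff, min_le_iff] at *
  omega

/-- degree one base case -/
theorem base_one [CharZero k] {n : ℕ} (P T J : Type) [Fintype P] [Fintype T] [Fintype J]
    (h : 2 * Fintype.card P + Fintype.card T + Fintype.card J ≤ finrank k (Fm k n 1)) :
    ∃ x : Cfg k n P T J, min (finrank k (Fm k (n+1) 1))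
      (3 * Fintype.card P + 3 * Fintype.card T + 2 * Fintype.card J) ≤ finrank k (UU 1 x) := by
  obtain ⟨z, hz⟩ := add_generic' (fun v : Fin n → k => ev 1 v) (span_ev n 1) 0 ⊥ (P ⊕ P ⊕ T ⊕ J)
  obtain ⟨y, hy⟩ := add_generic' (fun v : Fin (n+1) → k => ev 1 v) (span_ev (n+1) 1) 0
    (((⊥ : Submodule k (Dual k (Fm k n 1))) ⊔ ⨆ j, Submodule.span k {ev 1 (z j)}).map (res n 1).dualMap)
    (P ⊕ T ⊕ T ⊕ J)
  rw [finrank_map_dualMap_of_surj _ (res_surj _ _)] at hy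
  simp only [Fintype.card_sum] at hy hz
  refine ⟨(fun i => (z (.inl i), z (.inr (.inl i)), y (.inl i)),
    fun i => (z (.inr (.inr (.inl i))), y (.inr (.inl i)), y (.inr (.inr (.inl i)))),
    fun i => (z (.inr (.inr (.inr i))), y (.inr (.inr (.inr i))))), ?_⟩
  have h2 : finrank k ↥(⊥ : Submodule k (Dual k (Fm k n 1))) = 0 := finrank_bot _ _
  rw [h2] at hz
  refine le_trans (le_trans ?_ hy) (Submodule.finrank_mono ?_)
  · simp only [le_min_iff, min_le_iff] at *
    omega
  · rw [Submodule.map_sup, Submodule.map_iSup, Submodule.map_bot, bot_sup_eq]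
    set x : Cfg k n P T J := (fun i => (z (.inl i), z (.inr (.inl i)), y (.inl i)),
      fun i => (z (.inr (.inr (.inl i))), y (.inr (.inl i)), y (.inr (.inr (.inl i)))),
      fun i => (z (.inr (.inr (.inr i))), y (.inr (.inr (.inr i))))) with hx
    have f3 : ∀ (i : P) (j : Fin 3), ev 1 (![em (x.1 i).1, em (x.1 i).2.1, (x.1 i).2.2] j) ∈ UU 1 x := by
      intro i j
      apply le_UU_flat x i
      have := ev_mem_Flat (d := 1) ![em (x.1 i).1, em (x.1 i).2.1, (x.1 i).2.2] (Pi.single j 1)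
      have e : ∑ l, (Pi.single j 1 : Fin 3 → k) l • (![em (x.1 i).1, em (x.1 i).2.1, (x.1 i).2.2] l) =
        ![em (x.1 i).1, em (x.1 i).2.1, (x.1 i).2.2] j := by
        rw [Finset.sum_eq_single j]
        · simp
        · intro b _ hb
          simp [Pi.single_apply, hb]
        · simp
      rwa [e] at this
    refine sup_le (iSup_le fun j => ?_) (iSup_le fun j => ?_)
    · rw [Submodule.map_span, Set.image_singleton, res_ev, Submodule.span_singleton_le_iff_mem]
      rcases j with i | i | i | i
      · exact f3 i 0
      · exact f3 i 1
      · exact le_UU_T1 x i (ev_mem_Line_left _ _)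
      · exact le_UU_J x i (ev_mem_Line_left _ _)
    · rw [Submodule.span_singleton_le_iff_mem]
      rcases j with i | i | i | i
      · exact f3 i 2
      · exact le_UU_T1 x i (ev_mem_Line_right _ _)
      · exact le_UU_T2 x i (ev_mem_Line_right _ _)
      · exact le_UU_J x i (ev_mem_Line_right _ _)

end Ind
end BP

namespace BP
open Module

section Ind2
variable {k : Type} [Field k]

/-- trace statement -/
def TR (k : Type) [Field k] (N d a c z : ℕ) : Prop :=
  ∀ (A D Z : Type) [Fintype A] [Fintype D] [Fintype Z], Fintype.card A = a → Fintype.card D = c →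
    Fintype.card Z = z → ∃ x : TCfg k N A D Z, min (finrank k (Fm k N d)) ((d+1) * a + 3 * c + z) ≤
      finrank k (TT d x)

def IndS (k : Type) [Field k] (n π d S c : ℕ) : Prop :=
  ∀ (P : Type) [Fintype P], Fintype.card P = π →
  (∀ (T J : Type) [Fintype T] [Fintype J], Fintype.card T = c → Fintype.card J + 2 * c = S →
    ∃ x : Cfg k n P T J, (n+d).choose n ≤ finrank k (UU d x)) ∧
  (∀ (J : Type) [Fintype J], Fintype.card J + 1 = S →
    ∃ x : Cfg k n P Empty J, π * (d+2).choose 2 + (d+1) * Fintype.card J ≤ finrank k (UU d x))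

theorem UU_option_le {n d : ℕ} {P J : Type} (x : Cfg k n P Empty (Option J)) :
    finrank k (UU d x) ≤ finrank k (UU d ((x.1, x.2.1, fun j => x.2.2 (some j)) : Cfg k n P Empty J)) + (d+1) := by
  have h : UU d x ≤ UU d ((x.1, x.2.1, fun j => x.2.2 (some j)) : Cfg k n P Empty J) ⊔
      Line d (em (x.2.2 none).1) (x.2.2 none).2 := by
    refine sup_le (sup_le (iSup_le fun i => ?_) (iSup_le fun i => i.elim)) (iSup_le fun i => ?_)
    · exact le_sup_of_le_left (le_UU_flat (d := d) ((x.1, x.2.1, fun j => x.2.2 (some j)) : Cfg k n P Empty J) i)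
    · rcases i with _ | i
      · exact le_sup_right
      · exact le_sup_of_le_left (le_UU_J (d := d) ((x.1, x.2.1, fun j => x.2.2 (some j)) : Cfg k n P Empty J) i)
  have h1 := Submodule.finrank_mono h
  have h2 := Submodule.finrank_add_le_finrank_add_finrank
    (UU d ((x.1, x.2.1, fun j => x.2.2 (some j)) : Cfg k n P Empty J)) (Line d (em (x.2.2 none).1) (x.2.2 none).2)
  have h3 := Line_rank_le (d := d) (em (x.2.2 none).1) (x.2.2 none).2
  omega

theorem choose_pascal (n d : ℕ) : ((n+1)+(d+1)).choose (n+1) = (n+(d+1)).choose n + ((n+1)+d).choose (n+1) := by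
  have := Nat.choose_succ_succ (n + 1 + d) n
  rw [show (n+1)+(d+1) = (n+1+d).succ by omega, show n + (d+1) = n+1+d by omega]
  exact this

theorem tri_succ (d : ℕ) : (d+1+2).choose 2 = (d+2).choose 2 + (d+2) := by
  have := Nat.choose_succ_succ (d+2) 1
  simp at this
  rw [show d+1+2 = d+2+1 by omega, this]
  omega

theorem ind_step [CharZero k] {m d π S' c' S c : ℕ}
    (hN' : ((m+1)+d).choose (m+1) + c' = π * (d+2).choose 2 + (d+1) * S')
    (hN : ((m+1)+(d+1)).choose (m+1) + c = π * (d+1+2).choose 2 + (d+2) * S)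
    (hc : c ≤ d + 1) (ha : c + 2 * c' ≤ S') (hcS : S' + c ≤ S) (h1 : S' + 1 ≤ S)
    (hT1 : TR k (m+1) (d+1) (S - S' + π) c' (S' - 2 * c' - c))
    (hT2 : c = 0 ∨ TR k (m+1) (d+1) (S - S' - 1 + π) c' (S' - 2 * c'))
    (ih : IndS k (m+1) π d S' c') : IndS k (m+1) π (d+1) S c := by
  intro P _ hP
  obtain ⟨ih1, -⟩ := ih P hP
  have hdim : finrank k (Fm k (m+1) (d+1)) = (m+(d+1)).choose m := finrank_Fm m (d+1)
  have hpas := choose_pascal m d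
  have htri := tri_succ d
  have ex : ∀ (T J : Type) [Fintype T] [Fintype J], Fintype.card T = c → Fintype.card J + 2 * c = S →
    ∃ x : Cfg k (m+1) P T J, ((m+1)+(d+1)).choose (m+1) ≤ finrank k (UU (d+1) x) := by
    intro T J _ _ hT hJ
    obtain ⟨x, hx⟩ := ih1 (Fin c') (T ⊕ Fin (S' - 2 * c' - c)) (by simp) (by
      simp only [Fintype.card_sum, Fintype.card_fin]
      omega)
    obtain ⟨y, hy⟩ := hT1 (T ⊕ Fin (S - S' - c) ⊕ P) (Fin c') (Fin (S' - 2 * c' - c)) (by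
      simp only [Fintype.card_sum, Fintype.card_fin]
      omega) (by simp) (by simp)
    have e : J ≃ Fin (S' - 2 * c' - c) ⊕ Fin (S - S' - c) ⊕ Fin c' ⊕ Fin c' :=
      Fintype.equivOfCardEq (by
        simp only [Fintype.card_sum, Fintype.card_fin]
        omega)
    obtain ⟨z, hz⟩ := stepN e ⟨x, hx⟩ ⟨y, hy⟩
    refine ⟨z, le_trans ?_ hz⟩
    rw [hdim, min_eq_left]
    · omega
    · obtain ⟨s1, rfl⟩ : ∃ s1, S = S' + s1 := ⟨S - S', by omega⟩
      obtain ⟨l, rfl⟩ : ∃ l, S' = c + 2 * c' + l := ⟨S' - (c + 2 * c'), by omega⟩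
      have e1 : c + 2 * c' + l + s1 - (c + 2 * c' + l) = s1 := by omega
      have e2 : c + 2 * c' + l - 2 * c' - c = l := by omega
      rw [e1, e2]
      rw [htri] at hN
      nlinarith [hN, hN', hpas]
  refine ⟨ex, ?_⟩
  intro J _ hJ
  rcases hT2 with rfl | hT2
  · obtain ⟨x, hx⟩ := ex Empty (Option J) (by simp) (by simp; omega)
    refine ⟨(x.1, x.2.1, fun j => x.2.2 (some j)), ?_⟩
    · have := UU_option_le (d := d+1) x
      rw [show d + 1 + 1 = d + 2 from rfl] at *
      have h2 : (d+2) * S = (d+2) * Fintype.card J + (d+2) := by rw [← hJ]; ring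
      omega
  · obtain ⟨x, hx⟩ := ih1 (Fin c') (Empty ⊕ Fin (S' - 2 * c')) (by simp) (by
      simp only [Fintype.card_sum, Fintype.card_fin, Fintype.card_empty]
      omega)
    obtain ⟨y, hy⟩ := hT2 (Empty ⊕ Fin (S - S' - 1) ⊕ P) (Fin c') (Fin (S' - 2 * c')) (by
      simp only [Fintype.card_sum, Fintype.card_fin, Fintype.card_empty]
      omega) (by simp) (by simp)
    have e : J ≃ Fin (S' - 2 * c') ⊕ Fin (S - S' - 1) ⊕ Fin c' ⊕ Fin c' :=
      Fintype.equivOfCardEq (by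
        simp only [Fintype.card_sum, Fintype.card_fin]
        omega)
    obtain ⟨z, hz⟩ := stepN e ⟨x, hx⟩ ⟨y, hy⟩
    refine ⟨z, le_trans ?_ hz⟩
    rw [hdim]
    obtain ⟨s1, rfl⟩ : ∃ s1, S = S' + s1 + 1 := ⟨S - S' - 1, by omega⟩
    obtain ⟨l, rfl⟩ : ∃ l, S' = 2 * c' + l := ⟨S' - (2 * c'), by omega⟩
    have e1 : 2 * c' + l + s1 + 1 - (2 * c' + l) - 1 = s1 := by omega
    have e2 : 2 * c' + l - 2 * c' = l := by omega
    have e3 : Fintype.card J = 2 * c' + l + s1 := by omega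
    rw [e1, e2, e3]
    rw [htri] at hN ⊢
    rw [Nat.min_def]
    clear e e1 e2 e3 hx hy hz x y z ex hT2 hT1 ih1
    generalize (d+2).choose 2 = a at *
    generalize (m + 1 + d).choose (m + 1) = B at *
    generalize (m + 1 + (d + 1)).choose (m + 1) = B' at *
    generalize (m + (d + 1)).choose m = B'' at *
    split_ifs
    · linarith
    · linarith

def HP (k : Type) [Field k] (n π d : ℕ) : Prop :=
  ∀ (P J : Type) [Fintype P] [Fintype J], Fintype.card P = π →
    ∃ (x : P → Fin 3 → Fin (n+1) → k) (y : J → (Fin (n+1) → k) × (Fin (n+1) → k)),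
      min ((n+d).choose n) (π * (d+2).choose 2 + (d+1) * Fintype.card J) ≤
        finrank k ↥((⨆ i, Flat d (x i)) ⊔ ⨆ i, Line d (y i).1 (y i).2)

theorem HP_of_Ind [CharZero k] {n π d S c : ℕ} (hS : 2 * c ≤ S) (h : IndS k n π d S c) : HP k n π d := by
  intro P J _ _ hP
  obtain ⟨h1, h2⟩ := h P hP
  by_cases hJ : S ≤ Fintype.card J
  · obtain ⟨x, hx⟩ := h1 (Fin c) (Fin (S - 2 * c)) (by simp) (by simp; omega)
    have e : J ≃ (Fin c ⊕ Fin c) ⊕ Fin (S - 2 * c) ⊕ Fin (Fintype.card J - S) :=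
      Fintype.equivOfCardEq (by
        simp only [Fintype.card_sum, Fintype.card_fin]
        omega)
    let y : J → (Fin (n+1) → k) × (Fin (n+1) → k) := fun j =>
      Sum.elim (Sum.elim (fun i => (em (x.2.1 i).1, (x.2.1 i).2.1)) (fun i => (em (x.2.1 i).1, (x.2.1 i).2.2)))
        (Sum.elim (fun i => (em (x.2.2 i).1, (x.2.2 i).2)) (fun _ => 0)) (e j)
    refine ⟨fun i => ![em (x.1 i).1, em (x.1 i).2.1, (x.1 i).2.2], y, ?_⟩
    refine le_trans (min_le_left _ _) (hx.trans (Submodule.finrank_mono ?_))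
    have hle : ∀ j, Line d (y j).1 (y j).2 ≤ (⨆ i, Flat d ![em (x.1 i).1, em (x.1 i).2.1, (x.1 i).2.2]) ⊔
      ⨆ i, Line d (y i).1 (y i).2 := fun j => le_sup_of_le_right (le_iSup (fun j => Line d (y j).1 (y j).2) j)
    refine sup_le (sup_le le_sup_left (iSup_le fun i => sup_le ?_ ?_)) (iSup_le fun i => ?_)
    · simpa [y] using hle (e.symm (.inl (.inl i)))
    · simpa [y] using hle (e.symm (.inl (.inr i)))
    · simpa [y] using hle (e.symm (.inr (.inl i)))
  · obtain ⟨x, hx⟩ := h2 (J ⊕ Fin (S - 1 - Fintype.card J)) (by simp; omega)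
    refine ⟨fun i => ![em (x.1 i).1, em (x.1 i).2.1, (x.1 i).2.2],
      fun i => (em (x.2.2 (.inl i)).1, (x.2.2 (.inl i)).2), ?_⟩
    refine le_trans (min_le_right _ _) ?_
    have hle : UU d x ≤ ((⨆ i, Flat d ![em (x.1 i).1, em (x.1 i).2.1, (x.1 i).2.2]) ⊔
      ⨆ i, Line d (em (x.2.2 (.inl i)).1) (x.2.2 (.inl i)).2) ⊔
      ⨆ i, Line d (em (x.2.2 (.inr i)).1) (x.2.2 (.inr i)).2 := by
      refine sup_le (sup_le ?_ (iSup_le fun i => i.elim)) (iSup_le fun i => ?_)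
      · exact le_sup_of_le_left le_sup_left
      · rcases i with i | i
        · exact le_sup_of_le_left (le_sup_of_le_right
            (le_iSup (fun i => Line d (em (x.2.2 (.inl i)).1) (x.2.2 (.inl i)).2) i))
        · exact le_sup_of_le_right
            (le_iSup (fun i => Line d (em (x.2.2 (.inr i)).1) (x.2.2 (.inr i)).2) i)
    have q1 := Submodule.finrank_mono hle
    have q2 := Submodule.finrank_add_le_finrank_add_finrank
      ((⨆ i, Flat d ![em (x.1 i).1, em (x.1 i).2.1, (x.1 i).2.2]) ⊔
      ⨆ i, Line d (em (x.2.2 (.inl i)).1) (x.2.2 (.inl i)).2)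
      (⨆ i, Line d (em (x.2.2 (.inr i)).1) (x.2.2 (.inr i)).2)
    have q3 := finrank_iSup_le (fun i => Line d (em (x.2.2 (.inr i)).1) (x.2.2 (.inr i)).2) (d+1)
      (fun i => Line_rank_le _ _)
    simp only [Fintype.card_sum, Fintype.card_fin] at hx q3
    rw [Nat.mul_add] at hx
    change _ ≤ finrank k ↥((⨆ i, Flat d ![em (x.1 i).1, em (x.1 i).2.1, (x.1 i).2.2]) ⊔
      ⨆ i, Line d (em (x.2.2 (.inl i)).1) (x.2.2 (.inl i)).2)
    omega

theorem HL_of_HP {n d : ℕ} (h : HP k n 0 d) : HL k (n+1) d := by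
  intro J _
  obtain ⟨x, y, hxy⟩ := h Empty J (by simp)
  refine ⟨y, ?_⟩
  rw [finrank_Fm]
  have e : ((⨆ i, Flat d (x i)) ⊔ ⨆ i, Line d (y i).1 (y i).2) ≤ ⨆ i, Line d (y i).1 (y i).2 :=
    sup_le (iSup_le fun i => i.elim) le_rfl
  simpa using hxy.trans (Submodule.finrank_mono e)

theorem ind_one [CharZero k] {m π S c : ℕ} (hN : m + 2 + c = 3 * π + 2 * S) (hc : c ≤ 1) (hS : 2 * c ≤ S)
    (hm : 2 * π + S ≤ m + 1 + c) :
    IndS k (m+1) π 1 S c := by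
  intro P _ hP
  have f1 : finrank k (Fm k (m+1) 1) = m + 1 := by rw [finrank_Fm]; simp
  have f2 : finrank k (Fm k (m+1+1) 1) = m + 2 := by rw [finrank_Fm]; simp
  refine ⟨?_, ?_⟩
  · intro T J _ _ hT hJ
    obtain ⟨x, hx⟩ := base_one (k := k) (n := m+1) P T J (by rw [f1, hP, hT]; omega)
    refine ⟨x, le_trans ?_ hx⟩
    rw [f2, hP, hT]
    simp only [Nat.choose_succ_self_right]
    omega
  · intro J _ hJ
    obtain ⟨x, hx⟩ := base_one (k := k) (n := m+1) P Empty J (by rw [f1, hP]; simp; omega)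
    refine ⟨x, le_trans ?_ hx⟩
    rw [f2, hP]
    simp
    omega

end Ind2
end BP

namespace BP
open Module

section Num
variable {k : Type} [Field k]

theorem choose_formula4 (d : ℕ) : 24 * (4+d).choose 4 = (d+1)*(d+2)*(d+3)*(d+4) := by
  induction d with
  | zero => decide
  | succ d ih =>
    have e : ∀ j, (j+4).choose 3 * 6 = (j+4)*(j+3)*(j+2) := by
      intro j
      induction j with
      | zero => decide
      | succ j ihj =>
        have e2 : ∀ i, (i+4).choose 2 * 2 = (i+4)*(i+3) := by
          intro i
          have := Nat.choose_two_right (i+4)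
          have h2 : 2 ∣ (i+4)*(i+4-1) := Nat.two_dvd_mul_sub_one _
          rw [this, Nat.div_mul_cancel h2]
          simp
        have := Nat.choose_succ_succ (j+4) 2
        have h3 := e2 j
        rw [show j + 1 + 4 = (j+4)+1 by omega]
        simp at this
        rw [this]
        nlinarith
    have := Nat.choose_succ_succ (4+d) 3
    rw [show 4 + (d+1) = (4+d)+1 by omega]
    simp at this
    rw [this]
    have h3 := e d
    rw [show 4 + d = d + 4 by omega] at *
    nlinarith

theorem tri_formula (d : ℕ) : 2 * (d+2).choose 2 = (d+1)*(d+2) := by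
  have := Nat.choose_two_right (d+2)
  have h2 : 2 ∣ (d+2)*(d+2-1) := Nat.two_dvd_mul_sub_one _
  rw [this, Nat.mul_div_cancel' h2]
  simp; ring

theorem choose_mono_n {n n' : ℕ} (d : ℕ) (h : n' ≤ n) : (n'+d).choose n' ≤ (n+d).choose n := by
  rw [Nat.choose_symm_add, Nat.choose_symm_add]
  exact Nat.choose_le_choose d (by omega)

theorem delta_eq {n d π S' c' S c : ℕ} 
    (hN' : (n+d).choose n + c' = π * (d+2).choose 2 + (d+1) * S')
    (hN : (n+(d+1)).choose n + c = π * (d+1+2).choose 2 + (d+2) * S) :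
    ((d+1)*(d+2)*(S:ℤ)) - (d+1)*(d+2)*S' = ((n:ℤ)-1)*(n+d).choose n - π * (d+2).choose 2 + (d+1)*c - (d+2)*c' := by
  have h1 := Nat.add_one_mul_choose_eq (n+d) d
  rw [← Nat.choose_symm_add (a := n) (b := d),
    show n + d + 1 = n + (d+1) by omega, ← Nat.choose_symm_add (a := n) (b := d+1)] at h1
  rw [tri_succ] at hN
  have h2 := tri_formula d
  zify at *
  generalize ((n+d).choose n : ℤ) = B at *
  generalize ((n+(d+1)).choose n : ℤ) = B' at *
  generalize ((d+2).choose 2 : ℤ) = t at *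
  linear_combination ((d:ℤ)+2) * hN' - ((d:ℤ)+1)*hN - h1 + π * h2

def Concl (n d π S' c' S c : ℕ) : Prop :=
  c + 2 * c' ≤ S' ∧ S' + c ≤ S ∧ S' + 1 ≤ S ∧ (c' = 0 ∨ ((2*c'+c+d ≤ S'+1 ∨ (n=4 ∧ d=3 ∧ π=1)) ∧
    n ≤ 2*(S-S'+π) ∧ (c = 0 ∨ n ≤ 2*(S-S'-1+π))))

theorem concl_of {n d π S' c' S c : ℕ} (hd : 1 ≤ d) (hc' : c' ≤ d) (hc : c ≤ d + 1) (h1 : 4*d ≤ S') (h2 : S'+d+1 ≤ S)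
    (h3 : n + 2 + 2 * S' ≤ 2*S) : Concl n d π S' c' S c := by
  refine ⟨by omega, by omega, by omega, Or.inr ⟨Or.inl (by omega), by omega, Or.inr (by omega)⟩⟩

theorem concl_all {n d π S' c' S c : ℕ} (hn : 4 ≤ n) (hd : 1 ≤ d) (hπ : π ≤ 1) (hc' : c' ≤ d) (hc : c ≤ d + 1)
    (hN' : (n+d).choose n + c' = π * (d+2).choose 2 + (d+1) * S')
    (hN : (n+(d+1)).choose n + c = π * (d+1+2).choose 2 + (d+2) * S) : Concl n d π S' c' S c := by
  have hdel := delta_eq hN' hN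
  have small : ∀ n d : ℕ, n + d ≤ 9 → 4 ≤ n → 1 ≤ d → c' ≤ d → c ≤ d+1 → (d = 1 ∧ n ≤ 8 ∨ d = 2 ∧ n ≤ 5 ∨ n = 4) →
     (n+d).choose n + c' = π * (d+2).choose 2 + (d+1) * S' → 
     (n+(d+1)).choose n + c = π * (d+1+2).choose 2 + (d+2) * S → Concl n d π S' c' S c := by
    clear hdel hN hN' hc hc' hn hd n d
    intro n d hnd hn hd hc' hc hcases hN' hN
    unfold Concl
    have : n ≤ 8 := by omega
    have : d ≤ 5 := by omega
    have n1 : Nat.choose 5 4 = 5 := by decide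
    interval_cases n <;> interval_cases d <;> first | omega | (interval_cases π <;> simp [Nat.choose] at hN hN' <;> omega)
  by_cases hs : n + d ≤ 9 ∧ (d = 1 ∧ n ≤ 8 ∨ d = 2 ∧ n ≤ 5 ∨ n = 4)
  · exact small n d hs.1 hn hd hc' hc hs.2 hN' hN
  clear small
  have ht := tri_formula d
  have hc'' : (c':ℤ) ≤ d := by exact_mod_cast hc'
  have hπt : π * (d+2).choose 2 ≤ (d+2).choose 2 := by nlinarith
  have hcnn : (0:ℤ) ≤ (d+1)*c := by positivity
  -- key facts in integers
  have key : ∀ b : ℕ, b ≤ (n+d).choose n → 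
      ((d+1)*(d+2)*(S:ℤ)) - (d+1)*(d+2)*S' ≥ ((n:ℤ)-1)*b - (d+2).choose 2 - (d+2)*d := by
    intro b hb
    have hb' : (b:ℤ) ≤ (n+d).choose n := by exact_mod_cast hb
    have hn' : (4:ℤ) ≤ n := by exact_mod_cast hn
    have hπt' : (π:ℤ) * (d+2).choose 2 ≤ (d+2).choose 2 := by exact_mod_cast hπt
    rw [hdel]
    nlinarith
  by_cases hd6 : 6 ≤ d
  · have hb := choose_mono_n d hn
    have h4 := choose_formula4 d
    have k1 := key _ hb
    have hS : (4 + d).choose 4 ≤ (d+2).choose 2 + (d+1)*S' := by omega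
    generalize (4+d).choose 4 = B at *
    generalize (d+2).choose 2 = t at *
    obtain ⟨e, rfl⟩ : ∃ e, d = e + 6 := ⟨d - 6, by omega⟩
    obtain ⟨p, rfl⟩ : ∃ p, n = p + 4 := ⟨n - 4, by omega⟩
    clear hN hN' hdel hb
    push_cast at *
    refine concl_of (by omega) hc' hc ?_ ?_ ?_
    · have : (e+7) * (24 * S') ≥ (e+7) * ((e+8)*(e+6)*(e+13)) := by nlinarith
      have := Nat.le_of_mul_le_mul_left this (by omega)
      nlinarith
    · have h4' : (24:ℤ) * B = (e+7)*(e+8)*(e+9)*(e+10) := by have := h4; zify at this; linarith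
      have ht' : (2:ℤ) * t = (e+7)*(e+8) := by have := ht; zify at this; linarith
      by_contra hcon
      push Not at hcon
      have : (S:ℤ) ≤ S' + e + 6 := by zify at hcon; linarith
      have hB : (0:ℤ) ≤ B := by positivity
      have hp : (0:ℤ) ≤ p := by positivity
      have he : (0:ℤ) ≤ e := by positivity
      have m1 := mul_le_mul_of_nonneg_left this (show (0:ℤ) ≤ (e+7)*(e+8) by positivity)
      have m2 := mul_nonneg hp hB
      nlinarith [pow_nonneg he 3, pow_nonneg he 4, pow_nonneg he 2]
    · have h4' : (24:ℤ) * B = (e+7)*(e+8)*(e+9)*(e+10) := by have := h4; zify at this; linarith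
      have ht' : (2:ℤ) * t = (e+7)*(e+8) := by have := ht; zify at this; linarith
      have he : (0:ℤ) ≤ e := by positivity
      have hp : (0:ℤ) ≤ p := by positivity
      have hB : (B:ℤ) ≥ 3 * ((e+7)*(e+8)) := by nlinarith [pow_nonneg he 3, pow_nonneg he 4, pow_nonneg he 2]
      zify
      have m2 := mul_le_mul_of_nonneg_left hB (show (0:ℤ) ≤ p + 3 by positivity)
      have : ((e+7)*(e+8):ℤ) * (S - S') ≥ ((e+7)*(e+8):ℤ) * (3*(p+3) - 2) := by nlinarith
      have := le_of_mul_le_mul_left this (by positivity)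
      linarith
  · have hd5 : d ≤ 5 := by omega
    by_cases hd1 : d = 1
    · subst hd1
      have hn9 : 9 ≤ n := by omega
      have k1 := key (n+1) (by simp)
      simp at hN'
      rw [show Nat.choose 3 2 = 3 by decide] at *
      refine concl_of (by omega) hc' hc (by omega) ?_ ?_
      all_goals
        push_cast at k1
        have m1 : ((n:ℤ)-1)*(n+1) ≥ 8 * (n+1) := by
          apply mul_le_mul_of_nonneg_right <;> omega
        omega
    · by_cases hd2 : d = 2
      · subst hd2
        have hb := choose_mono_n 2 (show 6 ≤ n by omega)
        have k1 := key _ hb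
        have hS : (6 + 2).choose 6 ≤ (2+2).choose 2 + (2+1)*S' := by omega
        simp [Nat.choose] at k1 hS
        refine concl_of (by omega) hc' hc ?_ ?_ ?_ <;> omega
      · have hn5 : 5 ≤ n := by omega
        have hb := choose_mono_n d hn5
        have k1 := key _ hb
        have hS : (5 + d).choose 5 ≤ (d+2).choose 2 + (d+1)*S' := by omega
        have : 3 ≤ d := by omega
        clear key hb hN hN' hdel
        interval_cases d <;> simp [Nat.choose] at k1 hS <;> 
        (refine concl_of (by omega) hc' hc ?_ ?_ ?_ <;> omega)

theorem ind_all [CharZero k] {m π : ℕ} (hm : 3 ≤ m) (hπ : π ≤ 1) (hHL : ∀ d, 1 ≤ d → HL k (m+1) d)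
    (hex : TR k 4 4 5 3 1) : ∀ d, 1 ≤ d → ∀ S c : ℕ, ((m+1)+d).choose (m+1) + c = π * (d+2).choose 2 + (d+1) * S →
      c ≤ d → IndS k (m+1) π d S c := by
  intro d hd
  induction d, hd using Nat.le_induction with
  | base =>
    intro S c h hc
    simp at h
    exact ind_one (by omega) hc (by omega) (by omega)
  | succ d hd ih =>
    intro S c hN hc
    obtain ⟨S', c', hN', hc'⟩ : ∃ S' c' : ℕ, ((m+1)+d).choose (m+1) + c' = π * (d+2).choose 2 + (d+1) * S' ∧ c' ≤ d := by
      have hle : π * (d+2).choose 2 ≤ ((m+1)+d).choose (m+1) := by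
        have h1 := choose_mono_n d (show 2 ≤ m+1 by omega)
        rw [show 2 + d = d + 2 by omega] at h1
        nlinarith
      obtain ⟨N, hN⟩ := Nat.exists_eq_add_of_le hle
      have h1 := Nat.div_add_mod (N + d) (d+1)
      have h2 := Nat.mod_lt (N + d) (show d+1 > 0 by omega)
      refine ⟨(N + d)/(d+1), d - (N+d) % (d+1), ?_, by omega⟩
      omega
    have hdel := delta_eq hN' hN
    obtain ⟨q1, q2, q3, q4⟩ := concl_all (by omega) hd hπ hc' hc hN' hN
    have f1 : finrank k (Fm k (m+1) 1) = m + 1 := by rw [finrank_Fm]; simp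
    have f2 : finrank k (Fm k (m+1) (d+1)) = (m+(d+1)).choose m := finrank_Fm m (d+1)
    have hpas := choose_pascal m d
    have htri := tri_succ d
    have sub : (d+2)*(S-S'+π) + 3*c' + (S'-2*c'-c) = (m+(d+1)).choose m := by
      obtain ⟨s1, rfl⟩ : ∃ s1, S = S' + s1 := ⟨S - S', by omega⟩
      obtain ⟨l, rfl⟩ : ∃ l, S' = c + 2 * c' + l := ⟨S' - (c + 2 * c'), by omega⟩
      have e1 : c + 2 * c' + l + s1 - (c + 2 * c' + l) = s1 := by omega
      have e2 : c + 2 * c' + l - 2 * c' - c = l := by omega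
      rw [e1, e2]
      rw [htri] at hN
      clear e1 e2 hdel
      generalize (d+2).choose 2 = a at *
      generalize (m + 1 + d).choose (m + 1) = B at *
      generalize (m + 1 + (d + 1)).choose (m + 1) = B' at *
      generalize (m + (d + 1)).choose m = B'' at *
      linarith
    have tr : ∀ a z, (c' = 0 ∨ (m+1 ≤ 2 * a ∧ (d+2)*a + 3*c'+(d+2) ≤ (m+(d+1)).choose m + 3)) → TR k (m+1) (d+1) a c' z := by
      intro a z h A D Z _ _ _ hA hD hZ
      have := trace_exists (k := k) (N := m+1) (d := d+1) (by omega) (hHL 1 le_rfl) (hHL (d+1) (by omega)) A D Z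
        (by rw [hA, hD, f1, f2]; exact h)
      rw [hA, hD, hZ] at this
      exact this
    refine ind_step hN' hN hc q1 q2 q3 ?_ ?_ (ih S' c' hN' hc')
    · rcases q4 with h0 | ⟨h | ⟨h4, h3, h1⟩, h5, h6⟩
      · exact tr _ _ (Or.inl h0)
      · exact tr _ _ (Or.inr ⟨h5, by omega⟩)
      · obtain rfl : m = 3 := by omega
        subst h3 h1
        simp [Nat.choose] at hN' hN
        obtain rfl : S' = 7 := by omega
        obtain rfl : c' = 3 := by omega
        obtain rfl : S = 11 := by omega
        obtain rfl : c = 0 := by omega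
        exact hex
    · rcases q4 with h0 | ⟨-, -, h | h⟩
      · exact Or.inr (tr _ _ (Or.inl h0))
      · exact Or.inl h
      · refine Or.inr (tr _ _ (Or.inr ⟨h, ?_⟩))
        have : (d+2)*(S-S'+π) = (d+2)*(S-S'-1+π) + (d+2) := by
          rw [show S - S' + π = (S-S'-1+π) + 1 by omega, Nat.mul_add]; simp
        omega

theorem HP_all [CharZero k] {m π : ℕ} (hm : 3 ≤ m) (hπ : π ≤ 1) (hHL : ∀ d, 1 ≤ d → HL k (m+1) d)
    (hex : TR k 4 4 5 3 1) (d : ℕ) (hd : 1 ≤ d) : HP k (m+1) π d := by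
  have ex : ∀ d, 1 ≤ d → ∃ S c : ℕ, ((m+1)+d).choose (m+1) + c = π * (d+2).choose 2 + (d+1) * S ∧ c ≤ d := by
    intro d hd
    have hle : π * (d+2).choose 2 ≤ ((m+1)+d).choose (m+1) := by
      have h1 := choose_mono_n d (show 2 ≤ m+1 by omega)
      rw [show 2 + d = d + 2 by omega] at h1
      nlinarith
    obtain ⟨N, hN⟩ := Nat.exists_eq_add_of_le hle
    have h1 := Nat.div_add_mod (N + d) (d+1)
    have h2 := Nat.mod_lt (N + d) (show d+1 > 0 by omega)
    refine ⟨(N + d)/(d+1), d - (N+d) % (d+1), ?_, by omega⟩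
    omega
  obtain ⟨S', c', hN', hc'⟩ := ex d hd
  obtain ⟨S, c, hN, hc⟩ := ex (d+1) (by omega)
  have := concl_all (by omega) hd hπ hc' hc hN' hN
  exact HP_of_Ind (by have := this.1; omega) (ind_all hm hπ hHL hex d hd S' c' hN' hc')

theorem HL_all [CharZero k] (h4 : ∀ d, 1 ≤ d → HL k 4 d) (hex : TR k 4 4 5 3 1) (m : ℕ) (hm : 3 ≤ m) :
    ∀ d, 1 ≤ d → HL k (m+1) d := by
  induction m, hm using Nat.le_induction with
  | base => exact h4
  | succ m hm ih => exact fun d hd => HL_of_HP (HP_all hm (by omega) ih hex d hd)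

theorem HP_final [CharZero k] (h4 : ∀ d, 1 ≤ d → HL k 4 d) (hex : TR k 4 4 5 3 1) (n : ℕ) (hn : 4 ≤ n) (d : ℕ) (hd : 1 ≤ d) :
    HP k n 1 d := by
  obtain ⟨m, rfl⟩ : ∃ m, n = m+1 := ⟨n-1, by omega⟩
  exact HP_all (by omega) le_rfl (HL_all h4 hex m (by omega)) hex d hd

end Num
end BP

namespace BP
open Module

section Quad
variable {k : Type} [Field k]

theorem add_generic_span {M : Type} [AddCommGroup M] [Module k M] [FiniteDimensional k M] {Z : Type}
    (G : Z → Dual k M) (z0 : Z) (U : Submodule k (Dual k M)) (j : ℕ) :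
    ∃ z : Fin j → Z, min (finrank k ↥(Submodule.span k (Set.range G))) (finrank k U + j) ≤
      finrank k ↥(U ⊔ Submodule.span k (Set.range (G ∘ z))) := by
  induction j with
  | zero =>
    refine ⟨Fin.elim0, ?_⟩
    refine le_trans (min_le_right _ _) ?_
    exact Submodule.finrank_mono le_sup_left
  | succ j ih =>
    obtain ⟨z, hz⟩ := ih
    set U' := U ⊔ Submodule.span k (Set.range (G ∘ z))
    have key : ∃ w, min (finrank k ↥(Submodule.span k (Set.range G))) (finrank k U' + 1) ≤
        finrank k ↥(U' ⊔ Submodule.span k {G w}) := by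
      by_cases hU : ∃ w, G w ∉ U'
      · obtain ⟨w, hw⟩ := hU
        refine ⟨w, (min_le_right _ _).trans ?_⟩
        have : U' < U' ⊔ Submodule.span k {G w} := by
          refine lt_of_le_of_ne le_sup_left fun h => hw ?_
          rw [h]
          exact Submodule.mem_sup_right (Submodule.mem_span_singleton_self _)
        exact Submodule.finrank_lt_finrank_of_lt this
      · push Not at hU
        have : Submodule.span k (Set.range G) ≤ U' := by
          rw [Submodule.span_le]
          rintro _ ⟨w, rfl⟩
          exact hU w
        refine ⟨z0, (min_le_left _ _).trans ?_⟩
        exact Submodule.finrank_mono (this.trans le_sup_left)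
    obtain ⟨w, hw⟩ := key
    refine ⟨Fin.snoc z w, ?_⟩
    have hle : U' ⊔ Submodule.span k {G w} ≤
        U ⊔ Submodule.span k (Set.range (G ∘ (Fin.snoc z w : Fin (j+1) → Z))) := by
      refine sup_le (sup_le le_sup_left ?_) ?_
      · refine le_trans (Submodule.span_mono ?_) le_sup_right
        rintro _ ⟨i, rfl⟩
        exact ⟨i.castSucc, by simp⟩
      · refine le_trans (Submodule.span_mono ?_) le_sup_right
        rintro _ rfl
        exact ⟨Fin.last j, by simp⟩
    have := Submodule.finrank_mono hle
    omega

theorem add_generic_span' {M : Type} [AddCommGroup M] [Module k M] [FiniteDimensional k M] {Z : Type}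
    (G : Z → Dual k M) (z0 : Z) (U : Submodule k (Dual k M)) (J : Type) [Fintype J] :
    ∃ z : J → Z, min (finrank k ↥(Submodule.span k (Set.range G))) (finrank k U + Fintype.card J) ≤
      finrank k ↥(U ⊔ ⨆ j, Submodule.span k {G (z j)}) := by
  obtain ⟨z, hz⟩ := add_generic_span G z0 U (Fintype.card J)
  refine ⟨z ∘ Fintype.equivFin J, hz.trans (Submodule.finrank_mono (sup_le_sup_left ?_ _))⟩
  rw [Submodule.span_le]
  rintro _ ⟨i, rfl⟩
  refine Submodule.mem_iSup_of_mem ((Fintype.equivFin J).symm i) ?_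
  simp [Submodule.mem_span_singleton_self]

theorem rank_ge_of_order {M : Type} [AddCommGroup M] [Module k M] [FiniteDimensional k M]
    (U : Submodule k (Dual k M)) {ι : Type} [Fintype ι] (ρ : ι → ℕ) (ψ : ι → Dual k M) (hψ : ∀ i, ψ i ∈ U)
    (f : ι → M) (hd : ∀ i, ψ i (f i) ≠ 0) (ht : ∀ i j, i ≠ j → ρ i ≤ ρ j → ψ i (f j) = 0) :
    Fintype.card ι ≤ finrank k U := by
  let e := Fintype.equivFin ι
  let σ := Tuple.sort (fun i => ρ (e.symm i))
  have hm : Monotone ((fun i => ρ (e.symm i)) ∘ σ) := Tuple.monotone_sort _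
  refine rank_ge_of_triangular U (fun i => ψ (e.symm (σ i))) (fun i => hψ _) (fun i => f (e.symm (σ i)))
    (fun i => hd _) (fun i j hij => ht _ _ (fun h => ?_) (hm hij.le))
  exact hij.ne (σ.injective (e.symm.injective h))

/-- affine parametrization of the quadric -/
def ph (z : k × k) : Fin 4 → k := ![1, z.1, z.2, z.1 * z.2]
def wx (z : k × k) : Fin 4 → k := ![0, 1, 0, z.2]
def wy (z : k × k) : Fin 4 → k := ![0, 0, 1, z.1]

noncomputable def qq (k : Type) [Field k] : Fm k 4 2 :=
  ⟨X 0 * X 3 - X 1 * X 2, by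
    rw [mem_homogeneousSubmodule]
    exact ((isHomogeneous_X k 0).mul (isHomogeneous_X k 3)).sub ((isHomogeneous_X k 1).mul (isHomogeneous_X k 2))⟩

theorem ev_qq (v : Fin 4 → k) : ev 2 v (qq k) = v 0 * v 3 - v 1 * v 2 := by
  rw [ev_apply]; simp [qq]

theorem dv_qq (p v : Fin 4 → k) : dv 2 p v (qq k) = v 0 * p 3 + p 0 * v 3 - v 1 * p 2 - p 1 * v 2 := by
  rw [dv_apply, Fin.sum_univ_four]
  simp [qq, pderiv_X, Pi.single_apply]
  ring

theorem ph_add_y (z : k × k) (t : k) : ph z + t • wy z = ph (z.1, z.2 + t) := by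
  ext i; fin_cases i <;> simp [ph, wy]; ring
theorem ph_add_x (z : k × k) (t : k) : ph z + t • wx z = ph (z.1 + t, z.2) := by
  ext i; fin_cases i <;> simp [ph, wx]; ring

/-- ruling line -/
noncomputable abbrev Rul (d : ℕ) (l : k) : Submodule k (Dual k (Fm k 4 d)) := Line d (ph (l, 0)) (ph (l, 1))

noncomputable abbrev DD (d : ℕ) (z : k × k) : Submodule k (Dual k (Fm k 4 d)) := PD d (ph z) (wx z) (wy z)

theorem exists_lift (d : ℕ) (A B : Polynomial k) (hA : A.natDegree ≤ d) (hB : B.natDegree ≤ d) :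
    ∃ f : Fm k 4 d, ∀ z, ev d (ph z) f = A.eval z.1 * B.eval z.2 := by
  have mon : ∀ i j : ℕ, i ≤ d → j ≤ d → ∃ f : Fm k 4 d, ∀ z : k × k, ev d (ph z) f = z.1 ^ i * z.2 ^ j := by
    intro i j hi hj
    let c := min i j
    have hm : (X 0 ^ (d - max i j) * X 1 ^ (i - c) * X 2 ^ (j - c) * X 3 ^ c : MvPolynomial (Fin 4) k) ∈
        homogeneousSubmodule (Fin 4) k d := by
      rw [mem_homogeneousSubmodule]
      have := ((((isHomogeneous_X k (0 : Fin 4)).pow (d - max i j)).mul ((isHomogeneous_X k (1 : Fin 4)).pow (i - c))).mul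
        ((isHomogeneous_X k (2 : Fin 4)).pow (j - c))).mul ((isHomogeneous_X k (3 : Fin 4)).pow c)
      convert this using 1
      omega
    refine ⟨⟨_, hm⟩, fun z => ?_⟩
    rw [ev_apply]
    simp [ph]
    rw [mul_pow]
    have h1 : i = (i - c) + c := by omega
    have h2 : j = (j - c) + c := by omega
    conv_rhs => rw [h1, h2, pow_add, pow_add]
    ring
  choose! m hm using mon
  refine ⟨∑ i ∈ Finset.range (d+1), ∑ j ∈ Finset.range (d+1), (A.coeff i * B.coeff j) • m i j, fun z => ?_⟩
  rw [Polynomial.eval_eq_sum_range' (n := d+1) (by omega), Polynomial.eval_eq_sum_range' (n := d+1) (by omega),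
    Finset.sum_mul_sum, map_sum]
  refine Finset.sum_congr rfl fun i hi => ?_
  rw [map_sum]
  refine Finset.sum_congr rfl fun j hj => ?_
  rw [map_smul, hm i j (by simpa [Nat.lt_succ_iff] using hi) (by simpa [Nat.lt_succ_iff] using hj), smul_eq_mul]
  ring

theorem dv_of_poly [Infinite k] {N d : ℕ} (p v : Fin N → k) (f : Fm k N d) (g : Polynomial k)
    (h : ∀ t, ev d (p + t • v) f = g.eval t) : dv d p v f = g.derivative.eval 0 := by
  have e : jet p v f.1 = g := Polynomial.funext fun t => by rw [jet_eval, ← h, ev_apply]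
  rw [← e, jet_deriv_eval]
  simp

theorem lift_dx [Infinite k] {d : ℕ} {A B : Polynomial k} {f : Fm k 4 d}
    (h : ∀ z, ev d (ph z) f = A.eval z.1 * B.eval z.2) (z : k × k) :
    dv d (ph z) (wx z) f = A.derivative.eval z.1 * B.eval z.2 := by
  rw [dv_of_poly (g := A.comp (Polynomial.X + Polynomial.C z.1) * Polynomial.C (B.eval z.2))]
  · simp [Polynomial.derivative_comp]
  · intro t; rw [ph_add_x, h]; simp [add_comm]

theorem lift_dy [Infinite k] {d : ℕ} {A B : Polynomial k} {f : Fm k 4 d}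
    (h : ∀ z, ev d (ph z) f = A.eval z.1 * B.eval z.2) (z : k × k) :
    dv d (ph z) (wy z) f = A.eval z.1 * B.derivative.eval z.2 := by
  rw [dv_of_poly (g := Polynomial.C (A.eval z.1) * B.comp (Polynomial.X + Polynomial.C z.2))]
  · simp [Polynomial.derivative_comp]
  · intro t; rw [ph_add_y, h]; simp [add_comm]

theorem tri_rank [Infinite k] {d : ℕ} {R D : Type} [Fintype R] [Fintype D] (l : R → k) (hl : Function.Injective l)
    (p : D → k × k) (hR : Fintype.card R ≤ d + 1) (hp : ∀ δ i, (p δ).1 ≠ l i)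
    (A B : D → Polynomial k) (hA : ∀ δ, (A δ).natDegree + 1 + Fintype.card R ≤ d) (hB : ∀ δ, (B δ).natDegree + 1 ≤ d)
    (hA0 : ∀ δ, (A δ).eval (p δ).1 ≠ 0) (hB0 : ∀ δ, (B δ).eval (p δ).2 ≠ 0)
    (hAB : ∀ δ δ', δ ≠ δ' → ((A δ).eval (p δ').1 = 0 ∧ (B δ).eval (p δ').2 = 0) ∨
      ((B δ).eval (p δ').2 = 0 ∧ (B δ).derivative.eval (p δ').2 = 0))
    (U : Submodule k (Dual k (Fm k 4 d))) (h1 : ∀ i y, ev d (ph (l i, y)) ∈ U) (h2 : ∀ δ, DD d (p δ) ≤ U) :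
    (d+1) * Fintype.card R + 3 * Fintype.card D ≤ finrank k U := by
  classical
  open Polynomial in
  have hy : ∃ y : Fin (d+1) → k, Function.Injective y := 
    ⟨_, (Infinite.natEmbedding k).injective.comp Fin.val_injective⟩
  obtain ⟨y, hy⟩ := hy
  let om : Polynomial k := ∏ i, (Polynomial.X - Polynomial.C (l i))
  have om_deg : om.natDegree = Fintype.card R := by
    rw [Polynomial.natDegree_prod_of_monic _ _ (fun i _ => Polynomial.monic_X_sub_C _)]; simp
  have om0 : ∀ i, om.eval (l i) = 0 := fun i => by
    simp only [om, Polynomial.eval_prod]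
    exact Finset.prod_eq_zero (Finset.mem_univ i) (by simp)
  have omne : ∀ δ, om.eval (p δ).1 ≠ 0 := fun δ => by
    simp only [om, Polynomial.eval_prod]
    exact Finset.prod_ne_zero_iff.2 fun i _ => by simpa [sub_eq_zero] using hp δ i
  have lag : ∀ i a, ∃ f : Fm k 4 d, ∀ z, ev d (ph z) f =
      (∏ j ∈ Finset.univ.erase i, (Polynomial.X - Polynomial.C (l j))).eval z.1 *
      (∏ j ∈ Finset.univ.erase a, (Polynomial.X - Polynomial.C (y j))).eval z.2 := by
    intro i a
    apply exists_lift
    · rw [Polynomial.natDegree_prod_of_monic _ _ (fun i _ => Polynomial.monic_X_sub_C _)]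
      simp [Finset.card_erase_of_mem]
      omega
    · rw [Polynomial.natDegree_prod_of_monic _ _ (fun i _ => Polynomial.monic_X_sub_C _)]
      simp [Finset.card_erase_of_mem]
  choose F hF using lag
  have dou : ∀ (δ : D) (a : Fin 3), ∃ f : Fm k 4 d, ∀ z, ev d (ph z) f =
      (om * A δ * (if a = 1 then Polynomial.X - Polynomial.C (p δ).1 else 1)).eval z.1 *
      (B δ * (if a = 2 then Polynomial.X - Polynomial.C (p δ).2 else 1)).eval z.2 := by
    intro δ a
    apply exists_lift
    · refine Polynomial.natDegree_mul_le.trans ?_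
      refine (Nat.add_le_add_right Polynomial.natDegree_mul_le _).trans ?_
      have := hA δ
      have : (if a = 1 then Polynomial.X - Polynomial.C (p δ).1 else 1 : Polynomial k).natDegree ≤ 1 := by
        split_ifs <;> simp
      omega
    · refine Polynomial.natDegree_mul_le.trans ?_
      have := hB δ
      have : (if a = 2 then Polynomial.X - Polynomial.C (p δ).2 else 1 : Polynomial k).natDegree ≤ 1 := by
        split_ifs <;> simp
      omega
  choose H hH using dou
  have hcard : Fintype.card ((R × Fin (d+1)) ⊕ (D × Fin 3)) = (d+1) * Fintype.card R + 3 * Fintype.card D := by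
    simp [mul_comm]
  rw [← hcard]
  let ψ : (R × Fin (d+1)) ⊕ (D × Fin 3) → Dual k (Fm k 4 d) :=
    Sum.elim (fun i => ev d (ph (l i.1, y i.2)))
      (fun i => if i.2 = 0 then ev d (ph (p i.1)) else if i.2 = 1 then dv d (ph (p i.1)) (wx (p i.1)) else
        dv d (ph (p i.1)) (wy (p i.1)))
  refine rank_ge_of_order U (Sum.elim (fun _ => 0) (fun i => 1 + i.2.1)) ψ ?_
    (Sum.elim (fun i => F i.1 i.2) (fun i => H i.1 i.2)) ?_ ?_
  · rintro (⟨i, a⟩ | ⟨δ, a⟩)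
    · exact h1 i _
    · refine h2 δ ?_
      simp only [ψ, Sum.elim_inr, DD, PD]
      split_ifs
      · exact Submodule.mem_sup_left (Submodule.mem_sup_left (Submodule.mem_span_singleton_self _))
      · exact Submodule.mem_sup_left (Submodule.mem_sup_right (Submodule.mem_span_singleton_self _))
      · exact Submodule.mem_sup_right (Submodule.mem_span_singleton_self _)
  · rintro (⟨i, a⟩ | ⟨δ, a⟩)
    · simp only [ψ, Sum.elim_inl, hF, Polynomial.eval_prod]
      refine mul_ne_zero (Finset.prod_ne_zero_iff.2 fun j hj => ?_) (Finset.prod_ne_zero_iff.2 fun j hj => ?_)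
      · have : j ≠ i := by simpa using hj
        simpa [sub_eq_zero] using fun h => this (hl h).symm
      · have : j ≠ a := by simpa using hj
        simpa [sub_eq_zero] using fun h => this (hy h).symm
    · fin_cases a
      · simp [ψ, hH, omne, hA0, hB0]
      · simp [ψ, lift_dx (hH δ 1), omne, hA0, hB0]
      · simp [ψ, lift_dy (hH δ 2), omne, hA0, hB0]
  · rintro (⟨i, a⟩ | ⟨δ, a⟩) (⟨i', a'⟩ | ⟨δ', a'⟩) hne hρ
    · simp only [ψ, Sum.elim_inl, hF, Polynomial.eval_prod]
      by_cases hi : i = i'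
      · subst hi
        have : a ≠ a' := fun h => hne (by rw [h])
        rw [Finset.prod_eq_zero (i := a) (s := Finset.univ.erase a')]
        · simp
        · simpa using this
        · simp
      · rw [Finset.prod_eq_zero (i := i) (s := Finset.univ.erase i')]
        · simp
        · simpa using hi
        · simp
    · fin_cases a' <;> simp [ψ, hH, om0]
    · simp at hρ
    · by_cases hδ : δ = δ'
      · subst hδ
        have : a ≠ a' := fun h => hne (by rw [h])
        fin_cases a <;> fin_cases a' <;> simp at this hρ <;> simp [ψ, hH, lift_dx (hH _ _), lift_dy (hH _ _)]
      · have hd' : δ' ≠ δ := fun h => hδ h.symm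
        rcases hAB δ' δ hd' with ⟨e1, e2⟩ | ⟨e1, e2⟩
        · fin_cases a <;> fin_cases a' <;> simp [ψ, hH, lift_dx (hH _ _), lift_dy (hH _ _), e1, e2]
        · fin_cases a <;> fin_cases a' <;> simp [ψ, hH, lift_dx (hH _ _), lift_dy (hH _ _), e1, e2]

end Quad
end BP

namespace BP
open Module

section Quad2
variable {k : Type} [Field k]

theorem ev_mem_Rul {d : ℕ} (l y : k) : ev d (ph (l, y)) ∈ Rul d l := by
  have h : ph (l, y) = (1 - y) • ph (l, 0) + y • ph (l, 1) := by
    ext i; fin_cases i <;> simp [ph] <;> ring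
  rw [h]
  exact ev_mem_Line _ _ _ _

noncomputable def QTr {R D Z : Type} (d : ℕ) (l : R → k) (p : D → k × k) (z : Z → k × k) :
    Submodule k (Dual k (Fm k 4 d)) :=
  (⨆ i, Rul d (l i)) ⊔ (⨆ δ, DD d (p δ)) ⊔ ⨆ i, Submodule.span k {ev d (ph (z i))}

section reg
variable {E : Type} [AddCommGroup E] [Module k E]

theorem ph_PL {z : E → k × k} (h1 : PL k (fun x => (z x).1)) (h2 : PL k (fun x => (z x).2)) (i : Fin 4) :
    PL k (fun x => ph (z x) i) := by
  fin_cases i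
  · simpa [ph] using PL.const 1
  · simpa [ph] using h1
  · simpa [ph] using h2
  · simpa [ph] using h1.mul h2

theorem wx_PL {z : E → k × k} (h2 : PL k (fun x => (z x).2)) (i : Fin 4) :
    PL k (fun x => wx (z x) i) := by
  fin_cases i
  · simpa [wx] using PL.const 0
  · simpa [wx] using PL.const 1
  · simpa [wx] using PL.const 0
  · simpa [wx] using h2

theorem wy_PL {z : E → k × k} (h1 : PL k (fun x => (z x).1)) (i : Fin 4) :
    PL k (fun x => wy (z x) i) := by
  fin_cases i
  · simpa [wy] using PL.const 0
  · simpa [wy] using PL.const 0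
  · simpa [wy] using PL.const 1
  · simpa [wy] using h1

theorem QTr_reg {R D Z : Type} {d : ℕ} {l : E → R → k} {p : E → D → k × k} {z : E → Z → k × k}
    (hl : ∀ i, PL k (fun x => l x i)) (hp1 : ∀ i, PL k (fun x => (p x i).1)) (hp2 : ∀ i, PL k (fun x => (p x i).2))
    (hz1 : ∀ i, PL k (fun x => (z x i).1)) (hz2 : ∀ i, PL k (fun x => (z x i).2)) :
    Reg (fun x => QTr d (l x) (p x) (z x)) := by
  unfold QTr DD PD
  refine Reg.sup (Reg.sup (Reg.iSup fun i => Line_reg (ph_PL (hl i) (PL.const 0)) (ph_PL (hl i) (PL.const 1)))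
    (Reg.iSup fun i => Reg.sup (Reg.sup (Reg.single (ev_PLs (ph_PL (hp1 i) (hp2 i)))) (Reg.single
      (dv_PLs (ph_PL (hp1 i) (hp2 i)) (wx_PL (hp2 i))))) (Reg.single (dv_PLs (ph_PL (hp1 i) (hp2 i)) (wy_PL (hp1 i))))))
    (Reg.iSup fun i => Reg.single (ev_PLs (ph_PL (hz1 i) (hz2 i))))
end reg

def QTR (k : Type) [Field k] (d r c z : ℕ) : Prop :=
  ∀ (R D Z : Type) [Fintype R] [Fintype D] [Fintype Z], Fintype.card R = r → Fintype.card D = c → Fintype.card Z = z →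
    ∃ (l : R → k) (p : D → k × k) (w : Z → k × k),
      min ((d+1)*(d+1)) ((d+1) * r + 3 * c + z) ≤ finrank k ↥(QTr d l p w)

theorem span_ph_rank [Infinite k] (d : ℕ) :
    (d+1)*(d+1) ≤ finrank k ↥(Submodule.span k (Set.range (fun z : k × k => ev d (ph z)))) := by
  have := tri_rank (k := k) (d := d) (R := Fin (d+1)) (D := Empty) (fun i => Infinite.natEmbedding k i)
    ((Infinite.natEmbedding k).injective.comp Fin.val_injective) Empty.elim (by simp) (fun δ => δ.elim)
    Empty.elim Empty.elim (fun δ => δ.elim) (fun δ => δ.elim) (fun δ => δ.elim) (fun δ => δ.elim) (fun δ => δ.elim)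
    (Submodule.span k (Set.range (fun z : k × k => ev d (ph z))))
    (fun i y => Submodule.subset_span ⟨_, rfl⟩) (fun δ => δ.elim)
  simpa using this

theorem QTR_of [Infinite k] {d r c z : ℕ}
    (h : ∀ (R D : Type) [Fintype R] [Fintype D], Fintype.card R = r → Fintype.card D = c →
      ∃ (l : R → k) (p : D → k × k), (d+1) * r + 3 * c ≤ finrank k ↥((⨆ i, Rul d (l i)) ⊔ ⨆ δ, DD d (p δ))) :
    QTR k d r c z := by
  intro R D Z _ _ _ hR hD hZ
  obtain ⟨l, p, hlp⟩ := h R D hR hD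
  obtain ⟨w, hw⟩ := add_generic_span' (k := k) (fun z : k × k => ev d (ph z)) (0, 0)
    ((⨆ i, Rul d (l i)) ⊔ ⨆ δ, DD d (p δ)) Z
  refine ⟨l, p, w, le_trans ?_ hw⟩
  have := span_ph_rank (k := k) d
  rw [hZ]
  omega

theorem QTR_rul [Infinite k] {d r z : ℕ} (hr : r ≤ d + 1) : QTR k d r 0 z := by
  apply QTR_of
  intro R D _ _ hR hD
  have : IsEmpty D := Fintype.card_eq_zero_iff.1 hD
  let e := Fintype.equivFin R
  refine ⟨fun i => Infinite.natEmbedding k (e i), fun δ => isEmptyElim δ, ?_⟩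
  have := tri_rank (k := k) (d := d) (R := R) (D := D) (fun i => Infinite.natEmbedding k (e i))
    ((Infinite.natEmbedding k).injective.comp (Fin.val_injective.comp e.injective)) isEmptyElim
    (by omega) isEmptyElim isEmptyElim isEmptyElim isEmptyElim isEmptyElim isEmptyElim isEmptyElim isEmptyElim
    ((⨆ i, Rul d (Infinite.natEmbedding k (e i))) ⊔ ⨆ δ : D, DD d (isEmptyElim δ))
    (fun i y => Submodule.mem_sup_left (Submodule.mem_iSup_of_mem i (ev_mem_Rul _ _))) isEmptyElim
  refine le_trans (le_of_eq ?_) this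
  rw [hR, hD]

open Polynomial in
theorem QTR_dbl [Infinite k] {e z : ℕ} : QTR k (3*e+1) (2*e+1) (2*e) z := by
  classical
  apply QTR_of
  intro R D _ _ hR hD
  have hcc : Fintype.card D = Fintype.card (Fin e ⊕ Fin e) := by simp [hD]; omega
  obtain ⟨g⟩ : Nonempty (D ≃ Fin e ⊕ Fin e) := ⟨Fintype.equivOfCardEq hcc⟩
  let u : (R ⊕ D) → k := fun i => Infinite.natEmbedding k (Fintype.equivFin (R ⊕ D) i)
  have hu : Function.Injective u :=
    (Infinite.natEmbedding k).injective.comp (Fin.val_injective.comp (Fintype.equivFin _).injective)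
  let x : Fin e ⊕ Fin e → k := fun i => u (Sum.inr (g.symm i))
  have hx : Function.Injective x := hu.comp (Sum.inr_injective.comp g.symm.injective)
  let LA : Fin e ⊕ Fin e → k[X] := Sum.elim
    (fun i => ∏ j ∈ Finset.univ.erase i, (Polynomial.X - Polynomial.C (x (Sum.inl j))))
    (fun i => ∏ j ∈ Finset.univ.erase i, (Polynomial.X - Polynomial.C (x (Sum.inr j))))
  let LB : Fin e ⊕ Fin e → k[X] := Sum.elim
    (fun i => (∏ j ∈ Finset.univ.erase i, (Polynomial.X - Polynomial.C (x (Sum.inl j)))) * (∏ j, (Polynomial.X - Polynomial.C (x (Sum.inr j))))^2)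
    (fun i => (∏ j ∈ Finset.univ.erase i, (Polynomial.X - Polynomial.C (x (Sum.inr j)))) * (∏ j, (Polynomial.X - Polynomial.C (x (Sum.inl j))))^2)
  have degp : ∀ (s : Finset (Fin e)) (f : Fin e → k), (∏ j ∈ s, (Polynomial.X - Polynomial.C (f j))).natDegree = s.card := by
    intro s f
    rw [Polynomial.natDegree_prod_of_monic _ _ (fun i _ => Polynomial.monic_X_sub_C _)]; simp
  have hpos : ∀ i : Fin e ⊕ Fin e, 0 < e := by
    rintro (i | i) <;> exact i.pos
  have cer : ∀ i : Fin e, (Finset.univ.erase i).card = e - 1 := fun i => by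
    rw [Finset.card_erase_of_mem (Finset.mem_univ _)]; simp
  have hAd : ∀ i, (LA i).natDegree = e - 1 := by
    rintro (i | i) <;> simp [LA, degp]
  have hBd : ∀ i, (LB i).natDegree ≤ (e - 1) + 2 * e := by
    rintro (i | i)
    · refine Polynomial.natDegree_mul_le.trans ?_
      refine (Nat.add_le_add_left (Polynomial.natDegree_pow_le) _).trans ?_
      rw [degp, degp, cer]; simp
    · refine Polynomial.natDegree_mul_le.trans ?_
      refine (Nat.add_le_add_left (Polynomial.natDegree_pow_le) _).trans ?_
      rw [degp, degp, cer]; simp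
  have nz : ∀ (s : Finset (Fin e)) (f : Fin e → k) (w : k), (∀ j ∈ s, w ≠ f j) → (∏ j ∈ s, (Polynomial.X - Polynomial.C (f j))).eval w ≠ 0 := by
    intro s f w h
    rw [Polynomial.eval_prod]
    exact Finset.prod_ne_zero_iff.2 fun j hj => by simpa [sub_eq_zero] using h j hj
  have ze : ∀ (s : Finset (Fin e)) (f : Fin e → k) (j : Fin e), j ∈ s → (∏ j ∈ s, (Polynomial.X - Polynomial.C (f j))).eval (f j) = 0 := by
    intro s f j h
    rw [Polynomial.eval_prod]
    exact Finset.prod_eq_zero h (by simp)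
  have hA0 : ∀ i, (LA i).eval (x i) ≠ 0 := by
    rintro (i | i)
    · exact nz _ _ _ fun j hj => hx.ne (by simpa [eq_comm] using hj)
    · exact nz _ _ _ fun j hj => hx.ne (by simpa [eq_comm] using hj)
  have hB0 : ∀ i, (LB i).eval (x i) ≠ 0 := by
    rintro (i | i)
    · simp only [LB, Sum.elim_inl, Polynomial.eval_mul, Polynomial.eval_pow]
      exact mul_ne_zero (nz _ _ _ fun j hj => hx.ne (by simpa [eq_comm] using hj))
        (pow_ne_zero _ (nz _ _ _ fun j hj => hx.ne (by simp)))
    · simp only [LB, Sum.elim_inr, Polynomial.eval_mul, Polynomial.eval_pow]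
      exact mul_ne_zero (nz _ _ _ fun j hj => hx.ne (by simpa [eq_comm] using hj))
        (pow_ne_zero _ (nz _ _ _ fun j hj => hx.ne (by simp)))
  have hAB : ∀ i i', i ≠ i' → ((LA i).eval (x i') = 0 ∧ (LB i).eval (x i') = 0) ∨
      ((LB i).eval (x i') = 0 ∧ (LB i).derivative.eval (x i') = 0) := by
    rintro (i | i) (i' | i') hne
    · left
      have h0 := ze (Finset.univ.erase i) (fun j => x (Sum.inl j)) i' (by simpa [eq_comm] using hne)
      exact ⟨h0, by simp only [LB, Sum.elim_inl, Polynomial.eval_mul, h0, zero_mul]⟩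
    · right
      have h0 := ze Finset.univ (fun j => x (Sum.inr j)) i' (by simp)
      constructor
      · simp only [LB, Sum.elim_inl, Polynomial.eval_mul, Polynomial.eval_pow, h0]; simp
      · simp only [LB, Sum.elim_inl, Polynomial.derivative_mul, Polynomial.derivative_pow, Polynomial.eval_add, Polynomial.eval_mul, Polynomial.eval_pow, h0]; simp
    · right
      have h0 := ze Finset.univ (fun j => x (Sum.inl j)) i' (by simp)
      constructor
      · simp only [LB, Sum.elim_inr, Polynomial.eval_mul, Polynomial.eval_pow, h0]; simp
      · simp only [LB, Sum.elim_inr, Polynomial.derivative_mul, Polynomial.derivative_pow, Polynomial.eval_add, Polynomial.eval_mul, Polynomial.eval_pow, h0]; simp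
    · left
      have h0 := ze (Finset.univ.erase i) (fun j => x (Sum.inr j)) i' (by simpa [eq_comm] using hne)
      exact ⟨h0, by simp only [LB, Sum.elim_inr, Polynomial.eval_mul, h0, zero_mul]⟩
  have xg : ∀ δ, x (g δ) = u (Sum.inr δ) := fun δ => by simp [x]
  refine ⟨fun i => u (Sum.inl i), fun δ => (x (g δ), x (g δ)), ?_⟩
  have := tri_rank (k := k) (d := 3*e+1) (R := R) (D := D) (fun i => u (Sum.inl i))
    (hu.comp Sum.inl_injective) (fun δ => (x (g δ), x (g δ)))
    (by omega) (fun δ i => by rw [xg]; exact hu.ne (by simp)) (fun δ => LA (g δ)) (fun δ => LB (g δ))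
    (fun δ => by have := hpos (g δ); rw [hAd, hR]; omega) (fun δ => by have := hpos (g δ); have := hBd (g δ); omega)
    (fun δ => hA0 _) (fun δ => hB0 _) (fun δ δ' h => hAB _ _ (g.injective.ne h))
    ((⨆ i, Rul (3*e+1) (u (Sum.inl i))) ⊔ ⨆ δ : D, DD (3*e+1) (x (g δ), x (g δ)))
    (fun i y => Submodule.mem_sup_left (Submodule.mem_iSup_of_mem i (ev_mem_Rul _ _)))
    (fun δ => le_sup_of_le_right (le_iSup (fun δ => DD (3*e+1) (x (g δ), x (g δ))) δ))
  refine le_trans (le_of_eq ?_) this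
  rw [hR, hD]

end Quad2
end BP

namespace BP
open Module

section Quad3
variable {k : Type} [Field k]

def BB (a b : k × k) : k := (a.1 - b.1) * (a.2 - b.2)

theorem q_line (a b : k × k) (s t : k) : ev 2 (s • ph a + t • ph b) (qq k) = s * t * BB a b := by
  rw [ev_qq]; simp [ph, BB]; ring

theorem Line_res [Infinite k] {d : ℕ} (a b : k × k) (h : BB a b ≠ 0) (W : Submodule k (Dual k (Fm k 4 (d+2))))
    (hW : Line (d+2) (ph a) (ph b) ≤ W) :
    Line d (ph a) (ph b) ≤ W.map (mulF d (qq k)).dualMap := by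
  have key : ∀ s t : k, s ≠ 0 → t ≠ 0 → ev d (s • ph a + t • ph b) ∈ W.map (mulF d (qq k)).dualMap := by
    intro s t hs ht
    have h1 := Submodule.mem_map_of_mem (f := (mulF d (qq k)).dualMap) (hW (ev_mem_Line (ph a) (ph b) s t))
    rw [mulF_ev, q_line] at h1
    have h2 := Submodule.smul_mem _ (s * t * BB a b)⁻¹ h1
    rwa [smul_smul, inv_mul_cancel₀ (mul_ne_zero (mul_ne_zero hs ht) h), one_smul] at h2
  have key2 : ∀ s t : k, s ≠ 0 → ev d (s • ph a + t • ph b) ∈ W.map (mulF d (qq k)).dualMap := by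
    intro s t hs
    by_cases ht : t = 0
    · apply ev_mem_of_ne _ (ph b)
      intro τ hτ
      have := key s τ hs hτ
      simpa [ht] using this
    · exact key s t hs ht
  rw [Line_le_iff]
  intro s t
  by_cases hs : s = 0
  · apply ev_mem_of_ne _ (ph a)
    intro τ hτ
    have := key2 τ t hτ
    rw [add_comm (τ • ph a)] at this
    simpa [hs] using this
  · exact key2 s t hs

theorem DD_le [Infinite k] {d : ℕ} (p a b : k × k) (W : Submodule k (Dual k (Fm k 4 d)))
    (ha : Line d (ph p) (ph a) ≤ W) (hb : Line d (ph p) (ph b) ≤ W) (hy : dv d (ph p) (wy p) ∈ W)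
    (hne : (a.1 - p.1) * (b.1 - p.1) * (b.2 - a.2) ≠ 0) : DD d p ≤ W := by
  have e : BB p b • ph a - BB p a • ph b = (BB p b - BB p a) • ph p +
      ((a.1 - p.1) * (b.1 - p.1) * (b.2 - a.2)) • wx p + ((a.2 - p.2) * (b.2 - p.2) * (b.1 - a.1)) • wy p := by
    ext i; fin_cases i <;> simp [ph, wx, wy, BB] <;> ring
  have h0 : ev d (ph p) ∈ W := ha (ev_mem_Line_left _ _)
  have e2 : ((a.1 - p.1) * (b.1 - p.1) * (b.2 - a.2)) • dv d (ph p) (wx p) =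
      BB p b • dv d (ph p) (ph a) - BB p a • dv d (ph p) (ph b) - (BB p b - BB p a) • ((d : k) • ev d (ph p))
       - ((a.2 - p.2) * (b.2 - p.2) * (b.1 - a.1)) • dv d (ph p) (wy p) := by
    have := congrArg (dv d (ph p)) e
    rw [dv_add, dv_add, dv_sub, dv_smul, dv_smul, dv_smul, dv_smul, dv_smul, dv_self] at this
    rw [this]
    abel
  have hx : dv d (ph p) (wx p) ∈ W := by
    have : ((a.1 - p.1) * (b.1 - p.1) * (b.2 - a.2)) • dv d (ph p) (wx p) ∈ W := by
      rw [e2]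
      exact sub_mem (sub_mem (sub_mem (W.smul_mem _ (ha (dv_mem_Line _ _))) (W.smul_mem _ (hb (dv_mem_Line _ _))))
        (W.smul_mem _ (W.smul_mem _ h0))) (W.smul_mem _ hy)
    have h2 := W.smul_mem ((a.1 - p.1) * (b.1 - p.1) * (b.2 - a.2))⁻¹ this
    rwa [smul_smul, inv_mul_cancel₀ hne, one_smul] at h2
  unfold DD PD
  refine sup_le (sup_le ?_ ?_) ?_ <;> rw [Submodule.span_singleton_le_iff_mem]
  exacts [h0, hx, hy]

theorem QTr_ann {d : ℕ} {R D Z : Type} (l : R → k) (p : D → k × k) (z : Z → k × k) :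
    ∀ φ ∈ QTr (d+2) l p z, φ ∘ₗ mulF d (qq k) = 0 := by
  have : QTr (d+2) l p z ≤ LinearMap.ker (mulF d (qq k)).dualMap := by
    have hev : ∀ w : k × k, ev 2 (ph w) (qq k) = 0 := fun w => by rw [ev_qq]; simp [ph]
    refine sup_le (sup_le (iSup_le fun i => ?_) (iSup_le fun i => ?_)) (iSup_le fun i => ?_)
    · rw [Rul, Line_le_iff]
      intro s t
      rw [LinearMap.mem_ker, mulF_ev, q_line]
      simp [BB]
    · unfold DD PD
      refine sup_le (sup_le ?_ ?_) ?_ <;> rw [Submodule.span_singleton_le_iff_mem, LinearMap.mem_ker]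
      · rw [mulF_ev, hev, zero_smul]
      · rw [mulF_dv, hev, dv_qq]; simp [ph, wx]
      · rw [mulF_dv, hev, dv_qq]; simp [ph, wy]
    · rw [Submodule.span_singleton_le_iff_mem, LinearMap.mem_ker, mulF_ev, hev, zero_smul]
  intro φ hφ
  exact this hφ

theorem QFix0 {d : ℕ} {R D Z : Type} (l : R → k) (p : D → k × k) (z : Z → k × k)
    (W : Submodule k (Dual k (Fm k 4 (d+2)))) (hA : QTr (d+2) l p z ≤ W)
    (V : Submodule k (Dual k (Fm k 4 d))) (hV : V ≤ W.map (mulF d (qq k)).dualMap) :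
    finrank k ↥(QTr (d+2) l p z) + finrank k V ≤ finrank k W := by
  have h1 := horace (mulF d (qq k)) (QTr (d+2) l p z) W (QTr_ann l p z)
  have h2 := Submodule.finrank_mono hV
  have h3 : finrank k ↥(QTr (d+2) l p z ⊔ W) ≤ finrank k W := Submodule.finrank_mono (sup_le hA le_rfl)
  omega

/-- limit lemma -/
theorem LimLemma [Infinite k] {d : ℕ} {D : Type} (W : k → Submodule k (Dual k (Fm k 4 d))) (hW : Reg W)
    (p : D → k × k) (h1 : ∀ ε δ, ev d (ph (p δ)) ∈ W ε) (h2 : ∀ ε δ, ev d (ph ((p δ).1, (p δ).2 + ε)) ∈ W ε)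
    (r : ℕ) (hr : r ≤ finrank k ↥(W 0 ⊔ ⨆ δ, Submodule.span k {dv d (ph (p δ)) (wy (p δ))})) :
    ∃ ε, r ≤ finrank k ↥(W ε) := by
  have hreg : Reg (fun ε => W ε ⊔ ⨆ δ, Submodule.span k {dq d (ph (p δ)) (wy (p δ)) ε}) :=
    hW.sup (Reg.iSup fun δ => Reg.single (dq_PLs _ _))
  have ho := hreg.isZOpen r
  have hne := ZOpen.ne_zero (PL.lin (LinearMap.id (R := k) (M := k)))
  obtain ⟨ε, hε1, hε2⟩ := ZOpen.nonempty_inter ho hne ⟨0, by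
    refine le_trans hr (Submodule.finrank_mono (sup_le_sup_left (iSup_mono fun δ => ?_) _))
    rw [dq_zero]⟩ ⟨1, by simp⟩
  refine ⟨ε, le_trans hε1 (Submodule.finrank_mono ?_)⟩
  refine sup_le le_rfl (iSup_le fun δ => ?_)
  have hε : ε ≠ 0 := hε2
  rw [Submodule.span_singleton_le_iff_mem, dq, if_neg hε, ph_add_y]
  exact Submodule.smul_mem _ _ (sub_mem (h2 _ _) (h1 _ _))

end Quad3
end BP

namespace BP
open Module

section Quad4
variable {k : Type} [Field k]

abbrev XC (k : Type) [Field k] (T L : Type) : Type :=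
  (T → (k × k) × (k × k) × (k × k)) × (L → (k × k) × (k × k))

noncomputable def WW {T L : Type} (d : ℕ) (x : XC k T L) : Submodule k (Dual k (Fm k 4 d)) :=
  (⨆ i, Line d (ph (x.1 i).1) (ph (x.1 i).2.1) ⊔ Line d (ph (x.1 i).1) (ph (x.1 i).2.2)) ⊔
  ⨆ i, Line d (ph (x.2 i).1) (ph (x.2 i).2)

theorem WW_T1 {T L : Type} (d : ℕ) (x : XC k T L) (i : T) : Line d (ph (x.1 i).1) (ph (x.1 i).2.1) ≤ WW d x :=
  le_sup_of_le_left (le_sup_left.trans (le_iSup (fun i => Line d (ph (x.1 i).1) (ph (x.1 i).2.1) ⊔ Line d (ph (x.1 i).1) (ph (x.1 i).2.2)) i))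
theorem WW_T2 {T L : Type} (d : ℕ) (x : XC k T L) (i : T) : Line d (ph (x.1 i).1) (ph (x.1 i).2.2) ≤ WW d x :=
  le_sup_of_le_left (le_sup_right.trans (le_iSup (fun i => Line d (ph (x.1 i).1) (ph (x.1 i).2.1) ⊔ Line d (ph (x.1 i).1) (ph (x.1 i).2.2)) i))
theorem WW_L {T L : Type} (d : ℕ) (x : XC k T L) (i : L) : Line d (ph (x.2 i).1) (ph (x.2 i).2) ≤ WW d x :=
  le_sup_of_le_right (le_iSup (fun i => Line d (ph (x.2 i).1) (ph (x.2 i).2)) i)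

def SR (k : Type) [Field k] (d t m r : ℕ) : Prop :=
  ∀ (T L : Type) [Fintype T] [Fintype L], Fintype.card T = t → Fintype.card L = m →
    ∃ x : XC k T L, r ≤ finrank k ↥(WW d x)

theorem SR_mk {T0 L0 : Type} [Fintype T0] [Fintype L0] {d t m r : ℕ} (x : XC k T0 L0) (h : r ≤ finrank k ↥(WW d x))
    (ht : Fintype.card T0 = t) (hm : Fintype.card L0 = m) : SR k d t m r := by
  intro T L _ _ hT hL
  let e := Fintype.equivOfCardEq (ht.trans hT.symm)
  let f := Fintype.equivOfCardEq (hm.trans hL.symm)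
  refine ⟨(fun i => x.1 (e.symm i), fun i => x.2 (f.symm i)), h.trans (Submodule.finrank_mono ?_)⟩
  set y : XC k T L := (fun i => x.1 (e.symm i), fun i => x.2 (f.symm i)) with hy
  refine sup_le (iSup_le fun i => sup_le ?_ ?_) (iSup_le fun i => ?_)
  · have := WW_T1 d y (e i)
    simpa only [hy, Equiv.symm_apply_apply] using this
  · have := WW_T2 d y (e i)
    simpa only [hy, Equiv.symm_apply_apply] using this
  · have := WW_L d y (f i)
    simpa only [hy, Equiv.symm_apply_apply] using this

section reg
variable {E : Type} [AddCommGroup E] [Module k E]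
def PZ (z : E → k × k) : Prop := PL k (fun x => (z x).1) ∧ PL k (fun x => (z x).2)

theorem PZ.ph {z : E → k × k} (h : PZ z) (i : Fin 4) : PL k (fun x => ph (z x) i) := ph_PL h.1 h.2 i
theorem PZ.const (c : k × k) : PZ (fun _ : E => c) := ⟨PL.const _, PL.const _⟩
theorem PZ.of_lin {z : E → k × k} (h1 : ∀ x y, z (x + y) = z x + z y) (h2 : ∀ (c : k) x, z (c • x) = c • z x) : PZ z :=
  ⟨PL.of_lin (fun x y => by rw [h1]; rfl) (fun c x => by rw [h2]; rfl),
   PL.of_lin (fun x y => by rw [h1]; rfl) (fun c x => by rw [h2]; rfl)⟩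
theorem PZ.BB {z w : E → k × k} (h : PZ z) (h' : PZ w) : PL k (fun x => BB (z x) (w x)) :=
  (h.1.sub h'.1).mul (h.2.sub h'.2)

theorem WW_reg {T L : Type} {d : ℕ} (h : E → XC k T L) (h1 : ∀ i, PZ (fun x => ((h x).1 i).1))
    (h2 : ∀ i, PZ (fun x => ((h x).1 i).2.1)) (h3 : ∀ i, PZ (fun x => ((h x).1 i).2.2))
    (h4 : ∀ i, PZ (fun x => ((h x).2 i).1)) (h5 : ∀ i, PZ (fun x => ((h x).2 i).2)) :
    Reg (fun x => WW d (h x)) := by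
  unfold WW
  exact Reg.sup (Reg.iSup fun i => Reg.sup (Line_reg (h1 i).ph (h2 i).ph) (Line_reg (h1 i).ph (h3 i).ph))
    (Reg.iSup fun i => Line_reg (h4 i).ph (h5 i).ph)
end reg

theorem Rul_le {d : ℕ} (a : k × k) : Rul d a.1 ≤ Line d (ph a) (ph (a.1, a.2 + 1)) := by
  rw [Rul, Line_le_iff]
  intro s t
  have : s • ph (a.1, 0) + t • ph (a.1, 1) = (s * (1 + a.2) + t * a.2) • ph a + (- s * a.2 + t * (1 - a.2)) • ph (a.1, a.2 + 1) := by
    ext i; fin_cases i <;> simp [ph] <;> ring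
  rw [this]
  exact ev_mem_Line _ _ _ _

set_option maxHeartbeats 1600000 in
theorem qstep [CharZero k] {d t' t l i m' r' : ℕ} (hm : m' = t + l) (hS : SR k d t' m' r')
    (hQ : QTR k (d+2) (t+i) t' (t+2*l+2*t')) :
    SR k (d+2) t (l+i+2*t') (min ((d+3)*(d+3)) ((d+3)*(t+i) + 3*t' + (t+2*l+2*t')) + r') := by
  have : Infinite k := inferInstance
  let T' := Fin t'; let T := Fin t; let L := Fin l; let I := Fin i
  let E := (T' → (k × k) × (k × k) × (k × k)) × (T → (k × k) × (k × k)) × (L → (k × k) × (k × k)) × (I → k)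
  let el : E → T ⊕ I → k := fun x => Sum.elim (fun a => (x.2.1 a).1.1) x.2.2.2
  let ep : E → T' → k × k := fun x δ => (x.1 δ).1
  let ez : E → T ⊕ (L ⊕ L) ⊕ (T' ⊕ T') → k × k := fun x => Sum.elim (fun a => (x.2.1 a).2)
    (Sum.elim (Sum.elim (fun b => (x.2.2.1 b).1) (fun b => (x.2.2.1 b).2))
      (Sum.elim (fun δ => (x.1 δ).2.1) (fun δ => (x.1 δ).2.2)))
  let ey : E → XC k T' (T ⊕ L) := fun x => (x.1, Sum.elim x.2.1 x.2.2.1)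
  have plin : ∀ {g : E → k × k}, (∀ x y, g (x + y) = g x + g y) → (∀ (c : k) x, g (c • x) = c • g x) → PZ g :=
    fun h1 h2 => PZ.of_lin h1 h2
  have p1 : ∀ δ, PZ (fun x : E => (x.1 δ).1) := fun δ => plin (fun _ _ => rfl) (fun _ _ => rfl)
  have p2 : ∀ δ, PZ (fun x : E => (x.1 δ).2.1) := fun δ => plin (fun _ _ => rfl) (fun _ _ => rfl)
  have p3 : ∀ δ, PZ (fun x : E => (x.1 δ).2.2) := fun δ => plin (fun _ _ => rfl) (fun _ _ => rfl)
  have p4 : ∀ δ, PZ (fun x : E => (x.2.1 δ).1) := fun δ => plin (fun _ _ => rfl) (fun _ _ => rfl)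
  have p5 : ∀ δ, PZ (fun x : E => (x.2.1 δ).2) := fun δ => plin (fun _ _ => rfl) (fun _ _ => rfl)
  have p6 : ∀ δ, PZ (fun x : E => (x.2.2.1 δ).1) := fun δ => plin (fun _ _ => rfl) (fun _ _ => rfl)
  have p7 : ∀ δ, PZ (fun x : E => (x.2.2.1 δ).2) := fun δ => plin (fun _ _ => rfl) (fun _ _ => rfl)
  have p8 : ∀ j, PL k (fun x : E => x.2.2.2 j) := fun δ => PL.of_lin (fun _ _ => rfl) (fun _ _ => rfl)
  have pz : ∀ j, PZ (fun x : E => ez x j) := by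
    rintro (j | (j | j) | (j | j))
    exacts [p5 j, p6 j, p7 j, p2 j, p3 j]
  set rq := min ((d+3)*(d+3)) ((d+3)*(t+i) + 3*t' + (t+2*l+2*t')) with hrq
  have O1 : ZOpen k {x : E | rq ≤ finrank k ↥(QTr (d+2) (el x) (ep x) (ez x))} := by
    refine Reg.isZOpen (QTr_reg ?_ (fun j => (p1 j).1) (fun j => (p1 j).2) (fun j => (pz j).1) (fun j => (pz j).2)) rq
    rintro (j | j)
    exacts [(p4 j).1, p8 j]
  have N1 : {x : E | rq ≤ finrank k ↥(QTr (d+2) (el x) (ep x) (ez x))}.Nonempty := by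
    obtain ⟨l0, p0, z0, h0⟩ := hQ (T ⊕ I) T' (T ⊕ (L ⊕ L) ⊕ (T' ⊕ T')) (by simp [T, I]) (by simp [T'])
      (by simp [T, L, T']; omega)
    let x0 : E := (fun δ => (p0 δ, z0 (.inr (.inr (.inl δ))), z0 (.inr (.inr (.inr δ)))), fun a => ((l0 (.inl a), 0), z0 (.inl a)),
      fun b => (z0 (.inr (.inl (.inl b))), z0 (.inr (.inl (.inr b)))), fun j => l0 (.inr j))
    have e1 : el x0 = l0 := by funext j; rcases j with j | j <;> rfl
    have e2 : ep x0 = p0 := rfl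
    have e3 : ez x0 = z0 := by funext j; rcases j with j | (j | j) | (j | j) <;> rfl
    refine ⟨x0, ?_⟩
    simp only [Set.mem_ofPred_eq]
    rw [e1, e2, e3]
    exact h0
  have O2 : ZOpen k {x : E | r' ≤ finrank k ↥(WW d (ey x))} := by
    refine Reg.isZOpen (WW_reg ey p1 p2 p3 ?_ ?_) r'
    · rintro (j | j)
      exacts [p4 j, p6 j]
    · rintro (j | j)
      exacts [p5 j, p7 j]
  have N2 : {x : E | r' ≤ finrank k ↥(WW d (ey x))}.Nonempty := by
    obtain ⟨y, hy⟩ := hS T' (T ⊕ L) (by simp [T']) (by simp [T, L, hm])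
    let x0 : E := (y.1, fun a => y.2 (.inl a), fun a => y.2 (.inr a), 0)
    have e1 : ey x0 = y := Prod.ext rfl (by funext j; rcases j with j | j <;> rfl)
    refine ⟨x0, ?_⟩
    simp only [Set.mem_ofPred_eq]
    rw [e1]
    exact hy
  have O3 : ZOpen k ({x : E | ∀ δ, x ∈ {x : E | (((x.1 δ).2.1.1 - (x.1 δ).1.1) * ((x.1 δ).2.2.1 - (x.1 δ).1.1) *
      ((x.1 δ).2.2.2 - (x.1 δ).2.1.2)) * (BB (x.1 δ).1 (x.1 δ).2.1 * BB (x.1 δ).1 (x.1 δ).2.2) ≠ 0}} ∩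
      ({x : E | ∀ a, x ∈ {x : E | BB (x.2.1 a).1 (x.2.1 a).2 ≠ 0}} ∩
       {x : E | ∀ a, x ∈ {x : E | BB (x.2.2.1 a).1 (x.2.2.1 a).2 ≠ 0}})) := by
    refine ZOpen.inter (ZOpen.forall fun δ => ZOpen.ne_zero ?_) (ZOpen.inter
      (ZOpen.forall fun δ => ZOpen.ne_zero ?_) (ZOpen.forall fun δ => ZOpen.ne_zero ?_))
    · exact ((((p2 δ).1.sub (p1 δ).1).mul ((p3 δ).1.sub (p1 δ).1)).mul ((p3 δ).2.sub (p2 δ).2)).mul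
        (((p1 δ).BB (p2 δ)).mul ((p1 δ).BB (p3 δ)))
    · exact (p4 δ).BB (p5 δ)
    · exact (p6 δ).BB (p7 δ)
  obtain ⟨x, ⟨hx1, hx2⟩, hx3, hx4, hx5⟩ := ZOpen.nonempty_inter (O1.inter O2) O3 (ZOpen.nonempty_inter O1 O2 N1 N2)
    ⟨(fun _ => ((0,0),(1,1),(1,2)), fun _ => ((0,0),(1,1)), fun _ => ((0,0),(1,1)), 0), by
      refine ⟨fun δ => ?_, fun δ => ?_, fun δ => ?_⟩
      · simp only [Set.mem_ofPred_eq, BB]; norm_num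
      · simp only [Set.mem_ofPred_eq, BB]; norm_num
      · simp only [Set.mem_ofPred_eq, BB]; norm_num⟩
  simp only [Set.mem_ofPred_eq] at hx1 hx2 hx3 hx4 hx5
  let out : k → XC k T (L ⊕ I ⊕ T' ⊕ T') := fun ε =>
    (fun a => ((x.2.1 a).1, (x.2.1 a).2, ((x.2.1 a).1.1, (x.2.1 a).1.2 + 1)),
     Sum.elim x.2.2.1 (Sum.elim (fun j => ((x.2.2.2 j, 0), (x.2.2.2 j, 1)))
      (Sum.elim (fun δ => ((x.1 δ).1, (x.1 δ).2.1)) (fun δ => (((x.1 δ).1.1, (x.1 δ).1.2 + ε), (x.1 δ).2.2)))))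
  have hreg : Reg (fun ε => WW (d+2) (out ε)) := by
    refine WW_reg out (fun i => PZ.const _) (fun i => PZ.const _) (fun i => PZ.const _) ?_ ?_
    · rintro (j | j | j | j)
      · exact PZ.const (E := k) (x.2.2.1 j).1
      · exact PZ.const (E := k) (x.2.2.2 j, 0)
      · exact PZ.const (E := k) (x.1 j).1
      · exact ⟨PL.const _, (PL.const _).add (PL.of_lin (fun _ _ => rfl) (fun _ _ => rfl))⟩
    · rintro (j | j | j | j)
      · exact PZ.const (E := k) (x.2.2.1 j).2
      · exact PZ.const (E := k) (x.2.2.2 j, 1)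
      · exact PZ.const (E := k) (x.1 j).2.1
      · exact PZ.const (E := k) (x.1 j).2.2
  have hL1 : ∀ ε δ, Line (d+2) (ph (x.1 δ).1) (ph (x.1 δ).2.1) ≤ WW (d+2) (out ε) := fun ε δ =>
    WW_L (d+2) (out ε) (.inr (.inr (.inl δ)))
  have hL2 : ∀ ε δ, Line (d+2) (ph ((x.1 δ).1.1, (x.1 δ).1.2 + ε)) (ph (x.1 δ).2.2) ≤ WW (d+2) (out ε) := fun ε δ =>
    WW_L (d+2) (out ε) (.inr (.inr (.inr δ)))
  obtain ⟨ε, hε⟩ := LimLemma (fun ε => WW (d+2) (out ε)) hreg (ep x) (fun ε δ => hL1 ε δ (ev_mem_Line_left _ _))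
    (fun ε δ => hL2 ε δ (ev_mem_Line_left _ _)) (rq + r') (by
      set W0 := WW (d+2) (out 0) ⊔ ⨆ δ, Submodule.span k {dv (d+2) (ph (ep x δ)) (wy (ep x δ))} with hW0
      have hle : WW (d+2) (out 0) ≤ W0 := le_sup_left
      have hL1' : ∀ δ, Line (d+2) (ph (x.1 δ).1) (ph (x.1 δ).2.1) ≤ W0 := fun δ => (hL1 0 δ).trans hle
      have hL2' : ∀ δ, Line (d+2) (ph (x.1 δ).1) (ph (x.1 δ).2.2) ≤ W0 := fun δ => by
        have := (hL2 0 δ).trans hle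
        simpa only [add_zero, Prod.mk.eta] using this
      have hL3 : ∀ b, Line (d+2) (ph (x.2.2.1 b).1) (ph (x.2.2.1 b).2) ≤ W0 := fun b =>
        (WW_L (d+2) (out 0) (.inl b)).trans hle
      have hL4 : ∀ b, Line (d+2) (ph (x.2.1 b).1) (ph (x.2.1 b).2) ≤ W0 := fun b =>
        (WW_T1 (d+2) (out 0) b).trans hle
      have hd : ∀ δ, dv (d+2) (ph (ep x δ)) (wy (ep x δ)) ∈ W0 := fun δ =>
        Submodule.mem_sup_right (Submodule.mem_iSup_of_mem δ (Submodule.mem_span_singleton_self _))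
      have hQT : QTr (d+2) (el x) (ep x) (ez x) ≤ W0 := by
        refine sup_le (sup_le (iSup_le ?_) (iSup_le fun δ => ?_)) (iSup_le ?_)
        · rintro (j | j)
          · exact (Rul_le (x.2.1 j).1).trans ((WW_T2 (d+2) (out 0) j).trans hle)
          · exact (WW_L (d+2) (out 0) (.inr (.inl j))).trans hle
        · refine DD_le (ep x δ) (x.1 δ).2.1 (x.1 δ).2.2 W0 (hL1' δ) (hL2' δ) (hd δ) ?_
          exact left_ne_zero_of_mul (hx3 δ)
        · rintro (j | (j | j) | (j | j)) <;> rw [Submodule.span_singleton_le_iff_mem]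
          · exact hL4 j (ev_mem_Line_right _ _)
          · exact hL3 j (ev_mem_Line_left _ _)
          · exact hL3 j (ev_mem_Line_right _ _)
          · exact hL1' j (ev_mem_Line_right _ _)
          · exact hL2' j (ev_mem_Line_right _ _)
      have hV : WW d (ey x) ≤ W0.map (mulF d (qq k)).dualMap := by
        refine sup_le (iSup_le fun δ => sup_le ?_ ?_) (iSup_le ?_)
        · exact Line_res _ _ (left_ne_zero_of_mul (right_ne_zero_of_mul (hx3 δ))) W0 (hL1' δ)
        · exact Line_res _ _ (right_ne_zero_of_mul (right_ne_zero_of_mul (hx3 δ))) W0 (hL2' δ)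
        · rintro (j | j)
          · exact Line_res _ _ (hx4 j) W0 (hL4 j)
          · exact Line_res _ _ (hx5 j) W0 (hL3 j)
      have := QFix0 _ _ _ W0 hQT _ hV
      omega)
  exact SR_mk (out ε) hε (by simp [T]) (by simp [L, I, T']; omega)

end Quad4
end BP

namespace BP
open Module

section Quad5
variable {k : Type} [Field k]

def vv (k : Type) [Field k] (c : Fin 4 → ℤ) : Fin 4 → k :=
  ![c 0 + c 1 + c 2 + c 3, c 1 + c 3, c 2 + c 3, c 3]

noncomputable def ell (k : Type) [Field k] : Fin 4 → MvPolynomial (Fin 4) k :=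
  ![X 0 - X 1 - X 2 + X 3, X 1 - X 3, X 2 - X 3, X 3]

theorem ell_hom (a : Fin 4) : (ell k a).IsHomogeneous 1 := by
  have h := fun i : Fin 4 => isHomogeneous_X k i
  fin_cases a
  · exact (((h 0).sub (h 1)).sub (h 2)).add (h 3)
  · exact (h 1).sub (h 3)
  · exact (h 2).sub (h 3)
  · exact h 3

noncomputable def pr2 (k : Type) [Field k] (a b : Fin 4) : Fm k 4 2 :=
  ⟨ell k a * ell k b, by
    rw [mem_homogeneousSubmodule]; exact (ell_hom a).mul (ell_hom b)⟩

theorem eval_ell (c : Fin 4 → ℤ) (a : Fin 4) : eval (vv k c) (ell k a) = (c a : k) := by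
  fin_cases a <;> simp [vv, ell]; ring

theorem ev_pr2 (c : Fin 4 → ℤ) (a b : Fin 4) : ev 2 (vv k c) (pr2 k a b) = ((c a * c b : ℤ) : k) := by
  rw [ev_apply]; simp [pr2, eval_ell]

theorem d_ell (v : Fin 4 → ℤ) (w : Fin 4 → k) (a : Fin 4) : ∑ i, vv k v i * eval w (pderiv i (ell k a)) = (v a : k) := by
  rw [Fin.sum_univ_four]
  fin_cases a <;> simp [vv, ell, pderiv_X, Pi.single_apply] <;> ring

theorem dv_pr2 (c v : Fin 4 → ℤ) (a b : Fin 4) :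
    dv 2 (vv k c) (vv k v) (pr2 k a b) = ((c a * v b + v a * c b : ℤ) : k) := by
  rw [dv_apply]
  have : ∀ i, vv k v i * eval (vv k c) (pderiv i (pr2 k a b).1) =
      c a * (vv k v i * eval (vv k c) (pderiv i (ell k b))) + c b * (vv k v i * eval (vv k c) (pderiv i (ell k a))) := by
    intro i
    simp only [pr2, Derivation.leibniz, smul_eq_mul, map_add, map_mul, eval_ell]
    ring
  simp only [this, Finset.sum_add_distrib, ← Finset.mul_sum, d_ell]
  push_cast; ring

theorem vv_add (c c' : Fin 4 → ℤ) : vv k (c + c') = vv k c + vv k c' := by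
  ext i; fin_cases i <;> simp [vv] <;> ring

theorem ev_add_mem {d : ℕ} {W : Submodule k (Dual k (Fm k 4 d))} {a b c : Fin 4 → ℤ} (h : Line d (vv k a) (vv k b) ≤ W) (hc : c = a + b) :
    ev d (vv k c) ∈ W := by
  rw [hc, vv_add]
  simpa using h (ev_mem_Line _ _ 1 1)

theorem qtab [CharZero k] (U : Submodule k (Dual k (Fm k 4 2))) {r : ℕ} (ψ : Fin r → Dual k (Fm k 4 2)) (hψ : ∀ i, ψ i ∈ U)
    (s t : Fin r → Fin 4) (τ : Fin r → Fin 4 → Fin 4 → ℤ) (hτ : ∀ i a b, ψ i (pr2 k a b) = (τ i a b : k))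
    (h1 : ∀ i, τ i (s i) (t i) ≠ 0) (h2 : ∀ i j, i < j → τ i (s j) (t j) = 0) : r ≤ finrank k U := by
  refine rank_ge_of_triangular U ψ hψ (fun j => pr2 k (s j) (t j)) (fun i => ?_) (fun i j hij => ?_)
  · rw [hτ]; exact_mod_cast h1 i
  · rw [hτ, h2 i j hij]; simp

/-- the chain of lines has maximal rank in degree two -/
theorem chain_rank [CharZero k] (U : Submodule k (Dual k (Fm k 4 2)))
    (h1 : Line 2 (ph (0, 0)) (ph (1, 1)) ≤ U) (h2 : Line 2 (ph (1, 1)) (ph (1, 0)) ≤ U)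
    (h3 : Line 2 (ph (1, 0)) (ph (0, 1)) ≤ U) (h4 : Line 2 (ph (2, 0)) (ph (2, 1)) ≤ U) : 10 ≤ finrank k U := by
  have e1 : ph ((0, 0) : k × k) = vv k ![1, 0, 0, 0] := by ext i; fin_cases i <;> simp [ph, vv]
  have e2 : ph ((1, 1) : k × k) = vv k ![0, 0, 0, 1] := by ext i; fin_cases i <;> simp [ph, vv]
  have e3 : ph ((1, 0) : k × k) = vv k ![0, 1, 0, 0] := by ext i; fin_cases i <;> simp [ph, vv]
  have e4 : ph ((0, 1) : k × k) = vv k ![0, 0, 1, 0] := by ext i; fin_cases i <;> simp [ph, vv]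
  have e5 : ph ((2, 0) : k × k) = vv k ![-1, 2, 0, 0] := by ext i; fin_cases i <;> simp [ph, vv] <;> norm_num
  have e6 : ph ((2, 1) : k × k) = vv k ![0, 0, -1, 2] := by ext i; fin_cases i <;> simp [ph, vv] <;> norm_num
  rw [e1, e2] at h1
  rw [e2, e3] at h2
  rw [e3, e4] at h3
  rw [e5, e6] at h4
  let c : Fin 10 → Fin 4 → ℤ := ![![1,0,0,0], ![0,0,0,1], ![0,1,0,0], ![0,0,1,0], ![1,0,0,1], ![0,1,0,1], ![0,1,1,0],
    ![-1,2,0,0], ![0,0,-1,2], ![-1,2,-1,2]]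
  refine qtab U (fun i => ev 2 (vv k (c i))) ?_ ![0,3,1,2,0,3,1,0,3,0] ![0,3,1,2,3,1,2,1,2,2] (fun i a b => c i a * c i b)
    (fun i a b => ev_pr2 _ _ _) (by decide) (by decide)
  intro i
  fin_cases i
  · exact h1 (ev_mem_Line_left _ _)
  · exact h1 (ev_mem_Line_right _ _)
  · exact h2 (ev_mem_Line_right _ _)
  · exact h3 (ev_mem_Line_right _ _)
  · exact ev_add_mem h1 (by decide)
  · exact ev_add_mem h2 (by decide)
  · exact ev_add_mem h3 (by decide)
  · exact h4 (ev_mem_Line_left _ _)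
  · exact h4 (ev_mem_Line_right _ _)
  · exact ev_add_mem h4 (by decide)

theorem res9_rank [CharZero k] (U : Submodule k (Dual k (Fm k 4 2)))
    (h1 : Line 2 (ph (0, 0)) (ph (1, 1)) ≤ U) (h2 : Line 2 (ph (1, 0)) (ph (0, 1)) ≤ U)
    (h3 : PD 2 (vv k ![1,1,1,0]) (vv k ![0,1,0,0]) (vv k ![0,0,0,1]) ≤ U) : 9 ≤ finrank k U := by
  have e1 : ph ((0, 0) : k × k) = vv k ![1, 0, 0, 0] := by ext i; fin_cases i <;> simp [ph, vv]
  have e2 : ph ((1, 1) : k × k) = vv k ![0, 0, 0, 1] := by ext i; fin_cases i <;> simp [ph, vv]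
  have e3 : ph ((1, 0) : k × k) = vv k ![0, 1, 0, 0] := by ext i; fin_cases i <;> simp [ph, vv]
  have e4 : ph ((0, 1) : k × k) = vv k ![0, 0, 1, 0] := by ext i; fin_cases i <;> simp [ph, vv]
  rw [e1, e2] at h1
  rw [e3, e4] at h2
  let c : Fin 9 → Fin 4 → ℤ := ![![1,0,0,0], ![0,0,0,1], ![0,1,0,0], ![0,0,1,0], ![1,0,0,1], ![0,1,1,0], ![1,1,1,0],
    ![1,1,1,0], ![1,1,1,0]]
  let v : Fin 9 → Fin 4 → ℤ := ![0, 0, 0, 0, 0, 0, ![0,1,0,0], 0, ![0,0,0,1]]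
  let b : Fin 9 → Bool := ![true, true, true, true, true, true, false, true, false]
  refine qtab U (fun i => if b i then ev 2 (vv k (c i)) else dv 2 (vv k (c i)) (vv k (v i))) ?_
    ![0,3,1,2,0,1,0,0,3] ![0,3,1,2,3,2,1,2,1] (fun i a a' => if b i then c i a * c i a' else c i a * v i a' + v i a * c i a')
    (fun i a b => by split_ifs; exacts [ev_pr2 _ _ _, dv_pr2 _ _ _ _]) (by decide) (by decide)
  intro i
  fin_cases i
  · exact h1 (ev_mem_Line_left _ _)
  · exact h1 (ev_mem_Line_right _ _)
  · exact h2 (ev_mem_Line_left _ _)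
  · exact h2 (ev_mem_Line_right _ _)
  · exact ev_add_mem h1 (by decide)
  · exact ev_add_mem h2 (by decide)
  · exact h3 (Submodule.mem_sup_left (Submodule.mem_sup_right (Submodule.mem_span_singleton_self _)))
  · exact h3 (Submodule.mem_sup_left (Submodule.mem_sup_left (Submodule.mem_span_singleton_self _)))
  · exact h3 (Submodule.mem_sup_right (Submodule.mem_span_singleton_self _))

end Quad5
end BP

namespace BP
open Module

section Quad6
variable {k : Type} [Field k]

set_option maxHeartbeats 1600000 in
theorem SR4 [CharZero k] : SR k 4 0 7 35 := by
  have : Infinite k := inferInstance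
  let E := (Fin 6 → k × k) × (Fin 3 → k)
  let ep : E → Fin 2 → k × k := fun x => ![x.1 1, x.1 2]
  let ez : E → Fin 4 → k × k := fun x => ![x.1 0, x.1 3, x.1 4, x.1 5]
  let ey : E → XC k (Fin 0) (Fin 4) := fun x => (Fin.elim0, ![(x.1 0, x.1 1), (x.1 1, x.1 2), (x.1 2, x.1 3), (x.1 4, x.1 5)])
  have p1 : ∀ δ, PZ (fun x : E => x.1 δ) := fun δ => PZ.of_lin (fun _ _ => rfl) (fun _ _ => rfl)
  have p8 : ∀ j, PL k (fun x : E => x.2 j) := fun δ => PL.of_lin (fun _ _ => rfl) (fun _ _ => rfl)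
  have pp : ∀ j, PZ (fun x : E => ep x j) := by
    intro j; fin_cases j
    exacts [p1 1, p1 2]
  have pz : ∀ j, PZ (fun x : E => ez x j) := by
    intro j; fin_cases j
    exacts [p1 0, p1 3, p1 4, p1 5]
  have O1 : ZOpen k {x : E | 25 ≤ finrank k ↥(QTr (2+2) x.2 (ep x) (ez x))} :=
    Reg.isZOpen (QTr_reg p8 (fun j => (pp j).1) (fun j => (pp j).2) (fun j => (pz j).1) (fun j => (pz j).2)) 25
  have N1 : {x : E | 25 ≤ finrank k ↥(QTr (2+2) x.2 (ep x) (ez x))}.Nonempty := by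
    obtain ⟨l0, p0, z0, h0⟩ := QTR_dbl (k := k) (e := 1) (z := 4) (Fin 3) (Fin 2) (Fin 4) (by simp) (by simp) (by simp)
    let x0 : E := (![z0 0, p0 0, p0 1, z0 1, z0 2, z0 3], l0)
    have e2 : ep x0 = p0 := by funext j; fin_cases j <;> rfl
    have e3 : ez x0 = z0 := by funext j; fin_cases j <;> rfl
    refine ⟨x0, ?_⟩
    simp only [Set.mem_ofPred_eq]
    rw [e2, e3]
    exact h0
  have O2 : ZOpen k {x : E | 10 ≤ finrank k ↥(WW 2 (ey x))} := by
    refine Reg.isZOpen (WW_reg ey (fun i => i.elim0) (fun i => i.elim0) (fun i => i.elim0) ?_ ?_) 10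
    · intro j; fin_cases j
      exacts [p1 0, p1 1, p1 2, p1 4]
    · intro j; fin_cases j
      exacts [p1 1, p1 2, p1 3, p1 5]
  have N2 : {x : E | 10 ≤ finrank k ↥(WW 2 (ey x))}.Nonempty := by
    let x0 : E := (![(0,0),(1,1),(1,0),(0,1),(2,0),(2,1)], 0)
    refine ⟨x0, ?_⟩
    simp only [Set.mem_ofPred_eq]
    exact chain_rank _ (WW_L 2 (ey x0) 0) (WW_L 2 (ey x0) 1) (WW_L 2 (ey x0) 2) (WW_L 2 (ey x0) 3)
  have O3 : ZOpen k {x : E | ((((x.1 0).1 - (x.1 1).1) * ((x.1 2).1 - (x.1 1).1) * ((x.1 2).2 - (x.1 0).2)) *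
      (((x.1 1).1 - (x.1 2).1) * ((x.1 3).1 - (x.1 2).1) * ((x.1 3).2 - (x.1 1).2))) *
      ((BB (x.1 0) (x.1 1) * BB (x.1 1) (x.1 2)) * (BB (x.1 2) (x.1 3) * BB (x.1 4) (x.1 5))) ≠ 0} := by
    refine ZOpen.ne_zero ?_
    exact (((((p1 0).1.sub (p1 1).1).mul ((p1 2).1.sub (p1 1).1)).mul ((p1 2).2.sub (p1 0).2)).mul
      ((((p1 1).1.sub (p1 2).1).mul ((p1 3).1.sub (p1 2).1)).mul ((p1 3).2.sub (p1 1).2))).mul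
      ((((p1 0).BB (p1 1)).mul ((p1 1).BB (p1 2))).mul (((p1 2).BB (p1 3)).mul ((p1 4).BB (p1 5))))
  obtain ⟨x, ⟨hx1, hx2⟩, hx3⟩ := ZOpen.nonempty_inter (O1.inter O2) O3 (ZOpen.nonempty_inter O1 O2 N1 N2)
    ⟨(![(0,0),(1,1),(2,2),(3,3),(0,0),(1,1)], 0), by
      simp only [Set.mem_ofPred_eq, BB]
      simp
      norm_num⟩
  simp only [Set.mem_ofPred_eq, mul_ne_zero_iff] at hx1 hx2 hx3
  obtain ⟨⟨⟨⟨a1, a2⟩, a3⟩, ⟨a4, a5⟩, a6⟩, ⟨b1, b2⟩, b3, b4⟩ := hx3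
  let out : k → XC k (Fin 0) (Fin 4 ⊕ Fin 3) := fun ε =>
    (Fin.elim0, Sum.elim ![(x.1 0, x.1 1), (((x.1 1).1, (x.1 1).2 + ε), x.1 2), (((x.1 2).1, (x.1 2).2 + ε), x.1 3), (x.1 4, x.1 5)]
      (fun j => ((x.2 j, 0), (x.2 j, 1))))
  have hreg : Reg (fun ε => WW (2+2) (out ε)) := by
    refine WW_reg out (fun i => i.elim0) (fun i => i.elim0) (fun i => i.elim0) ?_ ?_
    · rintro (j | j)
      · fin_cases j
        · exact PZ.const (E := k) (x.1 0)
        · exact ⟨PL.const _, (PL.const _).add (PL.of_lin (fun _ _ => rfl) (fun _ _ => rfl))⟩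
        · exact ⟨PL.const _, (PL.const _).add (PL.of_lin (fun _ _ => rfl) (fun _ _ => rfl))⟩
        · exact PZ.const (E := k) (x.1 4)
      · exact PZ.const (E := k) (x.2 j, 0)
    · rintro (j | j)
      · fin_cases j
        · exact PZ.const (E := k) (x.1 1)
        · exact PZ.const (E := k) (x.1 2)
        · exact PZ.const (E := k) (x.1 3)
        · exact PZ.const (E := k) (x.1 5)
      · exact PZ.const (E := k) (x.2 j, 1)
  have hL1 : ∀ ε, Line (2+2) (ph (x.1 0)) (ph (x.1 1)) ≤ WW (2+2) (out ε) := fun ε => WW_L (2+2) (out ε) (.inl 0)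
  have hL2 : ∀ ε, Line (2+2) (ph ((x.1 1).1, (x.1 1).2 + ε)) (ph (x.1 2)) ≤ WW (2+2) (out ε) := fun ε => WW_L (2+2) (out ε) (.inl 1)
  have hL3 : ∀ ε, Line (2+2) (ph ((x.1 2).1, (x.1 2).2 + ε)) (ph (x.1 3)) ≤ WW (2+2) (out ε) := fun ε => WW_L (2+2) (out ε) (.inl 2)
  have hL4 : ∀ ε, Line (2+2) (ph (x.1 4)) (ph (x.1 5)) ≤ WW (2+2) (out ε) := fun ε => WW_L (2+2) (out ε) (.inl 3)
  obtain ⟨ε, hε⟩ := LimLemma (fun ε => WW (2+2) (out ε)) hreg (ep x) (by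
      intro ε δ; fin_cases δ
      · exact hL1 ε (ev_mem_Line_right _ _)
      · exact hL2 ε (ev_mem_Line_right _ _))
    (by
      intro ε δ; fin_cases δ
      · exact hL2 ε (ev_mem_Line_left _ _)
      · exact hL3 ε (ev_mem_Line_left _ _)) 35 (by
      set W0 := WW (2+2) (out 0) ⊔ ⨆ δ, Submodule.span k {dv (2+2) (ph (ep x δ)) (wy (ep x δ))} with hW0
      have hle : WW (2+2) (out 0) ≤ W0 := le_sup_left
      have hL1' : Line (2+2) (ph (x.1 0)) (ph (x.1 1)) ≤ W0 := (hL1 0).trans hle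
      have hL2' : Line (2+2) (ph (x.1 1)) (ph (x.1 2)) ≤ W0 := by
        have := (hL2 0).trans hle
        simpa only [add_zero, Prod.mk.eta] using this
      have hL3' : Line (2+2) (ph (x.1 2)) (ph (x.1 3)) ≤ W0 := by
        have := (hL3 0).trans hle
        simpa only [add_zero, Prod.mk.eta] using this
      have hL4' : Line (2+2) (ph (x.1 4)) (ph (x.1 5)) ≤ W0 := (hL4 0).trans hle
      have hd : ∀ δ, dv (2+2) (ph (ep x δ)) (wy (ep x δ)) ∈ W0 := fun δ =>
        Submodule.mem_sup_right (Submodule.mem_iSup_of_mem δ (Submodule.mem_span_singleton_self _))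
      have hQT : QTr (2+2) x.2 (ep x) (ez x) ≤ W0 := by
        refine sup_le (sup_le (iSup_le ?_) (iSup_le fun δ => ?_)) (iSup_le ?_)
        · intro j
          exact (WW_L (2+2) (out 0) (.inr j)).trans hle
        · fin_cases δ
          · exact DD_le (x.1 1) (x.1 0) (x.1 2) W0 (by rw [Line_comm]; exact hL1') hL2' (hd 0)
              (mul_ne_zero (mul_ne_zero a1 a2) a3)
          · exact DD_le (x.1 2) (x.1 1) (x.1 3) W0 (by rw [Line_comm]; exact hL2') hL3' (hd 1)
              (mul_ne_zero (mul_ne_zero a4 a5) a6)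
        · intro j; rw [Submodule.span_singleton_le_iff_mem]
          fin_cases j
          · exact hL1' (ev_mem_Line_left _ _)
          · exact hL3' (ev_mem_Line_right _ _)
          · exact hL4' (ev_mem_Line_left _ _)
          · exact hL4' (ev_mem_Line_right _ _)
      have hV : WW 2 (ey x) ≤ W0.map (mulF 2 (qq k)).dualMap := by
        refine sup_le (iSup_le fun δ => δ.elim0) (iSup_le ?_)
        intro j; fin_cases j
        · exact Line_res _ _ b1 W0 hL1'
        · exact Line_res _ _ b2 W0 hL2'
        · exact Line_res _ _ b3 W0 hL3'
        · exact Line_res _ _ b4 W0 hL4'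
      have := QFix0 _ _ _ W0 hQT _ hV
      omega)
  exact SR_mk (out ε) hε (by simp) (by simp)

theorem SR_rul [CharZero k] {d r : ℕ} (hr : r ≤ d + 1) : SR k d 0 r ((d+1)*r) := by
  obtain ⟨l, p, w, h⟩ := QTR_rul (k := k) (d := d) (z := 0) hr (Fin r) (Fin 0) (Fin 0) (by simp) (by simp) (by simp)
  refine SR_mk (T0 := Fin 0) (L0 := Fin r) (Fin.elim0, fun i => ((l i, 0), (l i, 1))) ?_ (by simp) (by simp)
  refine le_trans (le_min ?_ ?_) (h.trans (Submodule.finrank_mono ?_))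
  · exact Nat.mul_le_mul_left _ hr
  · omega
  · refine sup_le (sup_le (iSup_le fun i => ?_) (iSup_le fun i => i.elim0)) (iSup_le fun i => i.elim0)
    exact WW_L d (T := Fin 0) (L := Fin r) (Fin.elim0, fun i => ((l i, 0), (l i, 1))) i

end Quad6
end BP

namespace BP
open Module

section Quad7
variable {k : Type} [Field k]

theorem SR_cast {d d' t t' m m' r r' : ℕ} (h : SR k d t m r) (hd : d = d') (ht : t = t') (hm : m = m') (hr : r' ≤ r) :
    SR k d' t' m' r' := by
  subst hd ht hm
  intro T L _ _ hT hL
  obtain ⟨x, hx⟩ := h T L hT hL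
  exact ⟨x, hr.trans hx⟩

theorem QTR_cast {d d' r r' c c' z z' : ℕ} (h : QTR k d r c z) (hd : d = d') (hr : r = r') (hc : c = c') (hz : z = z') :
    QTR k d' r' c' z' := by
  subst hd hr hc hz
  exact h

theorem E01 [CharZero k] (a : ℕ) : (∀ m, 2*m = (3*a+2)*(a+1) → SR k (3*a) 0 m ((3*a+1)*m)) ∧
    (∀ m, 2*m = (a+1)*(3*a+4) → SR k (3*a+1) 0 m ((3*a+2)*m)) := by
  induction a with
  | zero =>
    refine ⟨fun m hm => ?_, fun m hm => ?_⟩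
    · obtain rfl : m = 1 := by omega
      exact SR_rul (d := 0) (r := 1) le_rfl
    · obtain rfl : m = 2 := by omega
      exact SR_rul (d := 1) (r := 2) le_rfl
  | succ a ih =>
    refine ⟨fun m hm => ?_, fun m hm => ?_⟩
    · obtain ⟨m', hm'⟩ : ∃ m', m = m' + (2*a+3) := by
        refine ⟨m - (2*a+3), ?_⟩
        have : 2*(2*a+3) ≤ 2*m := by rw [hm]; nlinarith
        omega
      subst hm'
      have h2 : 2*m' = (a+1)*(3*a+4) := by nlinarith
      have := qstep (t := 0) (l := m') (i := 2*a+3) (by omega) (ih.2 m' h2) (QTR_rul (by omega))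
      refine SR_cast this (by omega) rfl (by omega) ?_
      rw [min_eq_left (by nlinarith)]
      nlinarith
    · rcases Nat.eq_zero_or_pos a with rfl | ha
      · obtain rfl : m = 7 := by omega
        exact SR4
      obtain ⟨b, rfl⟩ : ∃ b, a = b + 1 := ⟨a - 1, by omega⟩
      -- here a = b+1, e = b+2
      obtain ⟨l, hl⟩ : ∃ l, 2 * l = (b+2)*(3*b+1) := by
        have : 2 ∣ (b+2)*(3*b+1) := by
          rcases Nat.even_or_odd b with ⟨c, hc⟩ | ⟨c, hc⟩
          · exact Dvd.dvd.mul_right ⟨c+1, by omega⟩ _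
          · exact Dvd.dvd.mul_left ⟨3*c+2, by omega⟩ _
        obtain ⟨l, hl⟩ := this
        exact ⟨l, hl.symm⟩
      have h1 := ih.1 (2*(b+2) + l) (by nlinarith)
      have h2 := qstep (t := 2*(b+2)) (l := l) (i := 1) rfl h1 (QTR_rul (by omega))
      have h3 := qstep (t := 0) (l := l+1) (i := 2*(b+2)+1) (by omega) h2
        (QTR_cast (QTR_dbl (e := b+2) (z := 2*(l+1) + 2*(2*(b+2)))) (by omega) (by omega) (by omega) (by omega))
      refine SR_cast h3 (by omega) rfl (by nlinarith) ?_
      rw [min_eq_left (by nlinarith), min_eq_left (by nlinarith)]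
      nlinarith

theorem choose_formula3 (d : ℕ) : 6 * (3+d).choose 3 = (d+1)*(d+2)*(d+3) := by
  have h := Nat.add_one_mul_choose_eq (d+2) 2
  have h2 := tri_formula d
  rw [show 3 + d = d + 2 + 1 by ring]
  norm_num at h
  nlinarith

theorem HL_of {d m m' : ℕ} (h1 : SR k d 0 m ((3+d).choose 3)) (h2 : SR k d 0 m' ((d+1)*m')) (hm : m ≤ m' + 1) :
    HL k 4 d := by
  classical
  intro J _
  rw [finrank_Fm 3 d]
  by_cases hJ : m ≤ Fintype.card J
  · obtain ⟨x, hx⟩ := h1 (Fin 0) (Fin m) (by simp) (by simp)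
    have hc : Fintype.card (Fin m) ≤ Fintype.card J := by simpa using hJ
    obtain ⟨f⟩ : Nonempty (Fin m ↪ J) := Function.Embedding.nonempty_of_card_le hc
    let y : J → (Fin 4 → k) × (Fin 4 → k) := fun j => if h : ∃ i, f i = j then (ph (x.2 h.choose).1, ph (x.2 h.choose).2) else 0
    have hy : ∀ i, y (f i) = (ph (x.2 i).1, ph (x.2 i).2) := by
      intro i
      have h : ∃ i', f i' = f i := ⟨i, rfl⟩
      have : h.choose = i := f.injective h.choose_spec
      simp only [y, dif_pos h]
      rw [this]
    refine ⟨y, le_trans (min_le_left _ _) (hx.trans (Submodule.finrank_mono ?_))⟩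
    refine sup_le (iSup_le fun i => i.elim0) (iSup_le fun i => ?_)
    refine le_trans (le_of_eq ?_) (le_iSup (fun j => Line d (y j).1 (y j).2) (f i))
    simp only [hy]
  · obtain ⟨c, hc⟩ : ∃ c, m' = Fintype.card J + c := ⟨m' - Fintype.card J, by omega⟩
    obtain ⟨x, hx⟩ := h2 (Fin 0) (J ⊕ Fin c) (by simp) (by simp [hc])
    refine ⟨fun j => (ph (x.2 (.inl j)).1, ph (x.2 (.inl j)).2), le_trans (min_le_right _ _) ?_⟩
    have h3 : WW d x ≤ (⨆ j, Line d (ph (x.2 (.inl j)).1) (ph (x.2 (.inl j)).2)) ⊔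
        ⨆ i, Line d (ph (x.2 (.inr i)).1) (ph (x.2 (.inr i)).2) := by
      refine sup_le (iSup_le fun i => i.elim0) (iSup_le ?_)
      rintro (j | j)
      · exact le_sup_of_le_left (le_iSup (fun j => Line d (ph (x.2 (.inl j)).1) (ph (x.2 (.inl j)).2)) j)
      · exact le_sup_of_le_right (le_iSup (fun j => Line d (ph (x.2 (.inr j)).1) (ph (x.2 (.inr j)).2)) j)
    have h4 := Submodule.finrank_mono h3
    have h5 := Submodule.finrank_add_le_finrank_add_finrank (⨆ j, Line d (ph (x.2 (.inl j)).1) (ph (x.2 (.inl j)).2))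
      (⨆ i, Line d (ph (x.2 (.inr i)).1) (ph (x.2 (.inr i)).2))
    have h6 := finrank_iSup_le (fun i : Fin c => Line d (ph (x.2 (.inr i)).1) (ph (x.2 (.inr i)).2)) (d+1)
      (fun i => Line_rank_le _ _)
    rw [Fintype.card_fin] at h6
    subst hc
    rw [mul_add] at hx
    simp only
    omega

theorem HL4 [CharZero k] (d : ℕ) : HL k 4 d := by
  have hN := choose_formula3 d
  generalize hNN : (3+d).choose 3 = N at hN
  obtain ⟨a, ha⟩ : ∃ a, d = 3*a ∨ d = 3*a+1 ∨ d = 3*a+2 := ⟨d/3, by omega⟩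
  have even0 : ∃ m, 2*m = (3*a+2)*(a+1) := by
    have : 2 ∣ (3*a+2)*(a+1) := by
      rcases Nat.even_or_odd a with ⟨c, hc⟩ | ⟨c, hc⟩
      · exact Dvd.dvd.mul_right ⟨3*c+1, by omega⟩ _
      · exact Dvd.dvd.mul_left ⟨c+1, by omega⟩ _
    obtain ⟨l, hl⟩ := this
    exact ⟨l, hl.symm⟩
  have even1 : ∃ m, 2*m = (a+1)*(3*a+4) := by
    have : 2 ∣ (a+1)*(3*a+4) := by
      rcases Nat.even_or_odd a with ⟨c, hc⟩ | ⟨c, hc⟩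
      · exact Dvd.dvd.mul_left ⟨3*c+2, by omega⟩ _
      · exact Dvd.dvd.mul_right ⟨c+1, by omega⟩ _
    obtain ⟨l, hl⟩ := this
    exact ⟨l, hl.symm⟩
  rcases ha with rfl | rfl | rfl
  · obtain ⟨m, hm⟩ := even0
    have h := (E01 (k := k) a).1 m hm
    refine HL_of (SR_cast h rfl rfl rfl ?_) h (by omega)
    rw [hNN]
    nlinarith
  · obtain ⟨m, hm⟩ := even1
    have h := (E01 (k := k) a).2 m hm
    refine HL_of (SR_cast h rfl rfl rfl ?_) h (by omega)
    rw [hNN]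
    nlinarith
  · obtain ⟨m, hm⟩ := even0
    have h := (E01 (k := k) a).1 m hm
    have h1 := qstep (t := 0) (l := m) (i := 2*a+3) (by omega) h (QTR_rul (by omega))
    have h2 := qstep (t := 0) (l := m) (i := 2*a+2) (by omega) h (QTR_rul (by omega))
    refine HL_of (m := m + (2*a+3)) (m' := m + (2*a+2)) (SR_cast h1 rfl rfl (by omega) ?_)
      (SR_cast h2 rfl rfl (by omega) ?_) (by omega)
    · rw [hNN, min_eq_left (by nlinarith)]
      nlinarith
    · rw [min_eq_right (by nlinarith)]
      nlinarith

set_option maxHeartbeats 1600000 in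
theorem TR4 [CharZero k] : TR k 4 4 5 3 1 := by
  have : Infinite k := inferInstance
  let E := (Fin 2 → k × k) × (Fin 4 → k × k) × (Fin 3 → k)
  have p1 : ∀ δ, PZ (fun x : E => x.1 δ) := fun δ => PZ.of_lin (fun _ _ => rfl) (fun _ _ => rfl)
  have p2 : ∀ δ, PZ (fun x : E => x.2.1 δ) := fun δ => PZ.of_lin (fun _ _ => rfl) (fun _ _ => rfl)
  have p8 : ∀ j, PL k (fun x : E => x.2.2 j) := fun δ => PL.of_lin (fun _ _ => rfl) (fun _ _ => rfl)
  have O1 : ZOpen k {x : E | 25 ≤ finrank k ↥(QTr (2+2) x.2.2 x.1 x.2.1)} :=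
    Reg.isZOpen (QTr_reg p8 (fun j => (p1 j).1) (fun j => (p1 j).2) (fun j => (p2 j).1) (fun j => (p2 j).2)) 25
  have N1 : {x : E | 25 ≤ finrank k ↥(QTr (2+2) x.2.2 x.1 x.2.1)}.Nonempty := by
    obtain ⟨l0, p0, z0, h0⟩ := QTR_dbl (k := k) (e := 1) (z := 4) (Fin 3) (Fin 2) (Fin 4) (by simp) (by simp) (by simp)
    exact ⟨(p0, z0, l0), h0⟩
  let PP (d : ℕ) := PD d (vv k ![1,1,1,0]) (vv k ![0,1,0,0]) (vv k ![0,0,0,1])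
  let RR : E → Submodule k (Dual k (Fm k 4 2)) := fun x =>
    Line 2 (ph (x.2.1 0)) (ph (x.2.1 1)) ⊔ Line 2 (ph (x.2.1 2)) (ph (x.2.1 3)) ⊔ PP 2
  have O2 : ZOpen k {x : E | 9 ≤ finrank k ↥(RR x)} := by
    refine Reg.isZOpen (Reg.sup (Reg.sup (Line_reg (p2 0).ph (p2 1).ph) (Line_reg (p2 2).ph (p2 3).ph)) ?_) 9
    exact Reg.sup (Reg.sup (Reg.single (ev_PLs fun i => PL.const _)) (Reg.single (dv_PLs (fun i => PL.const _) (fun i => PL.const _))))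
      (Reg.single (dv_PLs (fun i => PL.const _) (fun i => PL.const _)))
  have N2 : {x : E | 9 ≤ finrank k ↥(RR x)}.Nonempty := by
    refine ⟨(0, ![(0,0),(1,1),(1,0),(0,1)], 0), ?_⟩
    simp only [Set.mem_ofPred_eq]
    exact res9_rank _ (le_sup_of_le_left le_sup_left) (le_sup_of_le_left le_sup_right) le_sup_right
  have O3 : ZOpen k {x : E | BB (x.2.1 0) (x.2.1 1) * BB (x.2.1 2) (x.2.1 3) ≠ 0} :=
    ZOpen.ne_zero (((p2 0).BB (p2 1)).mul ((p2 2).BB (p2 3)))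
  obtain ⟨x, ⟨hx1, hx2⟩, hx3⟩ := ZOpen.nonempty_inter (O1.inter O2) O3 (ZOpen.nonempty_inter O1 O2 N1 N2)
    ⟨(0, ![(0,0),(1,1),(0,0),(1,1)], 0), by
      simp only [Set.mem_ofPred_eq, BB]
      simp⟩
  simp only [Set.mem_ofPred_eq, mul_ne_zero_iff] at hx1 hx2 hx3
  obtain ⟨b1, b2⟩ := hx3
  intro A D Z _ _ _ hA hD hZ
  let lA0 : Fin 2 ⊕ Fin 3 → (Fin 4 → k) × (Fin 4 → k) := Sum.elim ![(ph (x.2.1 0), ph (x.2.1 1)), (ph (x.2.1 2), ph (x.2.1 3))]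
    (fun j => (ph (x.2.2 j, 0), ph (x.2.2 j, 1)))
  let lD0 : Fin 2 ⊕ Fin 1 → (Fin 4 → k) × (Fin 4 → k) × (Fin 4 → k) := Sum.elim (fun i => (ph (x.1 i), wx (x.1 i), wy (x.1 i)))
    (fun _ => (vv k ![1,1,1,0], vv k ![0,1,0,0], vv k ![0,0,0,1]))
  let eA : A ≃ Fin 2 ⊕ Fin 3 := Fintype.equivOfCardEq (by simp [hA])
  let eD : D ≃ Fin 2 ⊕ Fin 1 := Fintype.equivOfCardEq (by simp [hD])
  let lA : A → (Fin 4 → k) × (Fin 4 → k) := fun a => lA0 (eA a)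
  let lD : D → (Fin 4 → k) × (Fin 4 → k) × (Fin 4 → k) := fun a => lD0 (eD a)
  let W : Submodule k (Dual k (Fm k 4 (2+2))) := (⨆ i, Line (2+2) (lA i).1 (lA i).2) ⊔ ⨆ i, PD (2+2) (lD i).1 (lD i).2.1 (lD i).2.2
  have hWA : ∀ i, Line (2+2) (lA0 i).1 (lA0 i).2 ≤ W := by
    intro i
    have := le_iSup (fun i => Line (2+2) (lA i).1 (lA i).2) (eA.symm i)
    simp only [lA, Equiv.apply_symm_apply] at this
    exact le_sup_of_le_left this
  have hWD : ∀ i, PD (2+2) (lD0 i).1 (lD0 i).2.1 (lD0 i).2.2 ≤ W := by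
    intro i
    have := le_iSup (fun i => PD (2+2) (lD i).1 (lD i).2.1 (lD i).2.2) (eD.symm i)
    simp only [lD, Equiv.apply_symm_apply] at this
    exact le_sup_of_le_right this
  have hL1 : Line (2+2) (ph (x.2.1 0)) (ph (x.2.1 1)) ≤ W := hWA (.inl 0)
  have hL2 : Line (2+2) (ph (x.2.1 2)) (ph (x.2.1 3)) ≤ W := hWA (.inl 1)
  have hP : PP (2+2) ≤ W := hWD (.inr 0)
  have hQT : QTr (2+2) x.2.2 x.1 x.2.1 ≤ W := by
    refine sup_le (sup_le (iSup_le ?_) (iSup_le fun δ => ?_)) (iSup_le ?_)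
    · intro j
      exact hWA (.inr j)
    · exact hWD (.inl δ)
    · intro j; rw [Submodule.span_singleton_le_iff_mem]
      fin_cases j
      · exact hL1 (ev_mem_Line_left _ _)
      · exact hL1 (ev_mem_Line_right _ _)
      · exact hL2 (ev_mem_Line_left _ _)
      · exact hL2 (ev_mem_Line_right _ _)
  have hq : ev 2 (vv k ![1,1,1,0]) (qq k) = -1 ∨ ev 2 (vv k ![1,1,1,0]) (qq k) = 1 ∨ ev 2 (vv k ![1,1,1,0]) (qq k) = 2:= by
    rw [ev_qq]; simp [vv]
  have hq0 : ev 2 (vv k ![1,1,1,0]) (qq k) ≠ 0 := by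
    rcases hq with h | h | h <;> rw [h] <;> norm_num
  have hV : RR x ≤ W.map (mulF 2 (qq k)).dualMap := by
    refine sup_le (sup_le (Line_res _ _ b1 W hL1) (Line_res _ _ b2 W hL2)) ?_
    set W' := W.map (mulF 2 (qq k)).dualMap with hW'
    have g1 : ev 2 (vv k ![1,1,1,0]) ∈ W' := by
      have h1 := Submodule.mem_map_of_mem (f := (mulF 2 (qq k)).dualMap)
        (hP (Submodule.mem_sup_left (Submodule.mem_sup_left (Submodule.mem_span_singleton_self _))))
      rw [mulF_ev] at h1
      exact (Submodule.smul_mem_iff _ hq0).1 h1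
    have g2 : ∀ v : Fin 4 → k, dv (2+2) (vv k ![1,1,1,0]) v ∈ W → dv 2 (vv k ![1,1,1,0]) v ∈ W' := by
      intro v hv
      have h1 := Submodule.mem_map_of_mem (f := (mulF 2 (qq k)).dualMap) hv
      rw [mulF_dv] at h1
      have h2 := Submodule.sub_mem _ h1 (Submodule.smul_mem _ (dv 2 (vv k ![1,1,1,0]) v (qq k)) g1)
      rw [add_sub_cancel_right] at h2
      exact (Submodule.smul_mem_iff _ hq0).1 h2
    refine sup_le (sup_le ?_ ?_) ?_ <;> rw [Submodule.span_singleton_le_iff_mem]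
    · exact g1
    · exact g2 _ (hP (Submodule.mem_sup_left (Submodule.mem_sup_right (Submodule.mem_span_singleton_self _))))
    · exact g2 _ (hP (Submodule.mem_sup_right (Submodule.mem_span_singleton_self _)))
  have hW := QFix0 _ _ _ W hQT _ hV
  obtain ⟨z, hz⟩ := add_generic' (fun v : Fin 4 → k => ev (2+2) v) (span_ev 4 (2+2)) 0 W Z
  refine ⟨(lA, lD, z), le_trans ?_ hz⟩
  rw [finrank_Fm 3, hZ]
  have : (3+4).choose 3 = 35 := by decide
  rw [this]
  change _ ≤ min ((3+4).choose 3) _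
  rw [this]
  omega

theorem HP_main [CharZero k] (n : ℕ) (hn : 4 ≤ n) (d : ℕ) (hd : 1 ≤ d) : HP k n 1 d :=
  HP_final (fun d _ => HL4 d) TR4 n hn d hd

end Quad7
end BP

namespace BP
open Module

section Final
variable {k : Type} [Field k]

noncomputable def mn {ι : Type} [Fintype ι] [DecidableEq ι] {N : ℕ} (f : ι → Fin N) (v : ι → Fin N → k) : k :=
  (Matrix.of fun i j => v i (f j)).det

theorem mn_PL {E : Type} [AddCommGroup E] [Module k E] {ι : Type} [Fintype ι] [DecidableEq ι] {N : ℕ} (f : ι → Fin N)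
    {v : E → ι → Fin N → k} (h : ∀ i j, PL k (fun x => v x i j)) : PL k (fun x => mn f (v x)) := by
  simp only [mn, Matrix.det_apply']
  exact PL.sum _ fun σ => (PL.const _).mul (PL.prod _ fun i => h _ _)

theorem li_of_mn {ι : Type} [Fintype ι] [DecidableEq ι] {N : ℕ} {f : ι → Fin N} {v : ι → Fin N → k} (h : mn f v ≠ 0) :
    LinearIndependent k v :=
  LinearIndependent.of_comp (LinearMap.funLeft k k f) (Matrix.linearIndependent_rows_of_det_ne_zero h)

theorem mn_one {ι : Type} [Fintype ι] [DecidableEq ι] {N : ℕ} {f : ι → Fin N} (hf : Function.Injective f) :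
    mn f (fun i => Pi.single (f i) (1 : k)) ≠ 0 := by
  have : (Matrix.of fun i j => (Pi.single (f i) (1 : k) : Fin N → k) (f j)) = 1 := by
    ext i j
    simp [Matrix.one_apply, Pi.single_apply, hf.eq_iff, eq_comm]
  rw [mn, this, Matrix.det_one]
  exact one_ne_zero

theorem Flat_coann {N r d : ℕ} (a : Fin r → Fin N → k) (f : Fm k N d) :
    (∀ φ ∈ Flat d a, φ f = 0) ↔ f.1 ∈ vanIdeal k N ↑(Submodule.span k (Set.range a)) := by
  constructor
  · intro h v hv
    obtain ⟨c, rfl⟩ := (Submodule.mem_span_range_iff_exists_fun k).1 hv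
    have := h _ (Submodule.subset_span ⟨c, rfl⟩)
    rwa [ev_apply] at this
  · intro h φ hφ
    have : Flat d a ≤ LinearMap.ker (LinearMap.applyₗ (R := k) (M₂ := k) f) := by
      refine Submodule.span_le.2 ?_
      rintro _ ⟨c, rfl⟩
      change ev d _ f = 0
      rw [ev_apply]
      exact h _ ((Submodule.mem_span_range_iff_exists_fun k).2 ⟨c, rfl⟩)
    exact this hφ

theorem hdim_eq {n d s : ℕ} (p : Fin 3 → Fin (n+1) → k) (y : Fin s → (Fin (n+1) → k) × (Fin (n+1) → k)) :
    finrank k ↥((Flat d p) ⊔ ⨆ i, Line d (y i).1 (y i).2) +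
    hdim k (n+1) (vanIdeal k (n+1) ↑(Submodule.span k (Set.range p)) ⊓
      ⨅ i, vanIdeal k (n+1) ↑(Submodule.span k (Set.range ![(y i).1, (y i).2]))) d = (n+d).choose n := by
  set W := (Flat d p) ⊔ ⨆ i, Line d (y i).1 (y i).2 with hW
  have h1 := Subspace.finrank_add_finrank_dualCoannihilator_eq W
  rw [finrank_Fm] at h1
  rw [← h1, ← Submodule.finrank_map_subtype_eq]
  congr 1
  unfold hdim
  have e : Submodule.restrictScalars k (vanIdeal k (n+1) ↑(Submodule.span k (Set.range p)) ⊓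
      ⨅ i, vanIdeal k (n+1) ↑(Submodule.span k (Set.range ![(y i).1, (y i).2])) :
      Submodule (MvPolynomial (Fin (n+1)) k) (MvPolynomial (Fin (n+1)) k))
      ⊓ MvPolynomial.homogeneousSubmodule (Fin (n+1)) k d =
      Submodule.map (homogeneousSubmodule (Fin (n+1)) k d).subtype W.dualCoannihilator := by
    have key : ∀ f : Fm k (n+1) d, f ∈ W.dualCoannihilator ↔ f.1 ∈ vanIdeal k (n+1) ↑(Submodule.span k (Set.range p)) ∧
        ∀ i, f.1 ∈ vanIdeal k (n+1) ↑(Submodule.span k (Set.range ![(y i).1, (y i).2])) := by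
      intro f
      rw [Submodule.mem_dualCoannihilator]
      constructor
      · intro h
        refine ⟨(Flat_coann p f).1 fun φ hφ => h φ (Submodule.mem_sup_left hφ), fun i => (Flat_coann _ f).1 fun φ hφ =>
          h φ (Submodule.mem_sup_right (Submodule.mem_iSup_of_mem i hφ))⟩
      · rintro ⟨h1, h2⟩ φ hφ
        have : W ≤ LinearMap.ker (LinearMap.applyₗ (R := k) (M₂ := k) f) :=
          sup_le (fun φ hφ => (Flat_coann p f).2 h1 φ hφ) (iSup_le fun i φ hφ => (Flat_coann _ f).2 (h2 i) φ hφ)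
        exact this hφ
    ext g
    simp only [Submodule.mem_inf, Submodule.restrictScalars_mem, Submodule.mem_iInf, Submodule.mem_map]
    constructor
    · rintro ⟨h, hg⟩
      exact ⟨⟨g, hg⟩, (key ⟨g, hg⟩).2 h, rfl⟩
    · rintro ⟨f, hf, rfl⟩
      exact ⟨(key f).1 hf, f.2⟩
  rw [e]

theorem main_exists [CharZero k] (n d s : ℕ) (hn : 4 ≤ n) (hd : 1 ≤ d) :
    ∃ (p : Fin 3 → Fin (n+1) → k) (y : Fin s → (Fin (n+1) → k) × (Fin (n+1) → k)),
      LinearIndependent k p ∧ (∀ i, LinearIndependent k (Sum.elim ![(y i).1, (y i).2] p)) ∧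
      (∀ i j, i ≠ j → LinearIndependent k (Sum.elim ![(y i).1, (y i).2] ![(y j).1, (y j).2])) ∧
      min ((n+d).choose n) ((d+2).choose 2 + (d+1) * s) ≤ finrank k ↥((Flat d p) ⊔ ⨆ i, Line d (y i).1 (y i).2) := by
  have : Infinite k := inferInstance
  let E := (Fin 3 → Fin (n+1) → k) × (Fin s → (Fin (n+1) → k) × (Fin (n+1) → k))
  have p1 : ∀ i j, PL k (fun x : E => x.1 i j) := fun i j => PL.of_lin (fun _ _ => rfl) (fun _ _ => rfl)
  have p2 : ∀ i j, PL k (fun x : E => (x.2 i).1 j) := fun i j => PL.of_lin (fun _ _ => rfl) (fun _ _ => rfl)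
  have p3 : ∀ i j, PL k (fun x : E => (x.2 i).2 j) := fun i j => PL.of_lin (fun _ _ => rfl) (fun _ _ => rfl)
  have p4 : ∀ m (i : Fin 2) j, PL k (fun x : E => (![(x.2 m).1, (x.2 m).2] : Fin 2 → Fin (n+1) → k) i j) := by
    intro m i j; fin_cases i
    exacts [p2 m j, p3 m j]
  obtain ⟨f3⟩ : Nonempty (Fin 3 ↪ Fin (n+1)) := Function.Embedding.nonempty_of_card_le (by simp; omega)
  obtain ⟨f5⟩ : Nonempty (Fin 2 ⊕ Fin 3 ↪ Fin (n+1)) := Function.Embedding.nonempty_of_card_le (by simp; omega)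
  obtain ⟨f4⟩ : Nonempty (Fin 2 ⊕ Fin 2 ↪ Fin (n+1)) := Function.Embedding.nonempty_of_card_le (by simp; omega)
  have O1 : ZOpen k {x : E | mn f3 x.1 ≠ 0} := ZOpen.ne_zero (mn_PL _ p1)
  have N1 : {x : E | mn f3 x.1 ≠ 0}.Nonempty := ⟨(fun i => Pi.single (f3 i) 1, 0), mn_one f3.injective⟩
  let S2 : Fin s → Set E := fun i => {x : E | mn f5 (Sum.elim ![(x.2 i).1, (x.2 i).2] x.1) ≠ 0}
  have O2 : ∀ i, ZOpen k (S2 i) := by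
    intro i
    refine ZOpen.ne_zero (mn_PL _ ?_)
    rintro (a | a) j
    exacts [p4 i a j, p1 a j]
  have N2 : ∀ i, (S2 i).Nonempty := by
    intro i
    let x0 : E := (fun a => Pi.single (f5 (.inr a)) 1, fun _ => (Pi.single (f5 (.inl 0)) 1, Pi.single (f5 (.inl 1)) 1))
    refine ⟨x0, ?_⟩
    have e : Sum.elim ![(x0.2 i).1, (x0.2 i).2] x0.1 = fun a => Pi.single (f5 a) (1 : k) := by
      funext a; rcases a with a | a
      · fin_cases a <;> rfl
      · rfl
    simp only [S2, Set.mem_ofPred_eq]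
    rw [e]
    exact mn_one f5.injective
  let S3 : {q : Fin s × Fin s // q.1 ≠ q.2} → Set E := fun q =>
    {x : E | mn f4 (Sum.elim ![(x.2 q.1.1).1, (x.2 q.1.1).2] ![(x.2 q.1.2).1, (x.2 q.1.2).2]) ≠ 0}
  have O3 : ∀ i, ZOpen k (S3 i) := by
    intro i
    refine ZOpen.ne_zero (mn_PL _ ?_)
    rintro (a | a) j
    exacts [p4 _ a j, p4 _ a j]
  have N3 : ∀ i, (S3 i).Nonempty := by
    rintro ⟨⟨i, j⟩, hij⟩
    let x0 : E := (0, fun m => if m = i then (Pi.single (f4 (.inl 0)) 1, Pi.single (f4 (.inl 1)) 1) else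
      (Pi.single (f4 (.inr 0)) 1, Pi.single (f4 (.inr 1)) 1))
    have hi : x0.2 i = (Pi.single (f4 (.inl 0)) 1, Pi.single (f4 (.inl 1)) 1) := if_pos rfl
    have hj : x0.2 j = (Pi.single (f4 (.inr 0)) 1, Pi.single (f4 (.inr 1)) 1) := if_neg (Ne.symm hij)
    refine ⟨x0, ?_⟩
    have e : Sum.elim ![(x0.2 i).1, (x0.2 i).2] ![(x0.2 j).1, (x0.2 j).2] = fun a => Pi.single (f4 a) (1 : k) := by
      rw [hi, hj]
      funext a; rcases a with a | a <;> fin_cases a <;> rfl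
    simp only [S3, Set.mem_ofPred_eq]
    rw [e]
    exact mn_one f4.injective
  let U : E → Submodule k (Dual k (Fm k (n+1) d)) := fun x => Flat d x.1 ⊔ ⨆ i, Line d (x.2 i).1 (x.2 i).2
  have O4 : ZOpen k {x : E | min ((n+d).choose n) ((d+2).choose 2 + (d+1) * s) ≤ finrank k ↥(U x)} :=
    Reg.isZOpen (Reg.sup (Flat_reg p1) (Reg.iSup fun i => Line_reg (p2 i) (p3 i))) _
  have N4 : {x : E | min ((n+d).choose n) ((d+2).choose 2 + (d+1) * s) ≤ finrank k ↥(U x)}.Nonempty := by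
    obtain ⟨x, y, h⟩ := HP_main (k := k) n hn d hd (Fin 1) (Fin s) (by simp)
    refine ⟨(x 0, y), ?_⟩
    simp only [Set.mem_ofPred_eq]
    rw [one_mul, Fintype.card_fin] at h
    refine h.trans (Submodule.finrank_mono (sup_le (iSup_le fun i => ?_) le_sup_right))
    rw [Subsingleton.elim i 0]
    exact le_sup_left
  obtain ⟨x, ⟨h1, h2⟩, h3, h4⟩ := ZOpen.nonempty_inter (O1.inter (ZOpen.forall O2)) ((ZOpen.forall O3).inter O4)
    (ZOpen.nonempty_inter O1 (ZOpen.forall O2) N1 (ZOpen.forall_nonempty O2 N2))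
    (ZOpen.nonempty_inter (ZOpen.forall O3) O4 (ZOpen.forall_nonempty O3 N3) N4)
  exact ⟨x.1, x.2, li_of_mn h1, fun i => li_of_mn (h2 i), fun i j hij => li_of_mn (h3 ⟨(i, j), hij⟩), h4⟩

end Final
end BP

/-- A generic union of one plane and `s` generic lines in `ℙ^n` (`n ≥ 4`) has
bipolynomial Hilbert function. -/
theorem stmt0 (k : Type) [Field k] [IsAlgClosed k] [CharZero k]
    (n d s : ℕ) (hn : 4 ≤ n) (hd : 1 ≤ d) :
    ∃ (Pl : Submodule k (Fin (n+1) → k)) (L : Fin s → Submodule k (Fin (n+1) → k)),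
      Module.finrank k Pl = 3 ∧
      (∀ i, Module.finrank k (L i) = 2) ∧
      (∀ i j, i ≠ j → L i ⊓ L j = ⊥) ∧
      (∀ i, L i ⊓ Pl = ⊥) ∧
      (hdim k (n+1) (vanIdeal k (n+1) ↑Pl ⊓ ⨅ i, vanIdeal k (n+1) ↑(L i)) d : ℤ)
        = max (((d+n).choose n : ℤ) - ((d+2).choose 2 : ℤ) - s * (d+1)) 0 := by
  obtain ⟨p, y, h1, h2, h3, h4⟩ := BP.main_exists (k := k) n d s hn hd
  refine ⟨Submodule.span k (Set.range p), fun i => Submodule.span k (Set.range ![(y i).1, (y i).2]), ?_, ?_, ?_, ?_, ?_⟩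
  · simpa using finrank_span_eq_card h1
  · intro i
    exact (finrank_span_eq_card (linearIndependent_sum.1 (h2 i)).1).trans (Fintype.card_fin 2)
  · intro i j hij
    exact disjoint_iff.1 (linearIndependent_sum.1 (h3 i j hij)).2.2
  · intro i
    exact disjoint_iff.1 (linearIndependent_sum.1 (h2 i)).2.2
  · have h5 := BP.hdim_eq (d := d) p y
    have h6 : Module.finrank k ↥(BP.Flat d p ⊔ ⨆ i, BP.Line d (y i).1 (y i).2) ≤ (d+2).choose 2 + (d+1) * s := by
      refine (Submodule.finrank_add_le_finrank_add_finrank _ _).trans (add_le_add ?_ ?_)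
      · refine (BP.Flat_rank_le (r := 2) p).trans (le_of_eq ?_)
        rw [add_comm]
      · simpa using BP.finrank_iSup_le (fun i => BP.Line d (y i).1 (y i).2) (d+1) (fun i => BP.Line_rank_le _ _)
    rw [add_comm d n, mul_comm (s : ℤ)]
    generalize hdim k (n+1) _ d = hh at h5 ⊢
    generalize Module.finrank k ↥(BP.Flat d p ⊔ ⨆ i, BP.Line d (y i).1 (y i).2) = r at *
    have e : ((d : ℤ) + 1) * s = (((d+1) * s : ℕ) : ℤ) := by push_cast; ring
    rw [e]
    generalize (d+1) * s = q at *
    omega
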